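/- Suppose the structure on ℝ is d-minimal and let p be a positive integer. Then every definable closed subset of ℝⁿ is the zero set of some definable C^p function ℝⁿ → ℝ. -/

import Mathlib

open FirstOrder Set Filter Topology
open scoped Classical

noncomputable section

namespace DMinPaper

variable (L : FirstOrder.Language) [L.Structure ℝ]

/-- A subset of `ℝ^α` is definable (with parameters from `ℝ`) in the structure `L`. -/
def IsDef {α : Type} (s : Set (α → ℝ)) : Prop :=
  (Set.univ : Set ℝ).Definable L s

/-- Definability of an `ℝ`-valued function on a subset `M ⊆ ℝ^α`, via its graph. -/
def IsDefFunOn {α : Type} (M : Set (α → ℝ)) (f : (α → ℝ) → ℝ) : Prop :=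
  IsDef L {z : (α ⊕ Unit) → ℝ |
    (fun i => z (Sum.inl i)) ∈ M ∧ z (Sum.inr ()) = f (fun i => z (Sum.inl i))}

/-- Definability of a map `M → ℝ^β` on a subset `M ⊆ ℝ^α`, via its graph. -/
def IsDefMapOn {α β : Type} (M : Set (α → ℝ)) (f : (α → ℝ) → (β → ℝ)) : Prop :=
  IsDef L {z : (α ⊕ β) → ℝ |
    (fun i => z (Sum.inl i)) ∈ M ∧ (fun j => z (Sum.inr j)) = f (fun i => z (Sum.inl i))}

/-- Definability of an `ℝ`-valued function on a subset of a product `ℝ^α × ℝ^β`. -/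
def IsDefFun2On {α β : Type} (S : Set ((α → ℝ) × (β → ℝ)))
    (f : (α → ℝ) × (β → ℝ) → ℝ) : Prop :=
  IsDef L {z : ((α ⊕ β) ⊕ Unit) → ℝ |
    ((fun i => z (Sum.inl (Sum.inl i)), fun j => z (Sum.inl (Sum.inr j))) ∈ S) ∧
    z (Sum.inr ()) = f (fun i => z (Sum.inl (Sum.inl i)), fun j => z (Sum.inl (Sum.inr j)))}

/-- Definability of a map into `ℝ^γ` on a subset of a product `ℝ^α × ℝ^β`. -/
def IsDefMap2On {α β γ : Type} (S : Set ((α → ℝ) × (β → ℝ)))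
    (f : (α → ℝ) × (β → ℝ) → (γ → ℝ)) : Prop :=
  IsDef L {z : ((α ⊕ β) ⊕ γ) → ℝ |
    ((fun i => z (Sum.inl (Sum.inl i)), fun j => z (Sum.inl (Sum.inr j))) ∈ S) ∧
    (fun l => z (Sum.inr l)) = f (fun i => z (Sum.inl (Sum.inl i)), fun j => z (Sum.inl (Sum.inr j)))}

/-- Definability of a function `ℝ → ℝ`, via its graph. -/
def IsDefFunR (f : ℝ → ℝ) : Prop :=
  IsDef L {z : Fin 2 → ℝ | z 1 = f (z 0)}

/-- The structure expands the ordered field of real numbers: the order, addition and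
multiplication are definable. -/
def ExpandsOrderedField : Prop :=
  IsDef L {x : Fin 2 → ℝ | x 0 < x 1} ∧
  IsDef L {x : Fin 3 → ℝ | x 2 = x 0 + x 1} ∧
  IsDef L {x : Fin 3 → ℝ | x 2 = x 0 * x 1}

/-- A discrete subset of `ℝ`. -/
def IsDiscreteSet (D : Set ℝ) : Prop :=
  ∀ x ∈ D, ∃ U : Set ℝ, IsOpen U ∧ U ∩ D = {x}

/-- d-minimality: the structure expands the ordered field of reals, and in every definable
family of subsets of `ℝ` each fiber is the union of an open set and `N` discrete sets, where
`N` does not depend on the parameter. -/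
def DMinimal : Prop :=
  ExpandsOrderedField L ∧
  ∀ (k : ℕ) (S : Set ((Fin k ⊕ Unit) → ℝ)), IsDef L S →
    ∃ N : ℕ, ∀ a : Fin k → ℝ,
      ∃ (U : Set ℝ) (D : Fin N → Set ℝ),
        IsOpen U ∧ (∀ i, IsDiscreteSet (D i)) ∧
        {t : ℝ | Sum.elim a (fun _ => t) ∈ S} = U ∪ ⋃ i, D i

variable {E F : Type} [NormedAddCommGroup E] [NormedSpace ℝ E]
  [NormedAddCommGroup F] [NormedSpace ℝ F]

/-- `f` is of class `C^p` on `M` (as a function on the submanifold `M`): near each point of `M`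
it coincides on `M` with a `C^p` function defined on an ambient open set. -/
def CpOn (p : ℕ) (f : E → F) (M : Set E) : Prop :=
  ∀ x ∈ M, ∃ (U : Set E) (g : E → F),
    IsOpen U ∧ x ∈ U ∧ ContDiffOn ℝ p g U ∧ Set.EqOn f g (M ∩ U)

/-- The tangent vectors to `M` at `x`: velocities of differentiable curves through `x`
staying in `M`. -/
def TangentVecs (M : Set E) (x : E) : Set E :=
  {v | ∃ γ : ℝ → E, γ 0 = x ∧ (∀ᶠ t in 𝓝 (0:ℝ), γ t ∈ M) ∧ HasDerivAt γ v 0}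

/-- The differential of `f : M → N` at `x` is surjective onto the tangent space of `N`
at `f x`. -/
def SubmersionAtOn (f : E → F) (M : Set E) (N : Set F) (x : E) : Prop :=
  ∀ w ∈ TangentVecs N (f x), ∃ (γ : ℝ → E) (v : E),
    γ 0 = x ∧ (∀ᶠ t in 𝓝 (0:ℝ), γ t ∈ M) ∧ HasDerivAt γ v 0 ∧
    HasDerivAt (fun t => f (γ t)) w 0

/-- `x` is a critical point of `f : M → ℝ`: the differential of `f` at `x` vanishes on all
tangent vectors of `M` at `x`. -/
def IsCritPtOn (f : E → ℝ) (M : Set E) (x : E) : Prop :=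
  x ∈ M ∧ ∀ (γ : ℝ → E) (v : E), γ 0 = x → (∀ᶠ t in 𝓝 (0:ℝ), γ t ∈ M) →
    HasDerivAt γ v 0 → HasDerivAt (fun t => f (γ t)) 0 0

/-- `x` is a nondegenerate critical point of `f : M → ℝ` on the `d`-dimensional submanifold
`M`: in a local `C²` parametrization `ψ` of `M` at `x`, the Hessian of `f ∘ ψ` is a
nondegenerate bilinear form. -/
def IsNondegCritPtOn (f : E → ℝ) (M : Set E) (d : ℕ) (x : E) : Prop :=
  IsCritPtOn f M x ∧
  ∃ (W : Set (Fin d → ℝ)) (ψ : (Fin d → ℝ) → E) (w0 : Fin d → ℝ),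
    IsOpen W ∧ w0 ∈ W ∧ ContDiffOn ℝ 2 ψ W ∧ ψ w0 = x ∧ Set.MapsTo ψ W M ∧
    Function.Injective (fun u => fderiv ℝ ψ w0 u) ∧
    ∀ v : Fin d → ℝ, v ≠ 0 → ∃ w : Fin d → ℝ,
      iteratedFDeriv ℝ 2 (fun z => f (ψ z)) w0 ![v, w] ≠ 0

/-- `f` is a Morse function on the `d`-dimensional submanifold `M`: all critical points are
nondegenerate and distinct critical points have distinct critical values. -/
def IsMorseOn (f : E → ℝ) (M : Set E) (d : ℕ) : Prop :=
  (∀ x, IsCritPtOn f M x → IsNondegCritPtOn f M d x) ∧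
  ∀ x y, IsCritPtOn f M x → IsCritPtOn f M y → x ≠ y → f x ≠ f y

/-- `M ⊆ ℝⁿ` is a definable `C^p` submanifold of dimension `d`: `M` is definable and every
point of `M` has a definable `C^p` chart of `ℝⁿ` flattening `M` onto `ℝ^d × {0}`. -/
def IsDpSubmanifold (p : ℕ) {n : ℕ} (d : ℕ) (M : Set (Fin n → ℝ)) : Prop :=
  IsDef L M ∧ d ≤ n ∧
  ∀ x ∈ M, ∃ (U V : Set (Fin n → ℝ)) (φ ψ : (Fin n → ℝ) → (Fin n → ℝ)),
    IsOpen U ∧ x ∈ U ∧ IsOpen V ∧ (0 : Fin n → ℝ) ∈ V ∧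
    IsDef L U ∧ IsDef L V ∧ IsDefMapOn L U φ ∧ IsDefMapOn L V ψ ∧
    ContDiffOn ℝ p φ U ∧ ContDiffOn ℝ p ψ V ∧
    Set.MapsTo φ U V ∧ Set.MapsTo ψ V U ∧
    (∀ y ∈ U, ψ (φ y) = y) ∧ (∀ y ∈ V, φ (ψ y) = y) ∧
    φ x = 0 ∧ φ '' (M ∩ U) = V ∩ {y | ∀ i : Fin n, d ≤ (i : ℕ) → y i = 0}

/-- The definable set `X ⊆ ℝⁿ` has dimension at least `d`: some projection of `X` onto `d`
of the coordinates has nonempty interior. -/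
def hasDimGE {n : ℕ} (X : Set (Fin n → ℝ)) (d : ℕ) : Prop :=
  ∃ ι : Fin d → Fin n, StrictMono ι ∧ (interior ((fun x => fun i => x (ι i)) '' X)).Nonempty

/-- The dimension of `X ⊆ ℝⁿ`: the largest `d` such that some coordinate projection of `X`
onto `ℝ^d` has nonempty interior; `⊥` (i.e. `-∞`) for the empty set. -/
noncomputable def dimDef {n : ℕ} (X : Set (Fin n → ℝ)) : WithBot ℕ :=
  if X.Nonempty then ((sSup {d : ℕ | hasDimGE X d} : ℕ) : WithBot ℕ) else ⊥

/-- The coordinate projection `ℝⁿ → ℝ^d` determined by `ι`. -/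
def projc {n d : ℕ} (ι : Fin d → Fin n) (x : Fin n → ℝ) : Fin d → ℝ := fun i => x (ι i)

/-- An open box in `ℝⁿ`: a product of `n` nonempty open intervals. -/
def IsOpenBox {n : ℕ} (U : Set (Fin n → ℝ)) : Prop :=
  ∃ a b : Fin n → ℝ, (∀ i, a i < b i) ∧ U = Set.univ.pi fun i => Set.Ioo (a i) (b i)

/-- `M` is locally, at `x`, the image of a definable `C^p` section `τ` of the coordinate
projection `projc ι`. -/
def MultiGraphPtAt (p : ℕ) {n d : ℕ} (ι : Fin d → Fin n) (M : Set (Fin n → ℝ))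
    (x : Fin n → ℝ) : Prop :=
  ∃ U : Set (Fin n → ℝ), IsOpenBox U ∧ x ∈ U ∧
    ∃ τ : (Fin d → ℝ) → (Fin n → ℝ),
      IsDefMapOn L (projc ι '' U) τ ∧ ContDiffOn ℝ p τ (projc ι '' U) ∧
      M ∩ U = τ '' (projc ι '' U) ∧ ∀ z ∈ projc ι '' U, projc ι (τ z) = z

/-- A `D^p` multi-valued graph with respect to the coordinate projection `projc ι`. -/
def IsMultiGraph (p : ℕ) {n d : ℕ} (ι : Fin d → Fin n) (M : Set (Fin n → ℝ)) : Prop :=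
  IsDpSubmanifold L p d M ∧ ∀ x ∈ M, MultiGraphPtAt L p ι M x

/-- The gradient vector `(∂g/∂x₁, …, ∂g/∂x_d)` of `g : ℝ^d → ℝ` at `z`. -/
noncomputable def gradVec {d : ℕ} (g : (Fin d → ℝ) → ℝ) (z : Fin d → ℝ) : Fin d → ℝ :=
  fun i => fderiv ℝ g z (Pi.single i 1)

/-- The Hessian matrix `(∂²g/∂x_i∂x_j)` of `g : ℝ^d → ℝ` at `z`. -/
noncomputable def hessMat {d : ℕ} (g : (Fin d → ℝ) → ℝ) (z : Fin d → ℝ) :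
    Matrix (Fin d) (Fin d) ℝ :=
  Matrix.of fun i j => fderiv ℝ (fun w => fderiv ℝ g w (Pi.single j 1)) z (Pi.single i 1)

/-- The derivative of `f : M → ℝ` at `x` along the vector field `D`: the common value of
`d_x g (D x)` over all local `C¹` extensions `g` of `f` (and `0` if there is no such common
value). -/
noncomputable def vderiv (M : Set E) (D : E → E) (f : E → ℝ) (x : E) : ℝ :=
  if h : ∃ w : ℝ, ∀ (U : Set E) (g : E → ℝ), IsOpen U → x ∈ U → ContDiffOn ℝ 1 g U →
      Set.EqOn f g (M ∩ U) → fderiv ℝ g x (D x) = w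
  then h.choose else 0

/-- Iterated derivative `D_{α₁} ⋯ D_{α_m} f` of `f : M → ℝ` along a finite family of vector
fields, indexed by a list `α`. -/
noncomputable def vderivIter {k : ℕ} (M : Set E) (D : Fin k → E → E) :
    List (Fin k) → (E → ℝ) → E → ℝ
  | [], f => f
  | i :: l, f => vderiv M (D i) (vderivIter M D l f)

set_option linter.unusedVariables false
set_option linter.deprecated false
set_option linter.unusedSectionVars false
set_option linter.style.longLine false

class DSp (X : Type) where
  ι : Type
  fin : Finite ι
  e : X ≃ (ι → ℝ)

attribute [instance] DSp.fin

instance dspR : DSp ℝ := ⟨Unit, inferInstance, (Equiv.funUnique Unit ℝ).symm⟩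
instance dspPi {κ : Type} [Finite κ] : DSp (κ → ℝ) := ⟨κ, inferInstance, Equiv.refl _⟩
instance dspProd {X Y : Type} [DSp X] [DSp Y] : DSp (X × Y) :=
  ⟨DSp.ι X ⊕ DSp.ι Y, inferInstance,
    (Equiv.prodCongr DSp.e DSp.e).trans (Equiv.sumArrowEquivProdArrow _ _ _).symm⟩

/-- definable predicate -/
def DP {X : Type} [DSp X] (P : X → Prop) : Prop :=
  IsDef L {v : DSp.ι X → ℝ | P (DSp.e.symm v)}

/-- definable function -/
def DF {X Y : Type} [DSp X] [DSp Y] (f : X → Y) : Prop :=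
  DP L (fun q : X × Y => q.2 = f q.1)

/-- coordinate maps -/
def CM {X Y : Type} [DSp X] [DSp Y] (φ : X → Y) : Prop :=
  ∃ h : DSp.ι Y → DSp.ι X, ∀ x, DSp.e (φ x) = DSp.e x ∘ h

section layer
variable {L}
variable {X Y Z W : Type} [DSp X] [DSp Y] [DSp Z] [DSp W]

lemma CM.id : CM (fun x : X => x) := ⟨fun i => i, fun x => rfl⟩

lemma CM.comp {f : X → Y} {g : Y → Z} (hg : CM g) (hf : CM f) : CM (fun x => g (f x)) := by
  obtain ⟨h, hh⟩ := hf
  obtain ⟨k, hk⟩ := hg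
  exact ⟨fun i => h (k i), fun x => by rw [hk, hh]; rfl⟩

lemma CM.fst : CM (fun q : X × Y => q.1) :=
  ⟨Sum.inl, fun x => by ext i; rfl⟩
lemma CM.snd : CM (fun q : X × Y => q.2) :=
  ⟨Sum.inr, fun x => by ext i; rfl⟩
lemma CM.pair {f : X → Y} {g : X → Z} (hf : CM f) (hg : CM g) : CM (fun x => (f x, g x)) := by
  obtain ⟨h, hh⟩ := hf
  obtain ⟨k, hk⟩ := hg
  refine ⟨Sum.elim h k, fun x => ?_⟩
  ext i
  rcases i with i | i
  · exact congrFun (hh x) i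
  · exact congrFun (hk x) i
lemma CM.eval {κ : Type} [Finite κ] (i : κ) : CM (fun v : κ → ℝ => v i) :=
  ⟨fun _ => i, fun x => by ext j; rfl⟩

lemma DP.cm {P : Y → Prop} {φ : X → Y} (hφ : CM φ) (hP : DP L P) : DP L (fun x => P (φ x)) := by
  obtain ⟨h, hh⟩ := hφ
  have := Set.Definable.preimage_comp (β := DSp.ι X) h hP
  unfold DP IsDef
  convert this using 1
  ext v
  simp only [mem_setOf_eq, mem_preimage]
  have : φ (DSp.e.symm v) = DSp.e.symm (v ∘ h) := by
    rw [Equiv.eq_symm_apply, hh]; simp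
  rw [this]

lemma DP.and {P Q : X → Prop} (hP : DP L P) (hQ : DP L Q) : DP L (fun x => P x ∧ Q x) :=
  Set.Definable.inter hP hQ
lemma DP.or {P Q : X → Prop} (hP : DP L P) (hQ : DP L Q) : DP L (fun x => P x ∨ Q x) :=
  Set.Definable.union hP hQ
lemma DP.not {P : X → Prop} (hP : DP L P) : DP L (fun x => ¬ P x) :=
  Set.Definable.compl hP
lemma DP.congr {P Q : X → Prop} (hP : DP L P) (h : ∀ x, Q x ↔ P x) : DP L Q := by
  have : Q = P := funext fun x => propext (h x)
  rwa [this]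
lemma DP.imp {P Q : X → Prop} (hP : DP L P) (hQ : DP L Q) : DP L (fun x => P x → Q x) :=
  (hP.not.or hQ).congr fun x => by tauto
lemma DP.iff {P Q : X → Prop} (hP : DP L P) (hQ : DP L Q) : DP L (fun x => P x ↔ Q x) :=
  ((hP.imp hQ).and (hQ.imp hP)).congr fun x => by tauto
lemma DP.ex {P : X → Y → Prop} (hP : DP L (fun q : X × Y => P q.1 q.2)) :
    DP L (fun x => ∃ y, P x y) := by
  have := Set.Definable.exists_of_finite hP
  unfold DP IsDef
  convert this using 1
  ext v
  simp only [mem_setOf_eq]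
  constructor
  · rintro ⟨y, hy⟩
    refine ⟨DSp.e y, ?_⟩
    have h1 : (DSp.e.symm (Sum.elim v (DSp.e y)) : X × Y) = (DSp.e.symm v, y) := by
      rw [Equiv.symm_apply_eq]
      ext i
      rcases i with i | i
      · simp [DSp.e, Equiv.sumArrowEquivProdArrow]
      · simp [DSp.e, Equiv.sumArrowEquivProdArrow]
    exact (congrArg (fun q : X × Y => P q.1 q.2) h1).mpr hy
  · rintro ⟨u, hu⟩
    exact ⟨_, hu⟩
lemma DP.all {P : X → Y → Prop} (hP : DP L (fun q : X × Y => P q.1 q.2)) :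
    DP L (fun x => ∀ y, P x y) :=
  (DP.ex (P := fun x y => ¬ P x y) hP.not).not.congr fun x => by simp
lemma DP.fall {κ : Type} [Finite κ] {P : κ → X → Prop} (hP : ∀ i, DP L (P i)) :
    DP L (fun x => ∀ i, P i x) := by
  have := Set.definable_iInter_of_finite hP
  unfold DP IsDef
  convert this using 1
  ext v
  simp
lemma DP.true : DP L (fun _ : X => True) := by
  unfold DP IsDef
  convert Set.definable_univ using 1
  ext v; simp
lemma DP.false : DP L (fun _ : X => False) := DP.true.not.congr fun x => by simp
lemma DP.constp (p : Prop) : DP L (fun _ : X => p) := by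
  by_cases h : p
  · exact DP.true.congr fun x => by simp [h]
  · exact DP.false.congr fun x => by simp [h]

lemma DP.comp {P : Y → Prop} {f : X → Y} (hP : DP L P) (hf : DF L f) : DP L (fun x => P (f x)) :=
  (DP.ex (P := fun x y => y = f x ∧ P y)
    (DP.and hf (DP.cm CM.snd hP))).congr fun x => by simp

lemma DF.comp {g : Y → Z} {f : X → Y} (hg : DF L g) (hf : DF L f) : DF L (fun x => g (f x)) :=
  (DP.ex (X := X × Z) (P := fun q y => y = f q.1 ∧ q.2 = g y)
    (DP.and (DP.cm (Y := X × Y) (φ := fun r : (X × Z) × Y => (r.1.1, r.2))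
        (CM.pair (CM.fst.comp CM.fst) CM.snd) hf)
      (DP.cm (Y := Y × Z) (φ := fun r : (X × Z) × Y => (r.2, r.1.2))
        (CM.pair CM.snd (CM.snd.comp CM.fst)) hg))).congr fun x => by simp

lemma DP.eqR : DP L (fun q : ℝ × ℝ => q.1 = q.2) := by
  have : (univ : Set ℝ).Definable L {v : (Unit ⊕ Unit) → ℝ | v (Sum.inl ()) = v (Sum.inr ())} := by
    refine ⟨(Language.Term.var (Sum.inl ())).equal (Language.Term.var (Sum.inr ())), ?_⟩
    ext v
    simp [Language.Formula.Realize, Language.Term.equal]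
  exact this

lemma DP.eqX : DP L (fun q : X × X => q.1 = q.2) := by
  have h : ∀ i : DSp.ι X, DP L (fun q : X × X => DSp.e q.1 i = DSp.e q.2 i) := fun i =>
    DP.cm (Y := ℝ × ℝ) (φ := fun q : X × X => (DSp.e q.1 i, DSp.e q.2 i))
      ⟨Sum.elim (fun _ => Sum.inl i) (fun _ => Sum.inr i), fun q => by
        ext j; rcases j with j | j <;> rfl⟩ DP.eqR
  exact (DP.fall h).congr fun q => by rw [← funext_iff]; simp

lemma CM.df {φ : X → Y} (h : CM φ) : DF L φ :=
  DP.cm (φ := fun q : X × Y => (q.2, φ q.1)) (CM.pair CM.snd (h.comp CM.fst)) DP.eqX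

lemma DF.id : DF L (fun x : X => x) := CM.id.df
lemma DF.fst' : DF L (fun x : X × Y => x.1) := CM.fst.df
lemma DF.snd' : DF L (fun x : X × Y => x.2) := CM.snd.df
lemma DF.fst {f : X → Y × Z} (h : DF L f) : DF L (fun x => (f x).1) := DF.fst'.comp h
lemma DF.snd {f : X → Y × Z} (h : DF L f) : DF L (fun x => (f x).2) := DF.snd'.comp h
lemma DF.app {κ : Type} [Finite κ] {f : X → κ → ℝ} (h : DF L f) (i : κ) : DF L (fun x => f x i) :=
  (CM.eval i).df.comp h

lemma DF.pair {f : X → Y} {g : X → Z} (hf : DF L f) (hg : DF L g) : DF L (fun x => (f x, g x)) :=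
  (DP.and
    (DP.cm (Y := X × Y) (φ := fun r : X × (Y × Z) => (r.1, r.2.1))
        (CM.pair CM.fst (CM.fst.comp CM.snd)) hf)
    (DP.cm (Y := X × Z) (φ := fun r : X × (Y × Z) => (r.1, r.2.2))
        (CM.pair CM.fst (CM.snd.comp CM.snd)) hg)).congr fun x => by
      simp [Prod.ext_iff]

lemma DP.eq {f g : X → Y} (hf : DF L f) (hg : DF L g) : DP L (fun x => f x = g x) :=
  DP.comp DP.eqX (hf.pair hg)

lemma DF.pi {κ : Type} [Finite κ] {f : X → κ → ℝ} (h : ∀ i, DF L (fun x => f x i)) : DF L f :=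
  (DP.fall (X := X × (κ → ℝ)) (P := fun i q => q.2 i = f q.1 i) fun i =>
    DP.eq (DF.app DF.snd' i) ((h i).comp DF.fst')).congr fun q => by
      rw [funext_iff]

lemma DF.comp2 {g : Y → Z → W} {a : X → Y} {b : X → Z} (hg : DF L (fun q : Y × Z => g q.1 q.2))
    (ha : DF L a) (hb : DF L b) : DF L (fun x => g (a x) (b x)) :=
  hg.comp (ha.pair hb)
lemma DP.comp2 {g : Y → Z → Prop} {a : X → Y} {b : X → Z} (hg : DP L (fun q : Y × Z => g q.1 q.2))
    (ha : DF L a) (hb : DF L b) : DP L (fun x => g (a x) (b x)) :=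
  hg.comp (ha.pair hb)

lemma DF.constR (c : ℝ) : DF L (fun _ : X => c) := by
  have h : DP L (fun y : ℝ => y = c) := by
    have : (univ : Set ℝ).Definable L {v : Unit → ℝ | v () = c} := by
      refine ⟨(Language.Term.var ()).equal (L.con (⟨c, mem_univ c⟩ : ↑(univ : Set ℝ))).term, ?_⟩
      ext v
      simp [Language.Formula.Realize, Language.Term.equal]
    exact this
  exact h.comp DF.snd'

lemma DF.const (c : Y) : DF L (fun _ : X => c) := by
  have h : DP L (fun y : Y => ∀ i, DSp.e y i = DSp.e c i) := DP.fall fun i =>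
    DP.eq (CM.df ⟨fun _ => i, fun x => by ext j; rfl⟩) (DF.constR _)
  exact (h.comp DF.snd').congr fun q => by rw [← funext_iff]; simp

/-- from a definable graph -/
lemma DF.of {f : X → Y} {P : X → Y → Prop} (hP : DP L (fun q : X × Y => P q.1 q.2))
    (h : ∀ x y, y = f x ↔ P x y) : DF L f :=
  hP.congr fun q => h _ _

end layer

class OF : Prop where
  out : ExpandsOrderedField L

section layer2
variable {L}
variable {X Y Z W : Type} [DSp X] [DSp Y] [DSp Z] [DSp W] [OF L]

lemma DP.lt {f g : X → ℝ} (hf : DF L f) (hg : DF L g) : DP L (fun x => f x < g x) := by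
  have h : DP L (fun v : Fin 2 → ℝ => v 0 < v 1) := (OF.out (L := L)).1
  have h2 : DF L (fun x => ![f x, g x]) := DF.pi fun i => by
    fin_cases i
    · exact hf
    · exact hg
  exact h.comp h2
lemma DP.le {f g : X → ℝ} (hf : DF L f) (hg : DF L g) : DP L (fun x => f x ≤ g x) :=
  (DP.lt hg hf).not.congr fun x => by simp
lemma DF.add {f g : X → ℝ} (hf : DF L f) (hg : DF L g) : DF L (fun x => f x + g x) := by
  have h : DP L (fun v : Fin 3 → ℝ => v 2 = v 0 + v 1) := (OF.out (L := L)).2.1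
  have h2 : DF L (fun q : X × ℝ => ![f q.1, g q.1, q.2]) := DF.pi fun i => by
    fin_cases i
    · exact hf.comp DF.fst'
    · exact hg.comp DF.fst'
    · exact DF.snd'
  exact h.comp h2
lemma DF.mul {f g : X → ℝ} (hf : DF L f) (hg : DF L g) : DF L (fun x => f x * g x) := by
  have h : DP L (fun v : Fin 3 → ℝ => v 2 = v 0 * v 1) := (OF.out (L := L)).2.2
  have h2 : DF L (fun q : X × ℝ => ![f q.1, g q.1, q.2]) := DF.pi fun i => by
    fin_cases i
    · exact hf.comp DF.fst'
    · exact hg.comp DF.fst'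
    · exact DF.snd'
  exact h.comp h2
lemma DF.neg {f : X → ℝ} (hf : DF L f) : DF L (fun x => - f x) := by
  have := (DF.const (L := L) (X := X) (-1 : ℝ)).mul hf
  simpa using this
lemma DF.sub {f g : X → ℝ} (hf : DF L f) (hg : DF L g) : DF L (fun x => f x - g x) := by
  have := hf.add hg.neg
  simpa [sub_eq_add_neg] using this
lemma DF.ite {P : X → Prop} {f g : X → Y} (hP : DP L P) (hf : DF L f) (hg : DF L g) :
    DF L (fun x => if P x then f x else g x) :=
  DF.of (P := fun x y => (P x ∧ y = f x) ∨ (¬ P x ∧ y = g x))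
    (((hP.comp DF.fst').and hf).or ((hP.comp DF.fst').not.and hg)) fun x y => by
      by_cases h : P x <;> simp [h]
lemma DF.inv {f : X → ℝ} (hf : DF L f) : DF L (fun x => (f x)⁻¹) :=
  DF.of (P := fun x y => (f x ≠ 0 ∧ y * f x = 1) ∨ (f x = 0 ∧ y = 0))
    (((DP.eq (hf.comp DF.fst') (DF.const 0)).not.and
      (DP.eq (DF.mul DF.snd' (hf.comp DF.fst')) (DF.const 1))).or
      ((DP.eq (hf.comp DF.fst') (DF.const 0)).and (DP.eq DF.snd' (DF.const 0)))) fun x y => by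
      by_cases h : f x = 0
      · simp [h]
      · simp only [h, ne_eq, not_false_eq_true, true_and, false_and, or_false]
        constructor
        · rintro rfl; field_simp
        · intro h2; field_simp; exact h2
lemma DF.div {f g : X → ℝ} (hf : DF L f) (hg : DF L g) : DF L (fun x => f x / g x) := by
  simpa [div_eq_mul_inv] using hf.mul hg.inv
lemma DF.pow {f : X → ℝ} (hf : DF L f) (n : ℕ) : DF L (fun x => f x ^ n) := by
  induction n with
  | zero => simpa using DF.const (1 : ℝ)
  | succ n ih => simpa [pow_succ] using ih.mul hf
lemma DF.sum {κ : Type} {f : κ → X → ℝ} (s : Finset κ) (hf : ∀ i, DF L (f i)) :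
    DF L (fun x => ∑ i ∈ s, f i x) := by
  induction s using Finset.induction_on with
  | empty => simpa using DF.const (0 : ℝ)
  | insert a s ha ih => simpa [Finset.sum_insert ha] using (hf a).add ih
lemma DF.max {f g : X → ℝ} (hf : DF L f) (hg : DF L g) : DF L (fun x => max (f x) (g x)) := by
  simpa [max_def] using DF.ite (DP.le hf hg) hg hf
lemma DF.abs {f : X → ℝ} (hf : DF L f) : DF L (fun x => |f x|) := by
  simpa [abs_eq_max_neg] using DF.max hf hf.neg
lemma DP.distlt {κ : Type} [Fintype κ] {f g : X → κ → ℝ} {r : X → ℝ} (hf : DF L f) (hg : DF L g)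
    (hr : DF L r) : DP L (fun x => dist (f x) (g x) < r x) := by
  refine ((DP.lt (DF.const 0) hr).and (DP.fall (P := fun i x => |f x i - g x i| < r x) fun i =>
    DP.lt (DF.abs ((hf.app i).sub (hg.app i))) hr)).congr fun x => ?_
  constructor
  · intro h
    have h0 := lt_of_le_of_lt dist_nonneg h
    exact ⟨h0, fun i => by simpa [Real.dist_eq] using (dist_pi_lt_iff h0).1 h i⟩
  · rintro ⟨h0, h⟩
    exact (dist_pi_lt_iff h0).2 fun i => by simpa [Real.dist_eq] using h i
lemma DP.distltR {f g : X → ℝ} {r : X → ℝ} (hf : DF L f) (hg : DF L g)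
    (hr : DF L r) : DP L (fun x => dist (f x) (g x) < r x) := by
  simpa [Real.dist_eq] using DP.lt (DF.abs (hf.sub hg)) hr

/-- eventually -/
lemma DP.ev {κ : Type} [Fintype κ] {P : X → (κ → ℝ) → Prop} {a : X → κ → ℝ}
    (ha : DF L a) (hP : DP L (fun q : X × (κ → ℝ) => P q.1 q.2)) :
    DP L (fun x => ∀ᶠ y in 𝓝 (a x), P x y) := by
  refine (DP.ex (P := fun x ε => 0 < ε ∧ ∀ y : κ → ℝ, dist y (a x) < ε → P x y)
    ((DP.lt (DF.const 0) DF.snd').and (DP.all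
      (P := fun (q : X × ℝ) (y : κ → ℝ) => dist y (a q.1) < q.2 → P q.1 y) ?_))).congr fun x => ?_
  · exact DP.imp (DP.distlt DF.snd' (ha.comp (DF.fst'.comp DF.fst')) (DF.snd'.comp DF.fst'))
      (hP.comp ((DF.fst'.comp DF.fst').pair DF.snd'))
  · simp only [Metric.eventually_nhds_iff, gt_iff_lt]
lemma DP.evR {P : X → ℝ → Prop} {a : X → ℝ}
    (ha : DF L a) (hP : DP L (fun q : X × ℝ => P q.1 q.2)) :
    DP L (fun x => ∀ᶠ y in 𝓝 (a x), P x y) := by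
  refine (DP.ex (P := fun x ε => 0 < ε ∧ ∀ y : ℝ, dist y (a x) < ε → P x y)
    ((DP.lt (DF.const 0) DF.snd').and (DP.all
      (P := fun (q : X × ℝ) (y : ℝ) => dist y (a q.1) < q.2 → P q.1 y) ?_))).congr fun x => ?_
  · exact DP.imp (DP.distltR DF.snd' (ha.comp (DF.fst'.comp DF.fst')) (DF.snd'.comp DF.fst'))
      (hP.comp ((DF.fst'.comp DF.fst').pair DF.snd'))
  · simp only [Metric.eventually_nhds_iff, gt_iff_lt]

end layer2
section calc1
variable {κ : Type} [Fintype κ]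

/-- partial derivative -/
def pd (i : κ) (f : (κ → ℝ) → ℝ) (x : κ → ℝ) : ℝ :=
  deriv (fun t => f (Function.update x i t)) (x i)

lemma hasFDerivAt_of_partials (f : (κ → ℝ) → ℝ) (g : κ → (κ → ℝ) → ℝ) (x : κ → ℝ)
    (h1 : ∀ᶠ x' in 𝓝 x, ∀ i, HasDerivAt (fun t => f (Function.update x' i t)) (g i x') (x' i))
    (h2 : ∀ i, ContinuousAt (g i) x) :
    HasFDerivAt f (∑ i, g i x • (ContinuousLinearMap.proj i : (κ → ℝ) →L[ℝ] ℝ)) x := by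
  rw [hasFDerivAt_iff_isLittleO, Asymptotics.isLittleO_iff]
  intro c hc
  have hε : 0 < c / (Fintype.card κ + 1) := by positivity
  set ε := c / (Fintype.card κ + 1) with hεd
  have h3 : ∀ᶠ x' in 𝓝 x, ∀ i, |g i x' - g i x| < ε := by
    rw [eventually_all]
    intro i
    have := Metric.tendsto_nhds.1 (h2 i) ε hε
    simpa [Real.dist_eq] using this
  obtain ⟨r, hr, hball⟩ := Metric.eventually_nhds_iff.1 (h1.and h3)
  filter_upwards [Metric.ball_mem_nhds x hr] with y hy
  have key : ∀ s : Finset κ, |f (s.piecewise y x) - f x - ∑ i ∈ s, g i x * (y i - x i)|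
      ≤ s.card * (ε * ‖y - x‖) := by
    intro s
    induction s using Finset.induction_on with
    | empty => simp
    | insert a s ha ih =>
      set w := s.piecewise y x with hw
      have hwa : w a = x a := by simp [hw, ha]
      have hwi : (insert a s).piecewise y x = Function.update w a (y a) := by
        rw [Finset.piecewise_insert]
      have hmem : ∀ t ∈ segment ℝ (x a) (y a), dist (Function.update w a t) x < r := by
        intro t ht
        rw [dist_pi_lt_iff hr]
        intro j
        have hyj : ∀ j, dist (y j) (x j) < r := fun j => (dist_le_pi_dist y x j).trans_lt hy
        by_cases hj : j = a
        · subst hj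
          simp only [Function.update_self]
          have : segment ℝ (x j) (y j) ⊆ Metric.ball (x j) r :=
            (convex_ball _ _).segment_subset (Metric.mem_ball_self hr) (hyj j)
          exact this ht
        · rw [Function.update_of_ne hj]
          by_cases hjs : j ∈ s
          · simpa [hw, hjs] using hyj j
          · simpa [hw, hjs] using hr
      have hd : ∀ t ∈ segment ℝ (x a) (y a),
          HasDerivWithinAt (fun t => f (Function.update w a t) - g a x * t)
            (g a (Function.update w a t) - g a x) (segment ℝ (x a) (y a)) t := by
        intro t ht
        have := (hball (hmem t ht)).1 a
        simp only [Function.update_idem, Function.update_self] at this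
        have h5 : HasDerivAt (fun t => g a x * t) (g a x) t := by
          simpa using (hasDerivAt_id t).const_mul (g a x)
        exact (this.sub h5).hasDerivWithinAt
      have hb : ∀ t ∈ segment ℝ (x a) (y a), ‖g a (Function.update w a t) - g a x‖ ≤ ε := by
        intro t ht
        exact ((hball (hmem t ht)).2 a).le
      have hm := (convex_segment (x a) (y a)).norm_image_sub_le_of_norm_hasDerivWithin_le hd hb
        (left_mem_segment ℝ _ _) (right_mem_segment ℝ _ _)
      rw [Finset.sum_insert ha, Finset.card_insert_of_notMem ha, hwi]
      have e1 : Function.update w a (x a) = w := by rw [← hwa]; simp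
      rw [e1] at hm
      have h6 : ‖y a - x a‖ ≤ ‖y - x‖ := norm_le_pi_norm (y - x) a
      have h7 : ε * ‖y a - x a‖ ≤ ε * ‖y - x‖ := by gcongr
      rw [Real.norm_eq_abs] at hm
      push_cast
      have e2 : f (Function.update w a (y a)) - f x -
          (g a x * (y a - x a) + ∑ i ∈ s, g i x * (y i - x i)) =
          (f (Function.update w a (y a)) - g a x * y a - (f w - g a x * x a)) +
          (f w - f x - ∑ i ∈ s, g i x * (y i - x i)) := by ring
      rw [e2]
      refine (abs_add_le _ _).trans ?_
      linarith
  have hk := key Finset.univ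
  simp only [Finset.piecewise_univ, Finset.card_univ] at hk
  have e3 : (∑ i, g i x • (ContinuousLinearMap.proj i : (κ → ℝ) →L[ℝ] ℝ)) (y - x)
      = ∑ i, g i x * (y i - x i) := by
    simp
  rw [e3, Real.norm_eq_abs]
  refine hk.trans ?_
  rw [← mul_assoc]
  gcongr
  rw [hεd, mul_div_assoc']
  rw [div_le_iff₀ (by positivity)]
  nlinarith

lemma hasDerivAt_update_of_fderiv {f : (κ → ℝ) → ℝ} {f' : (κ → ℝ) →L[ℝ] ℝ} {x : κ → ℝ} (i : κ)
    (h : HasFDerivAt f f' x) :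
    HasDerivAt (fun t => f (Function.update x i t)) (f' (Pi.single i 1)) (x i) := by
  have h1 : HasDerivAt (Function.update x i) (Pi.single i 1) (x i) := hasDerivAt_update x i (x i)
  have h2 : HasFDerivAt f f' (Function.update x i (x i)) := by simpa using h
  exact h2.comp_hasDerivAt (x i) h1

lemma pd_eq {f : (κ → ℝ) → ℝ} {x : κ → ℝ} (i : κ) (h : DifferentiableAt ℝ f x) :
    pd i f x = fderiv ℝ f x (Pi.single i 1) :=
  (hasDerivAt_update_of_fderiv i h.hasFDerivAt).deriv

lemma contDiffAt_succ_pd (k : ℕ) (f : (κ → ℝ) → ℝ) (x : κ → ℝ) :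
    ContDiffAt ℝ (k + 1 : ℕ) f x ↔
    (∀ᶠ x' in 𝓝 x, ∀ i, DifferentiableAt ℝ (fun t => f (Function.update x' i t)) (x' i)) ∧
      ∀ i, ContDiffAt ℝ k (pd i f) x := by
  constructor
  · intro h
    have hd : ∀ᶠ x' in 𝓝 x, DifferentiableAt ℝ f x' := by
      filter_upwards [h.eventually (by simp)] with x' hx'
      exact hx'.differentiableAt (by simp)
    refine ⟨?_, fun i => ?_⟩
    · filter_upwards [hd] with x' hx' i
      exact (hasDerivAt_update_of_fderiv i hx'.hasFDerivAt).differentiableAt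
    · have h1 : ContDiffAt ℝ k (fderiv ℝ f) x := h.fderiv_right (by norm_cast)
      have h2 : ContDiffAt ℝ k (fun x => fderiv ℝ f x (Pi.single i 1)) x :=
        h1.clm_apply contDiffAt_const
      refine h2.congr_of_eventuallyEq ?_
      filter_upwards [hd] with x' hx'
      exact pd_eq i hx'
  · rintro ⟨h1, h2⟩
    push_cast
    rw [contDiffAt_succ_iff_hasFDerivAt]
    refine ⟨fun x => ∑ i, pd i f x • (ContinuousLinearMap.proj i : (κ → ℝ) →L[ℝ] ℝ), ?_, ?_⟩
    · have h3 : ∀ᶠ x' in 𝓝 x, ∀ i, ContinuousAt (pd i f) x' := by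
        rw [eventually_all]
        intro i
        filter_upwards [(h2 i).eventually (by simp)] with x' hx'
        exact hx'.continuousAt
      refine ⟨{x' | HasFDerivAt f (∑ i, pd i f x' • (ContinuousLinearMap.proj i : (κ → ℝ) →L[ℝ] ℝ)) x'}, ?_,
        fun x hx => hx⟩
      filter_upwards [h1.eventually_nhds, h3] with x' h1' h3'
      refine hasFDerivAt_of_partials f (fun i => pd i f) x' ?_ h3'
      filter_upwards [h1'] with x'' hx'' i
      exact (hx'' i).hasDerivAt
    · exact ContDiffAt.sum fun i _ => (h2 i).smul contDiffAt_const

lemma contDiffAt_zero_iff (f : (κ → ℝ) → ℝ) (x : κ → ℝ) :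
    ContDiffAt ℝ (0 : ℕ) f x ↔ ∀ᶠ x' in 𝓝 x, ContinuousAt f x' := by
  constructor
  · intro h
    filter_upwards [h.eventually (by simp)] with x' hx'
    exact hx'.continuousAt
  · intro h
    have : ContDiffAt ℝ 0 f x := contDiffAt_zero.2 ⟨_, h, fun y hy => (hy : ContinuousAt f y).continuousWithinAt⟩
    exact_mod_cast this

end calc1
class DM : Prop where
  out : DMinimal L

instance [h : DM L] : OF L := ⟨h.out.1⟩

/-- somewhere dense definable sets have interior -/
def SD (X : Type) [DSp X] [TopologicalSpace X] : Prop :=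
  ∀ S : X → Prop, DP L S → ∀ O : Set X, IsOpen O → O.Nonempty → O ⊆ closure {x | S x} →
    (interior {x | S x} ∩ O).Nonempty

section sd
variable {L}

lemma dmin_family [hL : DM L] {X : Type} [DSp X] {P : X → ℝ → Prop}
    (hP : DP L (fun q : X × ℝ => P q.1 q.2)) :
    ∃ N : ℕ, ∀ x, ∃ (U : Set ℝ) (D : Fin N → Set ℝ),
        IsOpen U ∧ (∀ i, IsDiscreteSet (D i)) ∧ {t : ℝ | P x t} = U ∪ ⋃ i, D i := by
  obtain ⟨k, ⟨h⟩⟩ := Finite.exists_equiv_fin (DSp.ι X)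
  let φ : (Fin k → ℝ) → X := fun v => DSp.e.symm (v ∘ h)
  have hφ : CM φ := ⟨h, fun x => by simp [φ]; rfl⟩
  have h1 : DP L (fun q : (Fin k → ℝ) × ℝ => P (φ q.1) q.2) :=
    hP.comp (((hφ.df).comp DF.fst').pair DF.snd')
  obtain ⟨N, hN⟩ := hL.out.2 k _ h1
  refine ⟨N, fun x => ?_⟩
  obtain ⟨U, D, h2, h3, h4⟩ := hN (DSp.e x ∘ h.symm)
  refine ⟨U, D, h2, h3, ?_⟩
  rw [← h4]
  ext t
  have e1 : φ (DSp.e x ∘ h.symm) = x := by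
    simp only [φ]
    rw [Equiv.symm_apply_eq]
    ext i; simp
  have : P (φ (DSp.e x ∘ h.symm)) t ↔ P x t := by rw [e1]
  exact this.symm

lemma interior_closure_discrete {D : Set ℝ} (hD : IsDiscreteSet D) : interior (closure D) = ∅ := by
  by_contra hne
  obtain ⟨y, hy⟩ := nonempty_iff_ne_empty.2 hne
  obtain ⟨x, hx1, hx2⟩ := mem_closure_iff.1 (interior_subset hy) _ isOpen_interior hy
  obtain ⟨U, hU, hUx⟩ := hD x hx2
  have hxU : x ∈ U := by
    have : x ∈ U ∩ D := by rw [hUx]; rfl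
    exact this.1
  have ho : IsOpen (interior (closure D) ∩ U) := isOpen_interior.inter hU
  have hn : (interior (closure D) ∩ U) ∈ 𝓝 x := ho.mem_nhds ⟨hx1, hxU⟩
  have : ∃ z ∈ interior (closure D) ∩ U, z ≠ x := by
    obtain ⟨ε, hε, hb⟩ := Metric.mem_nhds_iff.1 hn
    refine ⟨x + ε / 2, hb ?_, by linarith⟩
    rw [Metric.mem_ball, Real.dist_eq]
    rw [abs_lt]; constructor <;> linarith
  obtain ⟨z, hz, hzx⟩ := this
  obtain ⟨w, hw1, hw2⟩ := mem_closure_iff.1 (interior_subset hz.1)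
    ((interior (closure D) ∩ U) ∩ {x}ᶜ) (ho.inter isOpen_compl_singleton) ⟨hz, hzx⟩
  have : w ∈ U ∩ D := ⟨hw1.1.2, hw2⟩
  rw [hUx] at this
  exact hw1.2 this

lemma sdR [DM L] : SD L ℝ := by
  intro S hS O hO hne hsub
  obtain ⟨N, hN⟩ := dmin_family (L := L) (X := ℝ) (P := fun _ t => S t) (hS.comp DF.snd')
  obtain ⟨U, D, hU, hD, he⟩ := hN 0
  by_contra hcon
  have hUO : U ∩ O = ∅ := by
    rw [Set.not_nonempty_iff_eq_empty] at hcon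
    rw [← subset_empty_iff, ← hcon]
    gcongr
    apply interior_maximal _ hU
    rw [he]; exact subset_union_left
  have h2 : O ⊆ ⋃ i, closure (D i) := by
    intro x hx
    have h3 : x ∈ closure ((⋃ i, D i)) := by
      rw [mem_closure_iff]
      intro V hV hxV
      obtain ⟨y, hy1, hy2⟩ := mem_closure_iff.1 (hsub hx) (V ∩ O) (hV.inter hO) ⟨hxV, hx⟩
      rw [he] at hy2
      rcases hy2 with hy2 | hy2
      · have : y ∈ U ∩ O := ⟨hy2, hy1.2⟩
        rw [hUO] at this; exact this.elim
      · exact ⟨y, hy1.1, hy2⟩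
    rwa [closure_iUnion_of_finite] at h3
  have h4 : interior (⋃ i, closure (D i)) = ∅ := by
    have := dense_iUnion_interior_of_closed (X := ℝ) (ι := Option (Fin N))
      (f := fun i => i.elim (Oᶜ) (fun i => closure (D i))) (by
        intro i; cases i
        · exact hO.isClosed_compl
        · exact isClosed_closure) (by
        apply eq_univ_of_forall
        intro x
        by_cases hx : x ∈ O
        · obtain ⟨i, hi⟩ := mem_iUnion.1 (h2 hx)
          exact mem_iUnion.2 ⟨some i, hi⟩
        · exact mem_iUnion.2 ⟨none, hx⟩)
    obtain ⟨x, hx1, hx2⟩ := this.inter_open_nonempty O hO hne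
    obtain ⟨i, hi⟩ := mem_iUnion.1 hx2
    cases i with
    | none => exact absurd hx1 (interior_subset hi)
    | some i =>
      have := interior_closure_discrete (hD i)
      simp only [Option.elim] at hi
      rw [this] at hi
      exact hi.elim
  obtain ⟨x, hx⟩ := hne
  have : x ∈ interior (⋃ i, closure (D i)) := interior_maximal h2 hO hx
  rw [h4] at this
  exact this

lemma baire {X : Type} [DSp X] [TopologicalSpace X] [BaireSpace X] (hX : SD L X)
    {κ : Type} [Countable κ] {S : κ → X → Prop} (hS : ∀ k, DP L (S k)) {W : Set X}
    (hW : IsOpen W) (hne : W.Nonempty) (hsub : ∀ x ∈ W, ∃ k, S k x) :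
    ∃ k, (interior {x | S k x} ∩ W).Nonempty := by
  have := dense_iUnion_interior_of_closed (X := X) (ι := Option κ)
      (f := fun i => i.elim (Wᶜ) (fun i => closure {x | S i x})) (by
        intro i; cases i
        · exact hW.isClosed_compl
        · exact isClosed_closure) (by
        apply eq_univ_of_forall
        intro x
        by_cases hx : x ∈ W
        · obtain ⟨i, hi⟩ := hsub x hx
          exact mem_iUnion.2 ⟨some i, subset_closure hi⟩
        · exact mem_iUnion.2 ⟨none, hx⟩)
  obtain ⟨x, hx1, hx2⟩ := this.inter_open_nonempty W hW hne
  obtain ⟨i, hi⟩ := mem_iUnion.1 hx2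
  cases i with
  | none => exact absurd hx1 (interior_subset hi)
  | some i =>
    simp only [Option.elim] at hi
    refine ⟨i, ?_⟩
    obtain ⟨y, hy⟩ := hX (S i) (hS i) (interior (closure {x | S i x}) ∩ W)
      (isOpen_interior.inter hW) ⟨x, hi, hx1⟩ (inter_subset_left.trans interior_subset)
    exact ⟨y, hy.1, hy.2.2⟩

lemma SD.prodR [DM L] {X : Type} [DSp X] [TopologicalSpace X] [BaireSpace X] (hX : SD L X) :
    SD L (X × ℝ) := by
  intro S hS O hO ⟨⟨x0, t0⟩, h0⟩ hsub
  obtain ⟨I, J, hI, hJ, hx0, ht0, hIJ⟩ := isOpen_prod_iff.1 hO x0 t0 h0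
  have hrat : ∀ u v : ℝ, u < v → ∃ c d : ℚ, u < c ∧ (c : ℝ) < d ∧ d < v := by
    intro u v h
    obtain ⟨c, hc1, hc2⟩ := exists_rat_btwn h
    obtain ⟨d, hd1, hd2⟩ := exists_rat_btwn hc2
    exact ⟨c, d, hc1, hd1, hd2⟩
  -- T relative to J
  obtain ⟨r, hr, hJr⟩ := Metric.isOpen_iff.1 hJ t0 ht0
  have hJ' : Ioo (t0 - r) (t0 + r) ⊆ J := by rwa [← Real.ball_eq_Ioo]
  have hT : DP L (fun x => ∃ c d : ℝ, c < d ∧ (t0 - r ≤ c ∧ d ≤ t0 + r) ∧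
      ∀ t, c < t → t < d → S (x, t)) := by
    apply DP.ex; apply DP.ex
    apply DP.and
    · exact DP.lt DF.fst'.snd DF.snd'
    · apply DP.and
      · exact (DP.le (DF.const _) DF.fst'.snd).and (DP.le DF.snd' (DF.const _))
      apply DP.all
      apply DP.imp (DP.lt DF.fst'.fst.snd DF.snd')
      apply DP.imp (DP.lt DF.snd' DF.fst'.snd)
      exact hS.comp (DF.fst'.fst.fst.pair DF.snd')
  set T : X → Prop := fun x => ∃ c d : ℝ, c < d ∧ (t0 - r ≤ c ∧ d ≤ t0 + r) ∧
      ∀ t, c < t → t < d → S (x, t) with hTd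
  by_cases hc : I ⊆ closure {x | T x}
  · have hW := hX T hT I hI ⟨x0, hx0⟩ hc
    obtain ⟨⟨c, d⟩, y, hy1, hy2, hy3⟩ := baire hX (κ := ℚ × ℚ)
      (S := fun k x => (k.1 : ℝ) < k.2 ∧ (t0 - r ≤ k.1 ∧ k.2 ≤ t0 + r) ∧
        ∀ t, (k.1 : ℝ) < t → t < k.2 → S (x, t)) (by
        intro k
        refine DP.and (DP.constp _) (DP.and (DP.constp _) ?_)
        apply DP.all
        apply DP.imp (DP.lt (DF.const _) DF.snd')
        apply DP.imp (DP.lt DF.snd' (DF.const _))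
        exact hS) (isOpen_interior.inter hI) hW (by
        rintro x ⟨hx, -⟩
        obtain ⟨c, d, hcd, ⟨h1, h2⟩, h3⟩ := interior_subset hx
        obtain ⟨c', d', h4, h5, h6⟩ := hrat c d hcd
        exact ⟨(c', d'), h5, ⟨by linarith, by linarith⟩, fun t ht1 ht2 => h3 t (by linarith) (by linarith)⟩)
    obtain ⟨hcd, ⟨h1, h2⟩, -⟩ := interior_subset hy1
    simp only at hcd h1 h2
    refine ⟨(y, (c + d) / 2), ?_, hIJ ⟨hy3, hJ' ⟨by linarith, by linarith⟩⟩⟩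
    rw [mem_interior]
    refine ⟨_ ×ˢ Ioo (c : ℝ) d, ?_, isOpen_interior.prod isOpen_Ioo, ⟨hy1, by linarith, by linarith⟩⟩
    rintro ⟨x, t⟩ ⟨hx, ht⟩
    exact (interior_subset hx).2.2 t ht.1 ht.2
  · exfalso
    obtain ⟨x1, hx1, hx1'⟩ := not_subset.1 hc
    obtain ⟨⟨c, d⟩, y, hy1, hy2, hy3⟩ := baire hX (κ := ℚ × ℚ)
      (S := fun k x => (k.1 : ℝ) < k.2 ∧ (t0 - r ≤ k.1 ∧ k.2 ≤ t0 + r) ∧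
        ∀ t, (k.1 : ℝ) < t → t < k.2 → ¬ S (x, t)) (by
        intro k
        refine DP.and (DP.constp _) (DP.and (DP.constp _) ?_)
        apply DP.all
        apply DP.imp (DP.lt (DF.const _) DF.snd')
        apply DP.imp (DP.lt DF.snd' (DF.const _))
        exact hS.not) (isClosed_closure.isOpen_compl.inter hI) ⟨x1, hx1', hx1⟩ (by
        rintro x ⟨hx, hxI⟩
        have hnT : ¬ T x := fun h => hx (subset_closure h)
        have h3 : ¬ (Ioo (t0 - r) (t0 + r) ⊆ closure {t | S (x, t)}) := by
          intro h3
          obtain ⟨t, ht1, ht2⟩ := sdR (fun t => S (x, t)) (hS.comp ((DF.const x).pair DF.id)) _ isOpen_Ioo ⟨t0, by constructor <;> linarith⟩ h3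
          obtain ⟨ε, hε, hb⟩ := Metric.isOpen_iff.1 (isOpen_interior.inter (isOpen_Ioo (a := t0 - r) (b := t0 + r))) t ⟨ht1, ht2⟩
          rw [Real.ball_eq_Ioo] at hb
          have ha : Icc (t - ε) (t + ε) ⊆ Icc (t0 - r) (t0 + r) := by
            rw [← closure_Ioo (by linarith), ← closure_Ioo (by linarith)]
            exact closure_mono (hb.trans inter_subset_right)
          refine hnT ⟨t - ε, t + ε, by linarith, ⟨(ha ⟨le_refl _, by linarith⟩).1, (ha ⟨by linarith, le_refl _⟩).2⟩, fun s hs1 hs2 => ?_⟩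
          exact interior_subset (s := {t | S (x, t)}) (hb ⟨hs1, hs2⟩).1
        obtain ⟨t, ht, ht'⟩ := not_subset.1 h3
        obtain ⟨ε, hε, hb⟩ := Metric.isOpen_iff.1 ((isClosed_closure (s := {t | S (x, t)})).isOpen_compl.inter (isOpen_Ioo (a := t0 - r) (b := t0 + r))) t ⟨ht', ht⟩
        rw [Real.ball_eq_Ioo] at hb
        obtain ⟨c', d', h4, h5, h6⟩ := hrat (t - ε) (t + ε) (by linarith)
        have hcc := (hb (show (c' : ℝ) ∈ _ from ⟨h4, by linarith⟩)).2
        have hdd := (hb (show (d' : ℝ) ∈ _ from ⟨by linarith, h6⟩)).2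
        refine ⟨(c', d'), h5, ⟨hcc.1.le, hdd.2.le⟩, fun s hs1 hs2 hs => ?_⟩
        exact (hb ⟨by linarith, by linarith⟩).1 (subset_closure hs))
    obtain ⟨hcd, ⟨h1, h2⟩, -⟩ := interior_subset hy1
    simp only at hcd h1 h2
    have hm : (y, ((c : ℝ) + d) / 2) ∈ O := hIJ ⟨hy3, hJ' ⟨by linarith, by linarith⟩⟩
    obtain ⟨⟨x, t⟩, hxt, hS'⟩ := mem_closure_iff.1 (hsub hm) _
      (isOpen_interior.prod isOpen_Ioo) (show (y, ((c : ℝ) + d) / 2) ∈ interior _ ×ˢ Ioo (c : ℝ) d from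
        ⟨hy1, by linarith, by linarith⟩)
    exact (interior_subset hxt.1).2.2 t hxt.2.1 hxt.2.2 hS'

lemma SD.homeo {X Y : Type} [DSp X] [TopologicalSpace X] [DSp Y] [TopologicalSpace Y]
    (hX : SD L X) (h : X ≃ₜ Y) (hh : DF L h) : SD L Y := by
  intro S hS O hO hne hsub
  have := hX (fun x => S (h x)) (hS.comp hh) (h ⁻¹' O) (hO.preimage h.continuous)
    (hne.preimage h.surjective) (by
      have e : {x | S (h x)} = h ⁻¹' {y | S y} := rfl
      rw [e, ← h.preimage_closure]
      exact preimage_mono hsub)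
  obtain ⟨x, hx1, hx2⟩ := this
  refine ⟨h x, ?_, hx2⟩
  have e : {x | S (h x)} = h ⁻¹' {y | S y} := rfl
  rw [e, ← h.preimage_interior] at hx1
  exact hx1

lemma sdFin [DM L] (n : ℕ) : SD L (Fin n → ℝ) := by
  induction n with
  | zero =>
    intro S hS O hO hne hsub
    obtain ⟨x, hx⟩ := hne
    obtain ⟨y, hy⟩ := mem_closure_iff.1 (hsub hx) _ hO hx
    refine ⟨y, ?_, hy.1⟩
    have : {x | S x} = univ := by
      apply eq_univ_of_forall
      intro z
      rw [Subsingleton.elim z y]; exact hy.2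
    rw [this]; simp
  | succ n ih =>
    refine ih.prodR.homeo (Y := Fin (n + 1) → ℝ)
      { toFun := fun q => Fin.cons q.2 q.1
        invFun := fun v => (fun i => v i.succ, v 0)
        left_inv := fun q => by simp
        right_inv := fun v => by
          ext i; refine Fin.cases ?_ (fun j => ?_) i <;> simp
        continuous_toFun := by
          apply continuous_pi
          intro i
          refine Fin.cases ?_ (fun j => ?_) i
          · simpa using continuous_snd
          · simp only [Fin.cons_succ]; fun_prop
        continuous_invFun := by fun_prop } ?_
    apply DF.pi
    intro i
    refine Fin.cases ?_ (fun j => ?_) i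
    · simpa using DF.snd'
    · simpa using DF.fst'.app j

lemma sd [DM L] (κ : Type) [Finite κ] : SD L (κ → ℝ) := by
  obtain ⟨k, ⟨h⟩⟩ := Finite.exists_equiv_fin κ
  refine (sdFin k).homeo
    { toFun := fun v i => v (h i)
      invFun := fun v i => v (h.symm i)
      left_inv := fun v => by simp
      right_inv := fun v => by simp
      continuous_toFun := by fun_prop
      continuous_invFun := by fun_prop } ?_
  apply DF.pi
  intro i
  exact DF.id.app (h i)

lemma SD.dense {X : Type} [DSp X] [TopologicalSpace X] (hX : SD L X) {S : X → Prop} (hS : DP L S)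
    (hd : Dense {x | S x}) : Dense (interior {x | S x}) := by
  rw [dense_iff_inter_open]
  intro U hU hne
  obtain ⟨x, hx⟩ := hX S hS U hU hne (by rw [hd.closure_eq]; exact subset_univ _)
  exact ⟨x, hx.2, hx.1⟩

end sd
section smooth
variable {L}
variable {X : Type} [DSp X]

lemma cont_dense [OF L] {X : Type} [DSp X] [TopologicalSpace X] [BaireSpace X] (hX : SD L X)
    (hev : ∀ P : X → Prop, DP L P → DP L (fun x => ∀ᶠ y in 𝓝 x, P y))
    {f : X → ℝ} (hf : DF L f) : Dense {x | ContinuousAt f x} := by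
  rw [dense_iff_inter_open]
  intro W hW hne
  by_contra hcon
  obtain ⟨⟨c, d⟩, y, hy1, hy2⟩ := baire hX (κ := ℚ × ℚ)
    (S := fun k x => ((k.1 : ℝ) < f x ∧ f x < k.2) ∧ ¬ ∀ᶠ y in 𝓝 x, ((k.1 : ℝ) < f y ∧ f y < k.2)) (by
      intro k
      have h1 : DP L (fun x => ((k.1 : ℝ) < f x ∧ f x < k.2)) :=
        (DP.lt (DF.const _) hf).and (DP.lt hf (DF.const _))
      exact h1.and (hev _ h1).not) hW hne (by
      intro x hx
      have h1 : ¬ ContinuousAt f x := fun h => hcon ⟨x, hx, h⟩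
      by_contra h2
      push Not at h2
      apply h1
      rw [Metric.continuousAt_iff']
      intro ε hε
      obtain ⟨c, hc1, hc2⟩ := exists_rat_btwn (show f x - ε < f x by linarith)
      obtain ⟨d, hd1, hd2⟩ := exists_rat_btwn (show f x < f x + ε by linarith)
      filter_upwards [h2 (c, d) ⟨hc2, hd1⟩] with y hy
      rw [Real.dist_eq, abs_lt]
      constructor <;> [have := hy.1; have := hy.2] <;> linarith)
  have h3 := mem_interior_iff_mem_nhds.1 hy1
  refine (interior_subset hy1).2 ?_
  filter_upwards [h3] with z hz using hz.1

lemma DP.hasDeriv [OF L] {F : X → ℝ → ℝ} {c a : X → ℝ} (hF : DF L (fun q : X × ℝ => F q.1 q.2))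
    (hc : DF L c) (ha : DF L a) : DP L (fun x => HasDerivAt (F x) (c x) (a x)) := by
  have : DP L (fun x => ∀ ε : ℝ, 0 < ε → ∀ᶠ y in 𝓝 (a x),
      |F x y - F x (a x) - (y - a x) * c x| ≤ ε * |y - a x|) := by
    apply DP.all
    apply DP.imp (DP.lt (DF.const _) DF.snd')
    apply DP.evR (ha.comp DF.fst')
    have e1 : DF L (fun q : (X × ℝ) × ℝ => q.2 - a q.1.1) := DF.snd'.sub (ha.comp DF.fst'.fst)
    apply DP.le
    · apply DF.abs
      apply DF.sub
      · apply DF.sub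
        · exact hF.comp (DF.fst'.fst.pair DF.snd')
        · exact hF.comp (DF.fst'.fst.pair (ha.comp DF.fst'.fst))
      · exact e1.mul (hc.comp DF.fst'.fst)
    · exact DF.fst'.snd.mul e1.abs
  refine this.congr fun x => ?_
  rw [hasDerivAt_iff_isLittleO, Asymptotics.isLittleO_iff]
  simp only [Real.norm_eq_abs, smul_eq_mul]

lemma DP.diff [OF L] {F : X → ℝ → ℝ} {a : X → ℝ} (hF : DF L (fun q : X × ℝ => F q.1 q.2))
    (ha : DF L a) : DP L (fun x => DifferentiableAt ℝ (F x) (a x)) := by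
  have : DP L (fun x => ∃ c, HasDerivAt (F x) c (a x)) := by
    apply DP.ex
    exact DP.hasDeriv (F := fun q : X × ℝ => F q.1) (hF.comp (DF.fst'.fst.pair DF.snd')) DF.snd' (ha.comp DF.fst')
  refine this.congr fun x => ⟨fun h => ⟨_, h.hasDerivAt⟩, fun ⟨c, h⟩ => h.differentiableAt⟩

lemma DF.deriv [OF L] {F : X → ℝ → ℝ} {a : X → ℝ} (hF : DF L (fun q : X × ℝ => F q.1 q.2))
    (ha : DF L a) : DF L (fun x => deriv (F x) (a x)) := by
  apply DF.of (P := fun x y => HasDerivAt (F x) y (a x) ∨ (¬ DifferentiableAt ℝ (F x) (a x) ∧ y = 0))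
  · apply DP.or
    · exact DP.hasDeriv (F := fun q : X × ℝ => F q.1) (hF.comp (DF.fst'.fst.pair DF.snd')) DF.snd' (ha.comp DF.fst')
    · exact ((DP.diff hF ha).comp DF.fst').not.and (DP.eq DF.snd' (DF.const _))
  · intro x y
    by_cases h : DifferentiableAt ℝ (F x) (a x)
    · simp only [h, not_true, false_and, or_false]
      exact ⟨fun e => e ▸ h.hasDerivAt, fun e => e.deriv.symm⟩
    · simp only [h, not_false_iff, true_and]
      rw [deriv_zero_of_not_differentiableAt h]
      exact ⟨Or.inr, fun e => e.elim (fun e => (h e.differentiableAt).elim) (fun e => e)⟩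

lemma DF.update {κ : Type} [Finite κ] {f : X → κ → ℝ} {t : X → ℝ} (hf : DF L f) (ht : DF L t) (i : κ) :
    DF L (fun x => Function.update (f x) i (t x)) := by
  apply DF.pi
  intro j
  by_cases h : j = i
  · subst h; simpa using ht
  · simpa [h] using hf.app j

lemma DP.contAt [OF L] {κ : Type} [Fintype κ] {f : X → (κ → ℝ) → ℝ} {a : X → κ → ℝ}
    (hf : DF L (fun q : X × (κ → ℝ) => f q.1 q.2)) (ha : DF L a) : DP L (fun x => ContinuousAt (f x) (a x)) := by
  have : DP L (fun x => ∀ ε : ℝ, 0 < ε → ∀ᶠ y in 𝓝 (a x), dist (f x y) (f x (a x)) < ε) := by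
    apply DP.all
    apply DP.imp (DP.lt (DF.const _) DF.snd')
    apply DP.ev (ha.comp DF.fst')
    apply DP.distltR
    · exact hf.comp (DF.fst'.fst.pair DF.snd')
    · exact hf.comp (DF.fst'.fst.pair (ha.comp DF.fst'.fst))
    · exact DF.fst'.snd
  refine this.congr fun x => ?_
  rw [Metric.continuousAt_iff']

lemma DP.contDiffAt [OF L] {κ : Type} [Fintype κ] (k : ℕ) : ∀ {f : X → (κ → ℝ) → ℝ} 
    (hf : DF L (fun q : X × (κ → ℝ) => f q.1 q.2)),
    DP L (fun q : X × (κ → ℝ) => ContDiffAt ℝ k (f q.1) q.2) := by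
  induction k with
  | zero =>
    intro f hf
    have : DP L (fun q : X × (κ → ℝ) => ∀ᶠ x in 𝓝 q.2, ContinuousAt (f q.1) x) := by
      apply DP.ev DF.snd'
      exact DP.contAt (f := fun q : (X × (κ → ℝ)) × (κ → ℝ) => f q.1.1) (hf.comp (DF.fst'.fst.fst.pair DF.snd')) DF.snd'
    exact this.congr fun q => contDiffAt_zero_iff _ _
  | succ k ih =>
    intro f hf
    refine DP.congr (DP.and ?_ ?_) fun q => contDiffAt_succ_pd k (f q.1) q.2
    · apply DP.ev DF.snd'
      apply DP.fall
      intro i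
      apply DP.diff (F := fun (q : (X × (κ → ℝ)) × (κ → ℝ)) t => f q.1.1 (Function.update q.2 i t))
      · exact hf.comp (DF.fst'.fst.fst.pair (DF.update DF.fst'.snd DF.snd' i))
      · exact DF.snd'.app i
    · apply DP.fall
      intro i
      apply ih (f := fun q => pd i (f q))
      apply DF.deriv (F := fun (q : X × (κ → ℝ)) t => f q.1 (Function.update q.2 i t))
      · exact hf.comp (DF.fst'.fst.pair (DF.update DF.fst'.snd DF.snd' i))
      · exact DF.snd'.app i

lemma DF.pd [OF L] {κ : Type} [Fintype κ] {f : (κ → ℝ) → ℝ} (hf : DF L f) (i : κ) : DF L (pd i f) := by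
  apply DF.deriv (F := fun (q : (κ → ℝ)) t => f (Function.update q i t))
  · exact hf.comp ((DF.update DF.fst' DF.snd' i))
  · exact DF.id.app i

lemma DP.contDiffAt' [OF L] {κ : Type} [Fintype κ] (k : ℕ) {f : (κ → ℝ) → ℝ} 
    (hf : DF L f) : DP L (fun q : (κ → ℝ) => ContDiffAt ℝ k f q) := by
  have := DP.contDiffAt (L := L) (X := ℝ) k (f := fun _ => f) (hf.comp DF.snd')
  exact this.comp ((DF.const 0).pair DF.id)

lemma diff1 [DM L] {f : ℝ → ℝ} (hf : DF L f) {a b : ℝ} (hab : a < b) :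
    ∃ t ∈ Ioo a b, DifferentiableAt ℝ f t := by
  have hc := cont_dense sdR (fun P hP => DP.evR DF.id (hP.comp DF.snd')) hf
  have hcd : DP L (fun t => ContinuousAt f t) := by
    have : DP L (fun x => ∀ ε : ℝ, 0 < ε → ∀ᶠ y in 𝓝 x, dist (f y) (f x) < ε) := by
      apply DP.all
      apply DP.imp (DP.lt (DF.const _) DF.snd')
      apply DP.evR (DF.fst')
      apply DP.distltR
      · exact hf.comp DF.snd'
      · exact hf.comp DF.fst'.fst
      · exact DF.fst'.snd
    refine this.congr fun x => ?_
    rw [Metric.continuousAt_iff']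
  obtain ⟨t, ht1, ht2⟩ := (sdR.dense hcd hc).inter_open_nonempty _ isOpen_Ioo (nonempty_Ioo.2 hab)
  obtain ⟨ε, hε, hb⟩ := Metric.isOpen_iff.1 (isOpen_Ioo.inter isOpen_interior) t ⟨ht1, ht2⟩
  rw [Real.ball_eq_Ioo] at hb
  -- replace a, b
  have key : ∀ a b : ℝ, a < b → (∀ x ∈ Ioo a b, ContinuousAt f x) → ∃ t ∈ Ioo a b, DifferentiableAt ℝ f t := by
    clear! a b t
    intro a b hab hcont
    by_cases hinj : ∃ c d, a < c ∧ c < d ∧ d < b ∧ InjOn f (Icc c d)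
    · obtain ⟨c, d, h1, h2, h3, h4⟩ := hinj
      have hco : ContinuousOn f (Icc c d) := fun x hx => (hcont x ⟨by linarith [hx.1], by linarith [hx.2]⟩).continuousWithinAt
      have : ∃ᵐ x : ℝ, x ∈ Ioo c d := by
        rw [MeasureTheory.frequently_ae_mem_iff]
        simp [h2]
      have hmon : ∃ x ∈ Ioo c d, DifferentiableWithinAt ℝ f (Icc c d) x := by
        rcases hco.strictMonoOn_of_injOn_Icc' h2.le h4 with h | h
        · obtain ⟨x, hx⟩ := (this.and_eventually h.monotoneOn.ae_differentiableWithinAt_of_mem).exists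
          exact ⟨x, hx.1, hx.2 ⟨hx.1.1.le, hx.1.2.le⟩⟩
        · have h' : MonotoneOn (fun x => - f x) (Icc c d) := h.antitoneOn.neg
          obtain ⟨x, hx⟩ := (this.and_eventually h'.ae_differentiableWithinAt_of_mem).exists
          refine ⟨x, hx.1, ?_⟩
          have := (hx.2 ⟨hx.1.1.le, hx.1.2.le⟩).neg
          simpa using this
      obtain ⟨x, hx, hd⟩ := hmon
      exact ⟨x, ⟨by linarith [hx.1], by linarith [hx.2]⟩, hd.differentiableAt (Icc_mem_nhds hx.1 hx.2)⟩
    · push Not at hinj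
      have hle : ∀ c d, a < c → c < d → d < b → ∃ x ∈ Ioo c d, IsLocalExtr f x := by
        intro c d h1 h2 h3
        have := hinj c d h1 h2 h3
        simp only [InjOn, not_forall] at this
        obtain ⟨u, hu, v, hv, huv, hne⟩ := this
        have hco : ∀ u v, u ∈ Icc c d → v ∈ Icc c d → ContinuousOn f (Icc u v) := fun u v hu hv x hx =>
          (hcont x ⟨by linarith [hx.1, hu.1], by linarith [hx.2, hv.2]⟩).continuousWithinAt
        rcases lt_or_gt_of_ne hne with h | h
        · obtain ⟨x, hx, hx'⟩ := exists_isLocalExtr_Ioo h (hco u v hu hv) huv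
          exact ⟨x, ⟨by linarith [hx.1, hu.1], by linarith [hx.2, hv.2]⟩, hx'⟩
        · obtain ⟨x, hx, hx'⟩ := exists_isLocalExtr_Ioo h (hco v u hv hu) huv.symm
          exact ⟨x, ⟨by linarith [hx.1, hv.1], by linarith [hx.2, hu.2]⟩, hx'⟩
      have hmin : DP L (fun t => IsLocalMin f t) := by
        apply DP.evR DF.id
        exact DP.le (hf.comp DF.fst') (hf.comp DF.snd')
      have hmax : DP L (fun t => IsLocalMax f t) := by
        apply DP.evR DF.id
        exact DP.le (hf.comp DF.snd') (hf.comp DF.fst')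
      have hex : DP L (fun t => IsLocalExtr f t) := hmin.or hmax
      have hint := sdR _ hex (Ioo a b) isOpen_Ioo (nonempty_Ioo.2 hab) (by
        intro x hx
        rw [Metric.mem_closure_iff]
        intro ε hε
        obtain ⟨y, hy, hy'⟩ := hle (max (x - ε) ((a + x) / 2)) (min (x + ε) ((x + b) / 2))
          (by rw [lt_max_iff]; right; linarith [hx.1])
          (by rw [max_lt_iff, lt_min_iff, lt_min_iff]; refine ⟨⟨?_, ?_⟩, ?_, ?_⟩ <;> linarith [hx.1, hx.2])
          (by rw [min_lt_iff]; right; linarith [hx.2])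
        refine ⟨y, hy', ?_⟩
        rw [dist_comm, Real.dist_eq, abs_lt]
        have h1 := lt_of_le_of_lt (le_max_left _ _) hy.1
        have h2 := lt_of_lt_of_le hy.2 (min_le_left _ _)
        constructor <;> linarith)
      obtain ⟨⟨s, c, d⟩, y, hy1, hy2, hy3⟩ := baire (L := L) sdR (κ := Bool × ℚ × ℚ)
        (S := fun k x => ((k.2.1 : ℝ) < x ∧ x < k.2.2) ∧ ∀ y, ((k.2.1 : ℝ) < y ∧ y < k.2.2) →
          if k.1 then f x ≤ f y else f y ≤ f x) (by
          intro k
          apply DP.and ((DP.lt (DF.const _) DF.id).and (DP.lt DF.id (DF.const _)))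
          apply DP.all
          apply DP.imp ((DP.lt (DF.const _) DF.snd').and (DP.lt DF.snd' (DF.const _)))
          rcases k.1
          · simpa using DP.le (hf.comp DF.snd') (hf.comp DF.fst')
          · simpa using DP.le (hf.comp DF.fst') (hf.comp DF.snd')) (isOpen_interior.inter isOpen_Ioo) hint (by
          rintro x ⟨hx, hx'⟩
          have hgen : ∀ Q : ℝ → Prop, (∀ᶠ y in 𝓝 x, Q y) → ∃ c d : ℚ, ((c : ℝ) < x ∧ x < d) ∧ ∀ y, ((c : ℝ) < y ∧ y < d) → Q y := by
            intro Q hQ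
            obtain ⟨ε, hε, hb⟩ := Metric.eventually_nhds_iff.1 hQ
            obtain ⟨c, hc1, hc2⟩ := exists_rat_btwn (show x - ε < x by linarith)
            obtain ⟨d, hd1, hd2⟩ := exists_rat_btwn (show x < x + ε by linarith)
            refine ⟨c, d, ⟨hc2, hd1⟩, fun y hy => hb ?_⟩
            rw [Real.dist_eq, abs_lt]
            constructor <;> linarith [hy.1, hy.2]
          rcases interior_subset hx with h | h
          · obtain ⟨c, d, h1, h2⟩ := hgen _ h
            exact ⟨(true, c, d), h1, by simpa using h2⟩
          · obtain ⟨c, d, h1, h2⟩ := hgen _ h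
            exact ⟨(false, c, d), h1, by simpa using h2⟩)
      refine ⟨y, hy3, ?_⟩
      have hcst : f =ᶠ[𝓝 y] fun _ => f y := by
        filter_upwards [mem_interior_iff_mem_nhds.1 hy1] with z hz
        have h1 := interior_subset hy1
        have h2 := h1.2 z hz.1
        have h3 := hz.2 y h1.1
        cases s
        · simp at h2 h3; linarith
        · simp at h2 h3; linarith
      exact (differentiableAt_const (f y)).congr_of_eventuallyEq hcst
  obtain ⟨s, hs, hs'⟩ := key (t - ε) (t + ε) (by linarith) (fun x hx => interior_subset (s := {t | ContinuousAt f t}) (hb hx).2)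
  exact ⟨s, (hb hs).1, hs'⟩

lemma contDiff_dense [DM L] {κ : Type} [Fintype κ] (k : ℕ) : ∀ {f : (κ → ℝ) → ℝ} (hf : DF L f),
    Dense {x | ContDiffAt ℝ k f x} := by
  induction k with
  | zero =>
    intro f hf
    have h1 := cont_dense (sd κ) (fun P hP => DP.ev DF.id (hP.comp DF.snd')) hf
    have h2 := (sd κ).dense (DP.contAt (f := fun _ : κ → ℝ => f) (hf.comp DF.snd') DF.id) h1
    refine h2.mono ?_
    intro x hx
    exact (contDiffAt_zero_iff f x).2 (mem_interior_iff_mem_nhds.1 hx)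
  | succ k ih =>
    intro f hf
    have h1 : ∀ i, Dense {x : κ → ℝ | DifferentiableAt ℝ (fun t => f (Function.update x i t)) (x i)} := by
      intro i
      rw [dense_iff_inter_open]
      rintro W hW ⟨x, hx⟩
      have hg : DF L (fun t => f (Function.update x i t)) := hf.comp (DF.update (DF.const x) DF.id i)
      have hcu : Continuous (fun t : ℝ => Function.update x i t) := by fun_prop
      have : (fun t : ℝ => Function.update x i t) ⁻¹' W ∈ 𝓝 (x i) :=
        (hW.preimage hcu).mem_nhds (by simpa using hx)
      obtain ⟨ε, hε, hb⟩ := Metric.mem_nhds_iff.1 this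
      rw [Real.ball_eq_Ioo] at hb
      obtain ⟨t, ht, hd⟩ := diff1 hg (show x i - ε < x i + ε by linarith)
      refine ⟨Function.update x i t, hb ht, ?_⟩
      simpa using hd
    have h2 : ∀ i, DP L (fun x : κ → ℝ => DifferentiableAt ℝ (fun t => f (Function.update x i t)) (x i)) := by
      intro i
      apply DP.diff (F := fun (q : κ → ℝ) t => f (Function.update q i t))
      · exact hf.comp (DF.update DF.fst' DF.snd' i)
      · exact DF.id.app i
    have h3 := fun i => (sd κ).dense (h2 i) (h1 i)
    have h4 := fun i => (sd κ).dense (DP.contDiffAt' k (hf.pd i)) (ih (hf.pd i))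
    have h5 := (dense_iInter_of_isOpen (fun i => isOpen_interior) h3).inter_of_isOpen_right
      (dense_iInter_of_isOpen (fun i => isOpen_interior) h4) (isOpen_iInter_of_finite fun i => isOpen_interior)
    refine h5.mono ?_
    rintro x ⟨hx1, hx2⟩
    refine (contDiffAt_succ_pd k f x).2 ⟨?_, fun i => ?_⟩
    · rw [eventually_all]
      intro i
      exact mem_interior_iff_mem_nhds.1 (mem_iInter.1 hx1 i)
    · exact interior_subset (s := {x | ContDiffAt ℝ k (DMinPaper.pd i f) x}) (mem_iInter.1 hx2 i)

end smooth
section regular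
variable {L}
variable {κ : Type} [Fintype κ]

def ag (s : Finset κ) (x y : κ → ℝ) : Prop := ∀ i, i ∈ s → x i = y i
def Inn (s : Finset κ) (c : κ → ℝ) (ε : ℝ) (y : κ → ℝ) : Prop := ∀ j, j ∉ s → |y j - c j| < ε
def U1 (A : Set (κ → ℝ)) (s : Finset κ) (c : κ → ℝ) (ε : ℝ) (x y : κ → ℝ) : Prop :=
  y ∈ A ∧ ag s y x ∧ Inn s c ε y
def sec (A : Set (κ → ℝ)) (s : Finset κ) (c : κ → ℝ) (ε : ℝ) (x : κ → ℝ) : κ → ℝ :=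
  if h : ∃! y, U1 A s c ε x y then h.choose else 0
def Reg (p : ℕ) (A : Set (κ → ℝ)) (s : Finset κ) (x : κ → ℝ) : Prop :=
  x ∈ A ∧ ∃ (c : κ → ℝ) (ε : ℝ), 0 < ε ∧ Inn s c ε x ∧
    (∀ᶠ x' in 𝓝 x, ∃! y, U1 A s c ε x' y) ∧ ∀ j, ContDiffAt ℝ p (fun x' => sec A s c ε x' j) x

lemma ag.symm {s : Finset κ} {x y : κ → ℝ} (h : ag s x y) : ag s y x := fun i hi => (h i hi).symm
lemma ag.trans {s : Finset κ} {x y z : κ → ℝ} (h : ag s x y) (h' : ag s y z) : ag s x z :=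
  fun i hi => (h i hi).trans (h' i hi)

lemma sec_spec {A : Set (κ → ℝ)} {s : Finset κ} {c : κ → ℝ} {ε : ℝ} {x : κ → ℝ}
    (h : ∃! y, U1 A s c ε x y) : U1 A s c ε x (sec A s c ε x) := by
  unfold sec; rw [dif_pos h]; exact h.choose_spec.1
lemma sec_eq {A : Set (κ → ℝ)} {s : Finset κ} {c : κ → ℝ} {ε : ℝ} {x y : κ → ℝ}
    (h : ∃! y, U1 A s c ε x y) (hy : U1 A s c ε x y) : sec A s c ε x = y :=
  h.unique (sec_spec h) hy

lemma U1_ag {A : Set (κ → ℝ)} {s : Finset κ} {c : κ → ℝ} {ε : ℝ} {x x' : κ → ℝ} (h : ag s x x') :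
    U1 A s c ε x = U1 A s c ε x' := by
  ext y
  exact ⟨fun ⟨h1, h2, h3⟩ => ⟨h1, h2.trans h, h3⟩, fun ⟨h1, h2, h3⟩ => ⟨h1, h2.trans h.symm, h3⟩⟩
lemma sec_ag {A : Set (κ → ℝ)} {s : Finset κ} {c : κ → ℝ} {ε : ℝ} {x x' : κ → ℝ} (h : ag s x x') :
    sec A s c ε x = sec A s c ε x' := by
  unfold sec; simp only [U1_ag h]

def Tm (s : Finset κ) (x0 : κ → ℝ) (x : κ → ℝ) : κ → ℝ := fun i => if i ∈ s then x i else x0 i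
lemma Tm_ag (s : Finset κ) (x0 x : κ → ℝ) : ag s (Tm s x0 x) x := fun i hi => by simp [Tm, hi]
lemma Tm_eq {s : Finset κ} {x0 x : κ → ℝ} (h : ag s x0 x) : Tm s x0 x = x0 := by
  ext i; by_cases hi : i ∈ s
  · simp [Tm, hi, h i hi]
  · simp [Tm, hi]
lemma Tm_cd {n : WithTop ℕ∞} (s : Finset κ) (x0 : κ → ℝ) : ContDiff ℝ n (Tm s x0) := by
  rw [contDiff_pi]
  intro i
  by_cases hi : i ∈ s
  · simp only [Tm, hi, if_true]; exact contDiff_apply ℝ ℝ i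
  · simp only [Tm, hi, if_false]; exact contDiff_const

lemma cyl {s : Finset κ} {P : (κ → ℝ) → Prop} (hP : ∀ x x', ag s x x' → P x → P x') {x y : κ → ℝ}
    (h : ag s x y) (hx : ∀ᶠ x' in 𝓝 x, P x') : ∀ᶠ x' in 𝓝 y, P x' := by
  have hc : Continuous (Tm s x) := (Tm_cd (n := 0) s x).continuous
  have : Tendsto (Tm s x) (𝓝 y) (𝓝 x) := by
    have := hc.tendsto y
    rwa [Tm_eq h] at this
  filter_upwards [this.eventually hx] with z hz
  exact hP _ _ (Tm_ag s x z) hz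

lemma Inn_ev {s : Finset κ} {c : κ → ℝ} {ε : ℝ} {x : κ → ℝ} (h : Inn s c ε x) : ∀ᶠ x' in 𝓝 x, Inn s c ε x' := by
  unfold Inn
  rw [eventually_all]
  intro j
  by_cases hj : j ∈ s
  · simp [hj]
  · have hc : Continuous (fun x' : κ → ℝ => |x' j - c j|) := by fun_prop
    filter_upwards [hc.continuousAt.eventually (eventually_lt_nhds (h j hj))] with z hz _ using hz

lemma Reg_open (p : ℕ) {A : Set (κ → ℝ)} {s : Finset κ} {x : κ → ℝ} (h : Reg p A s x) :
    ∀ᶠ x' in 𝓝 x, x' ∈ A → Reg p A s x' := by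
  obtain ⟨hA, c, ε, hε, h1, h2, h3⟩ := h
  have h4 : ∀ᶠ x' in 𝓝 x, ∀ j, ContDiffAt ℝ p (fun x' => sec A s c ε x' j) x' := by
    rw [eventually_all]
    intro j
    exact (h3 j).eventually (by simp)
  filter_upwards [Inn_ev h1, h2.eventually_nhds, h4] with z hz1 hz2 hz3 hzA
  exact ⟨hzA, c, ε, hε, hz1, hz2, hz3⟩

lemma Reg_closed (p : ℕ) {A : Set (κ → ℝ)} {s : Finset κ} (hA : IsClosed A) :
    IsClosed {x | x ∈ A ∧ ¬ Reg p A s x} := by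
  rw [← isOpen_compl_iff, isOpen_iff_mem_nhds]
  intro x hx
  by_cases hxA : x ∈ A
  · have hR : Reg p A s x := by
      by_contra h; exact hx ⟨hxA, h⟩
    filter_upwards [Reg_open p hR] with z hz hz'
    exact hz'.2 (hz hz'.1)
  · filter_upwards [hA.isOpen_compl.mem_nhds hxA] with z hz hz'
    exact hz hz'.1

variable {X : Type} [DSp X]
lemma DP.ag {s : Finset κ} {f g : X → κ → ℝ} (hf : DF L f) (hg : DF L g) : DP L (fun x => ag s (f x) (g x)) := by
  apply DP.fall
  intro i
  exact DP.imp (DP.constp _) (DP.eq (hf.app i) (hg.app i))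
lemma DP.Inn [OF L] {s : Finset κ} {c y : X → κ → ℝ} {ε : X → ℝ} (hc : DF L c) (hε : DF L ε) (hy : DF L y) :
    DP L (fun x => Inn s (c x) (ε x) (y x)) := by
  apply DP.fall
  intro i
  exact DP.imp (DP.constp _) (DP.lt ((hy.app i).sub (hc.app i)).abs hε)
lemma DP.U1 [OF L] {A : Set (κ → ℝ)} (hA : DP L (· ∈ A)) {s : Finset κ} {c x y : X → κ → ℝ} {ε : X → ℝ}
    (hc : DF L c) (hε : DF L ε) (hx : DF L x) (hy : DF L y) :
    DP L (fun q => U1 A s (c q) (ε q) (x q) (y q)) :=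
  (hA.comp hy).and ((DP.ag hy hx).and (DP.Inn hc hε hy))
lemma DP.exU {Y : Type} [DSp Y] {P : X → Y → Prop} (hP : DP L (fun q : X × Y => P q.1 q.2)) :
    DP L (fun x => ∃! y, P x y) := by
  unfold ExistsUnique
  apply DP.ex
  apply hP.and
  apply DP.all
  apply DP.imp (hP.comp (DF.fst'.fst.pair DF.snd'))
  exact DP.eq DF.snd' DF.fst'.snd
lemma DP.exU1 [OF L] {A : Set (κ → ℝ)} (hA : DP L (· ∈ A)) {s : Finset κ} {c x : X → κ → ℝ} {ε : X → ℝ}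
    (hc : DF L c) (hε : DF L ε) (hx : DF L x) :
    DP L (fun q => ∃! y, DMinPaper.U1 A s (c q) (ε q) (x q) y) := 
  DP.exU (DP.U1 hA (hc.comp DF.fst') (hε.comp DF.fst') (hx.comp DF.fst') DF.snd')
lemma DF.sec [OF L] {A : Set (κ → ℝ)} (hA : DP L (· ∈ A)) {s : Finset κ} {c x : X → κ → ℝ} {ε : X → ℝ}
    (hc : DF L c) (hε : DF L ε) (hx : DF L x) :
    DF L (fun q => sec A s (c q) (ε q) (x q)) := by
  apply DF.of (P := fun q y => (DMinPaper.U1 A s (c q) (ε q) (x q) y ∧ ∃! y, DMinPaper.U1 A s (c q) (ε q) (x q) y) ∨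
    ((¬ ∃! y, DMinPaper.U1 A s (c q) (ε q) (x q) y) ∧ y = 0))
  · have h2 := (DP.exU1 (s := s) hA hc hε hx).comp (DF.fst' (Y := κ → ℝ))
    exact DP.or (DP.and (DP.U1 hA (hc.comp DF.fst') (hε.comp DF.fst') (hx.comp DF.fst') DF.snd') h2)
      (h2.not.and (DP.eq DF.snd' (DF.const 0)))
  · intro q y
    by_cases h : ∃! y, DMinPaper.U1 A s (c q) (ε q) (x q) y
    · simp only [h, not_true, false_and, or_false, and_true]
      exact ⟨fun e => e ▸ sec_spec h, fun e => (sec_eq h e).symm⟩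
    · simp only [h, not_false_iff, true_and, and_false, false_or]
      unfold DMinPaper.sec
      rw [dif_neg h]

lemma DP.Reg [OF L] (p : ℕ) {A : Set (κ → ℝ)} (hA : DP L (· ∈ A)) (s : Finset κ) : DP L (Reg p A s) := by
  apply hA.and
  apply DP.ex
  apply DP.ex
  apply DP.and (DP.lt (DF.const _) DF.snd')
  apply DP.and (DP.Inn DF.fst'.snd DF.snd' DF.fst'.fst)
  apply DP.and
  · apply DP.ev DF.fst'.fst
    exact DP.exU1 hA DF.fst'.fst.snd DF.fst'.snd DF.snd'
  · apply DP.fall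
    intro j
    have := DP.contDiffAt (L := L) (X := (κ → ℝ) × ℝ) (κ := κ) p (f := fun q x' => DMinPaper.sec A s q.1 q.2 x' j)
      ((DF.sec hA DF.fst'.fst DF.fst'.snd DF.snd').app j)
    exact this.comp ((DF.fst'.snd.pair DF.snd').pair DF.fst'.fst)

def iso (A : Set (κ → ℝ)) (s : Finset κ) (y : κ → ℝ) : Prop :=
  ∃ ε : ℝ, 0 < ε ∧ ∀ y' ∈ A, ag s y' y → Inn s y ε y' → y' = y

lemma Z_empty [DM L] (p : ℕ) {A : Set (κ → ℝ)} (hA : DP L (· ∈ A)) (s : Finset κ) :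
    interior {x | ∃ y ∈ A, ag s y x ∧ iso A s y ∧ ¬ Reg p A s y} = ∅ := by
  by_contra hne
  obtain ⟨⟨c, ε⟩, hne2⟩ := baire (sd (L := L) κ) (κ := (κ → ℚ) × ℚ)
    (S := fun k x => (∃! y, U1 A s (fun i => (k.1 i : ℝ)) k.2 x y) ∧ (0 < (k.2 : ℝ)) ∧
      ∃ y, U1 A s (fun i => (k.1 i : ℝ)) k.2 x y ∧ ¬ Reg p A s y) (by
      intro k
      apply DP.and (DP.exU1 hA (DF.const _) (DF.const _) DF.id)
      apply DP.and (DP.constp _)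
      apply DP.ex
      exact DP.and (DP.U1 hA (DF.const _) (DF.const _) DF.fst' DF.snd') ((DP.Reg p hA s).comp DF.snd').not)
    isOpen_interior (nonempty_iff_ne_empty.2 hne) (by
      intro x hx
      obtain ⟨y, hyA, hyx, ⟨ε, hε, hiso⟩, hnR⟩ := interior_subset hx
      have : ∀ i, ∃ q : ℚ, |y i - q| < ε / 4 := by
        intro i
        obtain ⟨q, hq1, hq2⟩ := exists_rat_btwn (show y i - ε / 4 < y i by linarith)
        refine ⟨q, ?_⟩
        rw [abs_lt]; constructor <;> linarith
      choose c hc using this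
      obtain ⟨η, hη1, hη2⟩ := exists_rat_btwn (show ε / 4 < ε / 2 by linarith)
      have hU : U1 A s (fun i => (c i : ℝ)) η x y := ⟨hyA, hyx, fun j _ => (hc j).trans hη1⟩
      refine ⟨(c, η), ⟨y, hU, fun y' hy' => ?_⟩, ?_, y, hU, hnR⟩
      · apply hiso y' hy'.1 (hy'.2.1.trans hyx.symm)
        intro j hj
        have h1 := hy'.2.2 j hj
        have h2 := hc j
        simp only at h1
        rw [abs_lt] at *
        constructor <;> linarith [h1.1, h1.2, h2.1, h2.2]
      · show (0 : ℝ) < η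
        linarith)
  have hd := fun j => (sd (L := L) κ).dense (DP.contDiffAt' p ((DF.sec hA (s := s) (DF.const (fun i => (c i : ℝ))) (DF.const (ε : ℝ)) DF.id).app j))
    (contDiff_dense p ((DF.sec hA (s := s) (DF.const (fun i => (c i : ℝ))) (DF.const (ε : ℝ)) DF.id).app j))
  obtain ⟨x, hx1, hx2⟩ := (dense_iInter_of_isOpen (fun i => isOpen_interior) hd).inter_open_nonempty _
    (isOpen_interior.inter isOpen_interior) hne2
  have hx2' : ∀ j, ContDiffAt ℝ p (fun x' => sec A s (fun i => (c i : ℝ)) ε x' j) x := fun j =>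
    interior_subset (s := {x | ContDiffAt ℝ p (fun x' => sec A s (fun i => (c i : ℝ)) ε x' j) x}) (mem_iInter.1 hx2 j)
  obtain ⟨hu, hpos, y, hyU, hnR⟩ := interior_subset hx1.1
  have hev : ∀ᶠ x' in 𝓝 x, ∃! y, U1 A s (fun i => (c i : ℝ)) ε x' y := by
    filter_upwards [mem_interior_iff_mem_nhds.1 hx1.1] with z hz using hz.1
  apply hnR
  refine ⟨hyU.1, _, ε, hpos, hyU.2.2, cyl (s := s) ?_ hyU.2.1.symm hev, ?_⟩
  · intro x x' hxx' h
    rwa [← U1_ag hxx']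
  · intro j
    have h1 : (fun x' => sec A s (fun i => (c i : ℝ)) ε x' j) =
        (fun x' => sec A s (fun i => (c i : ℝ)) ε x' j) ∘ (Tm s x) := by
      ext z
      simp only [Function.comp, sec_ag (Tm_ag s x z)]
    rw [h1]
    apply ContDiffAt.comp
    · rw [Tm_eq hyU.2.1.symm]; exact hx2' j
    · exact (Tm_cd s x).contDiffAt

lemma CB {X ι : Type} [TopologicalSpace X] [T1Space X] (D : ι → Set X)
    (hD : ∀ i, ∀ x ∈ D i, ∃ U, IsOpen U ∧ x ∈ U ∧ ∀ y ∈ U ∩ D i, y = x) :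
    ∀ (m : ℕ) (s : Finset ι) (hs : s.card = m) (C : ℕ → Set X), (∀ x ∈ C 0, ∃ i ∈ s, x ∈ D i) →
    (∀ j, ∀ x ∈ C (j+1), x ∈ C j ∧ ∀ U, IsOpen U → x ∈ U → ∃ y ∈ U ∩ C j, y ≠ x) → C m = ∅ := by
  intro m
  induction m with
  | zero =>
    intro s hs C h0 hC
    rw [Finset.card_eq_zero] at hs
    subst hs
    rw [← Set.not_nonempty_iff_eq_empty]
    rintro ⟨x, hx⟩
    obtain ⟨i, hi, -⟩ := h0 x hx
    simp at hi
  | succ m ih =>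
    intro s hs C h0 hC
    rw [← Set.not_nonempty_iff_eq_empty]
    rintro ⟨x, hx⟩
    have hx0 : ∀ j, x ∈ C j → x ∈ C 0 := by
      intro j
      induction j with
      | zero => exact fun h => h
      | succ j ihj => exact fun h => ihj (hC j x h).1
    obtain ⟨i, hi, hxi⟩ := h0 x (hx0 _ hx)
    obtain ⟨U, hU, hxU, hUi⟩ := hD i x hxi
    have := ih (s.erase i) (by rw [Finset.card_erase_of_mem hi, hs]; rfl) (fun j => C j ∩ (U ∩ {x}ᶜ)) (by
      rintro y ⟨hy, hyU, hyx⟩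
      obtain ⟨i', hi', hyi'⟩ := h0 y hy
      refine ⟨i', Finset.mem_erase.2 ⟨?_, hi'⟩, hyi'⟩
      rintro rfl
      exact hyx (hUi y ⟨hyU, hyi'⟩)) (by
      rintro j y ⟨hy, hyU⟩
      refine ⟨⟨(hC j y hy).1, hyU⟩, fun V hV hyV => ?_⟩
      obtain ⟨z, hz, hzy⟩ := (hC j y hy).2 (V ∩ (U ∩ {x}ᶜ)) (hV.inter (hU.inter isOpen_compl_singleton)) ⟨hyV, hyU⟩
      exact ⟨z, ⟨hz.1.1, hz.2, hz.1.2⟩, hzy⟩)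
    obtain ⟨y, hy, hyx⟩ := (hC m x hx).2 U hU hxU
    have h2 : y ∈ C m ∩ (U ∩ {x}ᶜ) := ⟨hy.2, hy.1, hyx⟩
    rw [this] at h2
    exact h2

def HasInt (s : Finset κ) (A : Set (κ → ℝ)) : Prop := (interior {x | ∃ y ∈ A, ag s y x}).Nonempty

lemma HasInt.mono {s : Finset κ} {A B : Set (κ → ℝ)} (h : A ⊆ B) (hA : HasInt s A) : HasInt s B := by
  refine Set.Nonempty.mono (interior_mono ?_) hA
  rintro x ⟨y, hy, h'⟩
  exact ⟨y, h hy, h'⟩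

def Ait (p : ℕ) (s : Finset κ) (A : Set (κ → ℝ)) : ℕ → Set (κ → ℝ)
  | 0 => A
  | n + 1 => {x | x ∈ Ait p s A n ∧ ¬ Reg p (Ait p s A n) s x}

lemma Ait_def [OF L] (p : ℕ) (s : Finset κ) {A : Set (κ → ℝ)} (hA : DP L (· ∈ A)) (n : ℕ) :
    DP L (· ∈ Ait p s A n) := by
  induction n with
  | zero => exact hA
  | succ n ih => exact ih.and (DP.Reg p ih s).not

lemma Ait_closed (p : ℕ) (s : Finset κ) {A : Set (κ → ℝ)} (hA : IsClosed A) (n : ℕ) : IsClosed (Ait p s A n) := by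
  induction n with
  | zero => exact hA
  | succ n ih => exact Reg_closed p ih

lemma Ait_sub (p : ℕ) (s : Finset κ) (A : Set (κ → ℝ)) (n : ℕ) : Ait p s A n ⊆ A := by
  induction n with
  | zero => exact subset_rfl
  | succ n ih => exact fun x hx => ih hx.1

lemma V_empty [DM L] {A : Set (κ → ℝ)} (hA : DP L (· ∈ A)) {s : Finset κ}
    (hmax : ∀ j, j ∉ s → ¬ HasInt (insert j s) A) (j : κ) :
    interior {x | ∃ c d : ℝ, c < d ∧ ∀ t, c < t → t < d → ∃ y ∈ A, ag s y x ∧ y j = t} = ∅ := by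
  by_contra hne
  obtain ⟨⟨c, d⟩, x, hx, -⟩ := baire (sd (L := L) κ) (κ := ℚ × ℚ)
    (S := fun k x => (k.1 : ℝ) < k.2 ∧ ∀ t, (k.1 : ℝ) < t → t < k.2 → ∃ y ∈ A, ag s y x ∧ y j = t) (by
      intro k
      apply DP.and (DP.constp _)
      apply DP.all
      apply DP.imp (DP.lt (DF.const _) DF.snd')
      apply DP.imp (DP.lt DF.snd' (DF.const _))
      apply DP.ex
      exact (hA.comp DF.snd').and ((DP.ag DF.snd' DF.fst'.fst).and (DP.eq (DF.snd'.app j) DF.fst'.snd)))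
    isOpen_interior (nonempty_iff_ne_empty.2 hne) (by
      intro x hx
      obtain ⟨c, d, hcd, h⟩ := interior_subset hx
      obtain ⟨c', hc1, hc2⟩ := exists_rat_btwn hcd
      obtain ⟨d', hd1, hd2⟩ := exists_rat_btwn hc2
      exact ⟨(c', d'), hd1, fun t ht1 ht2 => h t (hc1.trans ht1) (ht2.trans hd2)⟩)
  have hcd := (interior_subset hx).1
  simp only at hcd
  by_cases hj : j ∈ s
  · have h := (interior_subset hx).2
    obtain ⟨y, -, hy1, hy2⟩ := h (c + (d - c) / 3) (by simp only; linarith) (by simp only; linarith)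
    obtain ⟨y', -, hy1', hy2'⟩ := h (c + (d - c) / 2) (by simp only; linarith) (by simp only; linarith)
    have := hy1 j hj
    have := hy1' j hj
    linarith
  · apply hmax j hj
    let x1 := Function.update x j ((c + d) / 2 : ℝ)
    have hag : ag s x x1 := by
      intro i hi
      have : i ≠ j := by rintro rfl; exact hj hi
      simp [x1, this]
    have h1 := cyl (s := s) (P := fun x => (c : ℝ) < d ∧ ∀ t, (c : ℝ) < t → t < d → ∃ y ∈ A, ag s y x ∧ y j = t)
      (by
        rintro x x' hxx ⟨h1, h2⟩
        refine ⟨h1, fun t ht1 ht2 => ?_⟩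
        obtain ⟨y, h3, h4, h5⟩ := h2 t ht1 ht2
        exact ⟨y, h3, h4.trans hxx, h5⟩) hag (mem_interior_iff_mem_nhds.1 hx)
    refine ⟨x1, mem_interior_iff_mem_nhds.2 ?_⟩
    have hcj : Continuous (fun x : κ → ℝ => x j) := continuous_apply j
    have h2 : ∀ᶠ x' in 𝓝 x1, x' j ∈ Ioo (c : ℝ) d := by
      apply hcj.continuousAt.eventually
      apply isOpen_Ioo.mem_nhds
      simp only [x1, Function.update_self]
      constructor <;> linarith
    filter_upwards [h1, h2] with z hz1 hz2
    obtain ⟨y, h3, h4, h5⟩ := hz1.2 (z j) hz2.1 hz2.2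
    refine ⟨y, h3, fun i hi => ?_⟩
    rcases Finset.mem_insert.1 hi with rfl | hi
    · exact h5
    · exact h4 i hi

lemma drop [DM L] (p : ℕ) {A : Set (κ → ℝ)} (hA : DP L (· ∈ A)) {s : Finset κ}
    (hmax : ∀ j, j ∉ s → ¬ HasInt (insert j s) A) : ∃ K, ¬ HasInt s (Ait p s A K) := by
  have hdm : ∀ j : κ, ∃ N : ℕ, ∀ x : κ → ℝ, ∃ (U : Set ℝ) (D : Fin N → Set ℝ),
        IsOpen U ∧ (∀ i, IsDiscreteSet (D i)) ∧ {t : ℝ | ∃ y ∈ A, ag s y x ∧ y j = t} = U ∪ ⋃ i, D i := by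
    intro j
    apply dmin_family (L := L)
    apply DP.ex
    exact (hA.comp DF.snd').and ((DP.ag DF.snd' DF.fst'.fst).and (DP.eq (DF.snd'.app j) DF.fst'.snd))
  choose N hN using hdm
  refine ⟨Fintype.card (∀ j, Fin (N j)), fun hint => ?_⟩
  obtain ⟨k, hk⟩ := baire (sd (L := L) κ) (κ := ℕ ⊕ κ)
    (S := fun k x => Sum.elim (fun n => ∃ y ∈ Ait p s A n, ag s y x ∧ iso (Ait p s A n) s y ∧ ¬ Reg p (Ait p s A n) s y)
      (fun j => ∃ c d : ℝ, c < d ∧ ∀ t, c < t → t < d → ∃ y ∈ A, ag s y x ∧ y j = t) k) (by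
      rintro (n | j)
      · have hn := Ait_def p s hA n
        apply DP.ex
        apply (hn.comp DF.snd').and
        apply DP.and (DP.ag DF.snd' DF.fst')
        apply DP.and _ (((DP.Reg p hn s).comp DF.snd').not)
        apply DP.ex
        apply DP.and (DP.lt (DF.const _) DF.snd')
        apply DP.all
        apply DP.imp (hn.comp DF.snd')
        apply DP.imp (DP.ag DF.snd' DF.fst'.fst.snd)
        apply DP.imp (DP.Inn DF.fst'.fst.snd DF.fst'.snd DF.snd')
        exact DP.eq DF.snd' DF.fst'.fst.snd
      · apply DP.ex
        apply DP.ex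
        apply DP.and (DP.lt DF.fst'.snd DF.snd')
        apply DP.all
        apply DP.imp (DP.lt DF.fst'.fst.snd DF.snd')
        apply DP.imp (DP.lt DF.snd' DF.fst'.snd)
        apply DP.ex
        exact (hA.comp DF.snd').and ((DP.ag DF.snd' DF.fst'.fst.fst.fst).and (DP.eq (DF.snd'.app j) DF.fst'.snd)))
    isOpen_interior hint (by
      intro x hx
      obtain ⟨y0, hy0, hy0x⟩ := interior_subset hx
      by_contra hgen
      push Not at hgen
      choose U D hU hD hUD using fun j => hN j x
      have hUe : ∀ j, U j = ∅ := by
        intro j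
        by_contra hne
        obtain ⟨t, ht⟩ := nonempty_iff_ne_empty.2 hne
        obtain ⟨ε, hε, hb⟩ := Metric.isOpen_iff.1 (hU j) t ht
        rw [Real.ball_eq_Ioo] at hb
        apply hgen (Sum.inr j)
        refine ⟨t - ε, t + ε, by linarith, fun u hu1 hu2 => ?_⟩
        have : u ∈ U j ∪ ⋃ i, D j i := Or.inl (hb ⟨hu1, hu2⟩)
        rw [← hUD j] at this
        exact this
      have := CB (X := κ → ℝ) (ι := ∀ j, Fin (N j)) (fun φ => {y | ∀ j, y j ∈ D j (φ j)}) (by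
        intro φ y hy
        choose V hV hVD using fun j => hD j (φ j) (y j) (hy j)
        refine ⟨Set.univ.pi V, isOpen_set_pi finite_univ (fun j _ => hV j), ?_, ?_⟩
        · intro j _
          have : y j ∈ V j ∩ D j (φ j) := by rw [hVD j]; rfl
          exact this.1
        · rintro y' ⟨h1, h2⟩
          ext j
          have : y' j ∈ V j ∩ D j (φ j) := ⟨h1 j trivial, h2 j⟩
          rw [hVD j] at this
          exact this) _ Finset.univ (by rw [Finset.card_univ]) (fun n => {y | y ∈ Ait p s A n ∧ ag s y x}) (by
        rintro y ⟨hyA, hyx⟩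
        have : ∀ j, ∃ i, y j ∈ D j i := by
          intro j
          have h1 : y j ∈ U j ∪ ⋃ i, D j i := by
            rw [← hUD j]; exact ⟨y, hyA, hyx, rfl⟩
          rw [hUe j, empty_union] at h1
          exact mem_iUnion.1 h1
        choose φ hφ using this
        exact ⟨φ, Finset.mem_univ _, hφ⟩) (by
        rintro n y ⟨hy, hyx⟩
        refine ⟨⟨hy.1, hyx⟩, fun V hV hyV => ?_⟩
        have hni : ¬ iso (Ait p s A n) s y := fun h => hgen (Sum.inl n) ⟨y, hy.1, hyx, h, hy.2⟩
        obtain ⟨ε, hε, hb⟩ := Metric.isOpen_iff.1 hV y hyV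
        by_contra hcon
        push Not at hcon
        refine hni ⟨ε, hε, fun y' h1 h2 h3 => hcon y' ⟨hb ?_, h1, h2.trans hyx⟩⟩
        rw [Metric.mem_ball, dist_pi_lt_iff hε]
        intro i
        by_cases hi : i ∈ s
        · rw [h2 i hi]; simpa using hε
        · exact h3 i hi)
      have h2 : y0 ∈ ({y | y ∈ Ait p s A (Fintype.card (∀ j, Fin (N j))) ∧ ag s y x} : Set _) := ⟨hy0, hy0x⟩
      rw [this] at h2
      exact h2)
  obtain ⟨x, hx, -⟩ := hk
  rcases k with n | j
  · have := Z_empty p (Ait_def p s hA n) s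
    simp only [Sum.elim_inl] at hx
    rw [this] at hx; exact hx
  · have := V_empty hA hmax j
    simp only [Sum.elim_inr] at hx
    rw [this] at hx; exact hx

lemma main_ind [DM L] (p : ℕ) (H : Set (κ → ℝ) → Prop) (h0 : H ∅)
    (hstep : ∀ (A : Set (κ → ℝ)) (s : Finset κ), DP L (· ∈ A) → IsClosed A →
      H {x | x ∈ A ∧ ¬ Reg p A s x} → H A) :
    ∀ (m : ℕ) (A : Set (κ → ℝ)), DP L (· ∈ A) → IsClosed A →
      (Finset.univ.filter (fun s => HasInt s A)).card = m → H A := by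
  intro m
  induction m using Nat.strong_induction_on with
  | _ m ih =>
  intro A hA hAc hm
  by_cases he : (Finset.univ.filter (fun s => HasInt s A)).Nonempty
  · obtain ⟨s, hs⟩ := Finset.exists_maximal he
    have hsA : HasInt s A := (Finset.mem_filter.1 hs.1).2
    have hmax : ∀ j, j ∉ s → ¬ HasInt (insert j s) A := by
      intro j hj hI
      have := hs.2 (Finset.mem_filter.2 ⟨Finset.mem_univ _, hI⟩) (Finset.subset_insert j s)
      exact hj (this (Finset.mem_insert_self j s))
    obtain ⟨K, hK⟩ := drop p hA hmax
    have hAK : H (Ait p s A K) := by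
      refine ih _ ?_ _ (Ait_def p s hA K) (Ait_closed p s hAc K) rfl
      rw [← hm]
      apply Finset.card_lt_card
      refine ⟨?_, ?_⟩
      · intro t ht
        rw [Finset.mem_filter] at ht ⊢
        exact ⟨ht.1, ht.2.mono (Ait_sub p s A K)⟩
      · intro h
        exact hK (Finset.mem_filter.1 (h hs.1)).2
    have hdown : ∀ n, H (Ait p s A n) → H A := by
      intro n
      induction n with
      | zero => exact fun h => h
      | succ n ihn => exact fun h => ihn (hstep _ s (Ait_def p s hA n) (Ait_closed p s hAc n) h)
    exact hdown K hAK
  · have : A = ∅ := by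
      by_contra hne
      obtain ⟨y, hy⟩ := nonempty_iff_ne_empty.2 hne
      apply he
      refine ⟨∅, Finset.mem_filter.2 ⟨Finset.mem_univ _, ?_⟩⟩
      have : {x | ∃ y ∈ A, ag ∅ y x} = univ := eq_univ_of_forall fun x => ⟨y, hy, by intro i hi; simp at hi⟩
      unfold HasInt
      rw [this, interior_univ]
      exact ⟨y, trivial⟩
    rw [this]; exact h0

end regular
section oned
variable {L}
variable {X : Type} [DSp X]

lemma DF.sup [OF L] {P : X → ℝ → Prop} (hP : DP L (fun q : X × ℝ => P q.1 q.2)) :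
    DF L (fun x => sSup {t | P x t}) := by
  have hb : DP L (fun q : X × ℝ => ∀ t, P q.1 t → t ≤ q.2) := by
    apply DP.all
    apply DP.imp (hP.comp (DF.fst'.fst.pair DF.snd'))
    exact DP.le DF.snd' DF.fst'.snd
  have hnb : DP L (fun x => (∃ t, P x t) ∧ ∃ u, ∀ t, P x t → t ≤ u) := DP.and (DP.ex hP) (DP.ex hb)
  apply DF.of (P := fun x y => (((∃ t, P x t) ∧ ∃ u, ∀ t, P x t → t ≤ u) ∧ ((∀ t, P x t → t ≤ y) ∧
      ∀ u, (∀ t, P x t → t ≤ u) → y ≤ u)) ∨ ((¬ ((∃ t, P x t) ∧ ∃ u, ∀ t, P x t → t ≤ u)) ∧ y = 0))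
  · apply DP.or
    · apply DP.and (hnb.comp DF.fst')
      apply DP.and hb
      apply DP.all
      exact DP.imp (hb.comp (DF.fst'.fst.pair DF.snd')) (DP.le DF.fst'.snd DF.snd')
    · exact (hnb.comp DF.fst').not.and (DP.eq DF.snd' (DF.const 0))
  · intro x y
    by_cases h : (∃ t, P x t) ∧ ∃ u, ∀ t, P x t → t ≤ u
    · have hl := isLUB_csSup (s := {t | P x t}) h.1 h.2
      constructor
      · rintro rfl
        exact Or.inl ⟨h, fun t ht => hl.1 ht, fun u hu => hl.2 hu⟩
      · rintro (h' | h')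
        · exact IsLUB.unique (s := {t | P x t}) ⟨fun t ht => h'.2.1 t ht, fun u hu => h'.2.2 u hu⟩ hl
        · exact (h'.1 h).elim
    · have : sSup {t | P x t} = 0 := by
        by_cases h1 : ∃ t, P x t
        · apply Real.sSup_of_not_bddAbove
          intro ⟨u, hu⟩
          exact h ⟨h1, u, fun t ht => hu ht⟩
        · have : {t | P x t} = ∅ := by
            rw [← Set.not_nonempty_iff_eq_empty]; exact h1
          rw [this, Real.sSup_empty]
      rw [this]
      constructor
      · intro e; exact Or.inr ⟨h, e⟩
      · rintro (h' | h')
        · exact (h h'.1).elim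
        · exact h'.2

lemma DF.inf [OF L] {P : X → ℝ → Prop} (hP : DP L (fun q : X × ℝ => P q.1 q.2)) :
    DF L (fun x => sInf {t | P x t}) := by
  have h := (DF.sup (P := fun x t => P x (-t)) (hP.comp (DF.fst'.pair DF.snd'.neg))).neg
  have : (fun x => sInf {t | P x t}) = fun x => - sSup {t | P x (-t)} := by
    ext x; rw [Real.sInf_def]; rfl
  rw [this]; exact h

structure LF (S : Set ℝ) (s0 : ℝ) : Prop where
  sub : S ⊆ Ioc 0 s0
  mem : s0 ∈ S
  le1 : s0 ≤ 1
  fin : ∀ ε > 0, (S ∩ Ici ε).Finite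
  acc : ∀ ε > 0, ∃ s ∈ S, s < ε

def gA (S : Set ℝ) (t : ℝ) : ℝ := sSup {s | s ∈ S ∧ s ≤ t}
def gB (S : Set ℝ) (t : ℝ) : ℝ := sInf {s | s ∈ S ∧ t ≤ s}

lemma LF.grA {S : Set ℝ} {s0 : ℝ} (h : LF S s0) {t : ℝ} (ht : 0 < t) : IsGreatest {s | s ∈ S ∧ s ≤ t} (gA S t) := by
  obtain ⟨s, hs, hst⟩ := h.acc t ht
  have hf : ((S ∩ Ici s) ∩ Iic t).Finite := (h.fin s (h.sub hs).1).subset inter_subset_left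
  obtain ⟨a, ha, hmax⟩ := hf.exists_maximalFor id _ ⟨s, ⟨hs, self_mem_Ici⟩, hst.le⟩
  have : IsGreatest {s | s ∈ S ∧ s ≤ t} a := by
    refine ⟨⟨ha.1.1, ha.2⟩, fun u hu => ?_⟩
    by_cases hus : s ≤ u
    · by_contra hau
      push Not at hau
      exact absurd (hmax ⟨⟨hu.1, hus⟩, hu.2⟩ hau.le) (not_le.2 hau)
    · push Not at hus
      exact hus.le.trans ha.1.2
  have e : gA S t = a := this.csSup_eq
  rwa [e]

lemma LF.leB {S : Set ℝ} {s0 : ℝ} (h : LF S s0) {t : ℝ} (ht : 0 < t) (ht' : t ≤ s0) :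
    IsLeast {s | s ∈ S ∧ t ≤ s} (gB S t) := by
  have hf : (S ∩ Ici t).Finite := h.fin t ht
  obtain ⟨a, ha, hmax⟩ := hf.exists_minimalFor id _ ⟨s0, h.mem, ht'⟩
  have : IsLeast {s | s ∈ S ∧ t ≤ s} a := by
    refine ⟨⟨ha.1, ha.2⟩, fun u hu => ?_⟩
    by_contra hau
    push Not at hau
    exact absurd (hmax ⟨hu.1, hu.2⟩ hau.le) (not_le.2 hau)
  have e : gB S t = a := this.csInf_eq
  rwa [e]

def gw (S : Set ℝ) (t : ℝ) : ℝ := (t - gA S t) * (gB S t - t)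
def gv (S : Set ℝ) (t : ℝ) : ℝ := gA S t + gB S t - 2 * t
def gu (S : Set ℝ) (s0 : ℝ) (m : ℝ → ℝ) (e j : ℕ) (t : ℝ) : ℝ :=
  if 0 < t ∧ t < s0 then m (gA S t) * (gw S t ^ e * gv S t ^ j) else 0

lemma LF.basic {S : Set ℝ} {s0 : ℝ} (h : LF S s0) {t : ℝ} (ht : 0 < t) (ht' : t < s0) :
    0 ≤ gw S t ∧ gw S t ≤ 1 ∧ |gv S t| ≤ 1 ∧ (∀ x ∈ insert 0 S, gw S t ≤ |t - x|) := by
  have hA := h.grA ht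
  have hB := h.leB ht ht'.le
  have hA0 := (h.sub hA.1.1).1
  have hA1 := hA.1.2
  have hB1 := hB.1.2
  have hB2 := (h.sub hB.1.1).2
  have hl := h.le1
  unfold gw gv
  refine ⟨by nlinarith, by nlinarith, by rw [abs_le]; constructor <;> linarith, ?_⟩
  have key : ∀ u v d : ℝ, 0 ≤ u → 0 ≤ v → v ≤ 1 → u ≤ d → u * v ≤ d := by
    intro u v d h1 h2 h3 h4; nlinarith
  rintro x (rfl | hx)
  · rw [sub_zero, abs_of_pos ht]
    apply key <;> linarith
  · rcases le_total x t with hxt | hxt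
    · have := hA.2 ⟨hx, hxt⟩
      rw [abs_of_nonneg (by linarith)]
      apply key <;> linarith
    · have := hB.2 ⟨hx, hxt⟩
      rw [abs_of_nonpos (by linarith), mul_comm]
      apply key <;> linarith

lemma LF.bound {S : Set ℝ} {s0 : ℝ} (h : LF S s0) {m : ℝ → ℝ} (hm : ∀ t, 0 < t → 0 < m t ∧ m t ≤ 1) (e j : ℕ) {x : ℝ}
    (hx : x ∈ insert 0 S) (t : ℝ) : |gu S s0 m e j t| ≤ |t - x| ^ e := by
  unfold gu
  split_ifs with ht
  · obtain ⟨h1, h2, h3, h4⟩ := h.basic ht.1 ht.2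
    have h5 := h4 x hx
    have h6 := hm _ (h.sub (h.grA ht.1).1.1).1
    rw [abs_mul, abs_mul, abs_pow, abs_pow, abs_of_pos h6.1, abs_of_nonneg h1]
    have h7 : gw S t ^ e ≤ |t - x| ^ e := pow_le_pow_left₀ h1 h5 e
    have h8 : |gv S t| ^ j ≤ 1 := pow_le_one₀ (abs_nonneg _) h3
    have h9 : gw S t ^ e * |gv S t| ^ j ≤ |t - x| ^ e * 1 := by gcongr
    have h10 : 0 ≤ gw S t ^ e * |gv S t| ^ j := by positivity
    nlinarith [h6.2]
  · simp

lemma LF.zero {S : Set ℝ} {s0 : ℝ} (h : LF S s0) {m : ℝ → ℝ} (hm : ∀ t, 0 < t → 0 < m t ∧ m t ≤ 1) (e j : ℕ) {x : ℝ}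
    (hx : x ∈ insert 0 S) (he : 1 ≤ e) : gu S s0 m e j x = 0 := by
  have := h.bound hm e j hx x
  rw [sub_self, abs_zero, zero_pow (by omega)] at this
  simpa using this

lemma LF.hasDeriv0 {S : Set ℝ} {s0 : ℝ} (h : LF S s0) {m : ℝ → ℝ} (hm : ∀ t, 0 < t → 0 < m t ∧ m t ≤ 1) (e j : ℕ)
     {t : ℝ} (ht : t < s0) (hx : t ∉ insert 0 S) :
    HasDerivAt (gu S s0 m e j) (e * gu S s0 m (e-1) (j+1) t - 2 * j * gu S s0 m e (j-1) t) t := by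
  rcases lt_trichotomy t 0 with ht0 | ht0 | ht0
  · have h1 : ∀ e j, ∀ z < 0, gu S s0 m e j z = 0 := by
      intro e j z hz
      unfold gu
      rw [if_neg (by intro h; linarith [h.1])]
    rw [h1 _ _ t ht0, h1 _ _ t ht0]
    simp only [mul_zero, sub_zero]
    apply (hasDerivAt_const t (0 : ℝ)).congr_of_eventuallyEq
    filter_upwards [eventually_lt_nhds ht0] with z hz using h1 _ _ z hz
  · exact (hx (Or.inl ht0)).elim
  · have hA := h.grA ht0
    have hB := h.leB ht0 ht.le
    have hS : t ∉ S := fun h => hx (Or.inr h)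
    have hA1 : gA S t < t := lt_of_le_of_ne hA.1.2 (fun e => hS (e ▸ hA.1.1))
    have hB1 : t < gB S t := lt_of_le_of_ne hB.1.2 (fun e => hS (e.symm ▸ hB.1.1))
    set a := gA S t with ha
    set b := gB S t with hb
    have ha0 := (h.sub hA.1.1).1
    have hb0 := (h.sub hB.1.1).2
    have hloc : ∀ z ∈ Ioo a b, gA S z = a ∧ gB S z = b := by
      intro z hz
      have hz0 : 0 < z := ha0.trans hz.1
      have hz1 : z ≤ s0 := hz.2.le.trans hb0
      have hdi : ∀ s ∈ S, s ≤ a ∨ b ≤ s := by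
        intro s hs
        rcases le_total s t with h | h
        · exact Or.inl (hA.2 ⟨hs, h⟩)
        · exact Or.inr (hB.2 ⟨hs, h⟩)
      constructor
      · refine (h.grA hz0).unique ⟨⟨hA.1.1, hz.1.le⟩, fun s hs => ?_⟩
        rcases hdi s hs.1 with h | h
        · exact h
        · linarith [hs.2, hz.2]
      · refine (h.leB hz0 hz1).unique ⟨⟨hB.1.1, hz.2.le⟩, fun s hs => ?_⟩
        rcases hdi s hs.1 with h | h
        · linarith [hs.2, hz.1]
        · exact h
    have hform : ∀ e j, ∀ z ∈ Ioo a b, gu S s0 m e j z = m a * (((z - a) * (b - z)) ^ e * (a + b - 2 * z) ^ j) := by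
      intro e j z hz
      unfold gu gw gv
      rw [if_pos ⟨ha0.trans hz.1, hz.2.trans_le hb0⟩, (hloc z hz).1, (hloc z hz).2]
    rw [hform _ _ t ⟨hA1, hB1⟩, hform _ _ t ⟨hA1, hB1⟩]
    have hd1 : HasDerivAt (fun z => (z - a) * (b - z)) (a + b - 2 * t) t := by
      have := ((hasDerivAt_id t).sub_const a).mul ((hasDerivAt_id t).const_sub b)
      exact this.congr_deriv (by simp only [id]; ring)
    have hd2 : HasDerivAt (fun z => a + b - 2 * z) (-2) t := by
      have := ((hasDerivAt_id t).const_mul 2).const_sub (a + b)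
      exact this.congr_deriv (by simp)
    have hd := ((hd1.pow e).mul (hd2.pow j)).const_mul (m a)
    refine (hd.congr_of_eventuallyEq ?_).congr_deriv ?_
    · filter_upwards [isOpen_Ioo.mem_nhds (show t ∈ Ioo a b from ⟨hA1, hB1⟩)] with z hz
      rw [hform e j z hz]; rfl
    · simp only [Pi.pow_apply]
      ring

lemma LF.hasDeriv {S : Set ℝ} {s0 : ℝ} (h : LF S s0) {m : ℝ → ℝ} (hm : ∀ t, 0 < t → 0 < m t ∧ m t ≤ 1) (e j : ℕ)
    (he : 2 ≤ e) {t : ℝ} (ht : t < s0) :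
    HasDerivAt (gu S s0 m e j) (e * gu S s0 m (e-1) (j+1) t - 2 * j * gu S s0 m e (j-1) t) t := by
  by_cases hx : t ∈ insert 0 S
  · rw [h.zero hm _ _ hx (by omega), h.zero hm _ _ hx (by omega)]
    have : HasFDerivAt (gu S s0 m e j) (0 : ℝ →L[ℝ] ℝ) t := by
      apply Asymptotics.IsBigO.hasFDerivAt (n := e) _ (by omega)
      apply Asymptotics.IsBigO.of_bound 1
      filter_upwards with z
      have := h.bound hm e j hx z
      simpa using this
    have h2 := this.hasDerivAt
    simpa using h2
  · exact h.hasDeriv0 hm e j ht hx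

lemma LF.contDiff {S : Set ℝ} {s0 : ℝ} (h : LF S s0) {m : ℝ → ℝ} (hm : ∀ t, 0 < t → 0 < m t ∧ m t ≤ 1) (k : ℕ) :
    ∀ (e j : ℕ), k + 1 ≤ e → ContDiffOn ℝ k (gu S s0 m e j) (Iio s0) := by
  induction k with
  | zero =>
    intro e j he
    simp only [Nat.cast_zero]
    rw [contDiffOn_zero]
    -- continuity
    intro t ht
    apply ContinuousAt.continuousWithinAt
    by_cases hx : t ∈ insert 0 S
    · rw [Metric.continuousAt_iff']
      intro ε hε
      have hc : ContinuousAt (fun z : ℝ => |z - t| ^ e) t := by fun_prop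
      have := hc.eventually (eventually_lt_nhds (b := ε) (by simp only [sub_self, abs_zero]; rw [zero_pow (by omega)]; exact hε))
      filter_upwards [this] with z hz
      rw [h.zero hm _ _ hx (by omega), Real.dist_eq, sub_zero]
      exact (h.bound hm e j hx z).trans_lt hz
    · exact (h.hasDeriv0 hm e j ht hx).continuousAt
  | succ k ih =>
    intro e j he
    rw [show ((k + 1 : ℕ) : WithTop ℕ∞) = (k : WithTop ℕ∞) + 1 by push_cast; rfl]
    rw [contDiffOn_succ_iff_deriv_of_isOpen isOpen_Iio]
    refine ⟨fun t ht => (h.hasDeriv hm e j (by omega) ht).differentiableAt.differentiableWithinAt, by simp, ?_⟩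
    have : ContDiffOn ℝ k (fun t => e * gu S s0 m (e-1) (j+1) t - 2 * j * gu S s0 m e (j-1) t) (Iio s0) :=
      ((contDiffOn_const).mul (ih _ _ (by omega))).sub (contDiffOn_const.mul (ih _ _ (by omega)))
    refine this.congr fun t ht => (h.hasDeriv hm e j (by omega) ht).deriv

end oned

section oned2
variable {L}

lemma DF.gu [OF L] {S : Set ℝ} (hS : DP L (· ∈ S)) (s0 : ℝ) {m : ℝ → ℝ} (hm : DF L m) (e j : ℕ) :
    DF L (gu S s0 m e j) := by
  have hA : DF L (gA S) := DF.sup (P := fun t s => s ∈ S ∧ s ≤ t)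
    ((hS.comp DF.snd').and (DP.le DF.snd' DF.fst'))
  have hB : DF L (gB S) := DF.inf (P := fun t s => s ∈ S ∧ t ≤ s)
    ((hS.comp DF.snd').and (DP.le DF.fst' DF.snd'))
  have hw : DF L (gw S) := (DF.id.sub hA).mul (hB.sub DF.id)
  have hv : DF L (gv S) := (hA.add hB).sub ((DF.const 2).mul DF.id)
  have := DF.ite ((DP.lt (DF.const 0) DF.id).and (DP.lt DF.id (DF.const s0)))
    ((hm.comp hA).mul ((hw.pow e).mul (hv.pow j))) (DF.const 0)
  convert this using 2 with x
  unfold DMinPaper.gu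
  congr

lemma LF.range {S : Set ℝ} {s0 : ℝ} (h : LF S s0) {m : ℝ → ℝ} (hm : ∀ t, 0 < t → 0 < m t ∧ m t ≤ 1)
    (hmono : ∀ s t, 0 < s → s ≤ t → m s ≤ m t) (e : ℕ) {t : ℝ} (h0 : 0 < t) (h1 : t < s0) :
    0 ≤ gu S s0 m e 0 t ∧ gu S s0 m e 0 t ≤ m t ∧ (t ∉ S → 0 < gu S s0 m e 0 t) := by
  have hA := h.grA h0
  have hB := h.leB h0 h1.le
  have hA0 := (h.sub hA.1.1).1
  have h2 := hm _ hA0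
  have h3 := hmono _ _ hA0 hA.1.2
  obtain ⟨h4, h5, -, -⟩ := h.basic h0 h1
  have h6 : gw S t ^ e ≤ 1 := pow_le_one₀ h4 h5
  have h7 : 0 ≤ gw S t ^ e := by positivity
  unfold gu
  rw [if_pos ⟨h0, h1⟩]
  simp only [pow_zero, mul_one]
  refine ⟨mul_nonneg h2.1.le h7, by nlinarith, fun hS => ?_⟩
  have hA1 : gA S t < t := lt_of_le_of_ne hA.1.2 (fun e => hS (e ▸ hA.1.1))
  have hB1 : t < gB S t := lt_of_le_of_ne hB.1.2 (fun e => hS (e.symm ▸ hB.1.1))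
  have : 0 < gw S t := mul_pos (by linarith) (by linarith)
  have := h2.1
  positivity

lemma LF.countable {S : Set ℝ} {s0 : ℝ} (h : LF S s0) : S.Countable := by
  have : S ⊆ ⋃ n : ℕ, S ∩ Ici (1 / ((n : ℝ) + 1)) := by
    intro s hs
    obtain ⟨n, hn⟩ := exists_nat_one_div_lt (h.sub hs).1
    exact mem_iUnion.2 ⟨n, hs, hn.le⟩
  refine Set.Countable.mono this (countable_iUnion fun n => (h.fin _ (by positivity)).countable)

lemma LF.scale {S : Set ℝ} {s0 : ℝ} (h : LF S s0) {c : ℝ} (hc : 0 < c) (hc1 : c ≤ 1) :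
    LF {t | t / c ∈ S} (c * s0) := by
  have h0 : 0 < s0 := (h.sub h.mem).1
  have hl := h.le1
  refine ⟨?_, ?_, by nlinarith, ?_, ?_⟩
  · intro t ht
    have := h.sub ht
    rw [mem_Ioc, lt_div_iff₀ hc, div_le_iff₀ hc] at this
    exact ⟨by linarith [this.1], by linarith [this.2]⟩
  · show c * s0 / c ∈ S
    rw [mul_div_cancel_left₀ _ hc.ne']; exact h.mem
  · intro ε hε
    refine ((h.fin (ε / c) (by positivity)).image (fun t => c * t)).subset ?_
    rintro t ⟨h1, h2⟩
    refine ⟨t / c, ⟨h1, ?_⟩, ?_⟩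
    · exact div_le_div_of_nonneg_right h2 hc.le
    · simp only; field_simp
  · intro ε hε
    obtain ⟨s, hs, hlt⟩ := h.acc (ε / c) (by positivity)
    refine ⟨c * s, ?_, ?_⟩
    · show c * s / c ∈ S
      rw [mul_div_cancel_left₀ _ hc.ne']; exact hs
    · rw [lt_div_iff₀ hc] at hlt; linarith

lemma theta1 [OF L] (p : ℕ) {S : Set ℝ} {s0 : ℝ} (h : LF S s0) (hS : DP L (· ∈ S)) {m : ℝ → ℝ} (hmd : DF L m)
    (hm : ∀ t, 0 < t → 0 < m t ∧ m t ≤ 1)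
    (hmono : ∀ s t, 0 < s → s ≤ t → m s ≤ m t) :
    ∃ t0 > 0, ∃ θ : ℝ → ℝ, DF L θ ∧ ContDiffOn ℝ p θ (Iio t0) ∧ (∀ t ≤ 0, θ t = 0) ∧
      ∀ t ∈ Ioo 0 t0, 0 < θ t ∧ θ t ≤ m t := by
  have hcnt : (image2 (fun s s' : ℝ => s / s') S S).Countable := h.countable.image2 h.countable _
  obtain ⟨c, hc, hc1⟩ := (hcnt.dense_compl ℝ).exists_between (show (1/2 : ℝ) < 1 by norm_num)
  have hc0 : 0 < c := by linarith [hc1.1]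
  have h0 : 0 < s0 := (h.sub h.mem).1
  have h' := h.scale hc0 hc1.2.le
  have hle : c * s0 ≤ s0 := by nlinarith [hc1.2]
  have hS' : DP L (· ∈ {t | t / c ∈ S}) := hS.comp (f := fun t => t / c) (DF.id.div (DF.const c))
  refine ⟨c * s0, by positivity, fun t => 1/2 * (gu S s0 m (p+1) 0 t + gu {t | t / c ∈ S} (c * s0) m (p+1) 0 t),
    ?_, ?_, ?_, ?_⟩
  · exact (DF.const _).mul ((DF.gu hS _ hmd _ _).add (DF.gu hS' _ hmd _ _))
  · exact contDiffOn_const.mul (((h.contDiff hm p _ _ le_rfl).mono (Iio_subset_Iio hle)).add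
      (h'.contDiff hm p _ _ le_rfl))
  · intro t ht
    simp only [gu]
    rw [if_neg (by intro h; linarith [h.1]), if_neg (by intro h; linarith [h.1])]
    simp
  · rintro t ⟨ht0, ht1⟩
    obtain ⟨a1, a2, a3⟩ := h.range hm hmono (p+1) ht0 (ht1.trans_le hle)
    obtain ⟨b1, b2, b3⟩ := h'.range hm hmono (p+1) ht0 ht1
    refine ⟨?_, by linarith⟩
    by_cases ht : t ∈ S
    · have : t ∉ {t | t / c ∈ S} := by
        intro ht'
        apply hc
        refine ⟨t, ht, t / c, ht', ?_⟩
        simp only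
        field_simp
      have := b3 this
      linarith
    · have := a3 ht
      linarith

def Fit (F : ℝ → Prop) : ℕ → ℝ → Prop
  | 0 => F
  | n+1 => fun t => Fit F n t ∧ ¬ ∀ᶠ s in 𝓝 t, s ≠ t → ¬ Fit F n s

lemma lf_exists [DM L] {F : ℝ → Prop} (hF : DP L F) (hi : interior {t | F t} = ∅)
    (hcl : ∀ t, 0 < t → (∃ᶠ s in 𝓝 t, F s) → F t) (hfr : ∃ᶠ t in 𝓝[>] (0:ℝ), F t) :
    ∃ S s0, LF S s0 ∧ DP L (· ∈ S) := by
  have hd : ∀ n, DP L (Fit F n) := by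
    intro n
    induction n with
    | zero => exact hF
    | succ n ih =>
      exact ih.and (DP.not (DP.evR (P := fun t s => s ≠ t → ¬ Fit F n s) DF.id
        ((DP.eq DF.snd' DF.fst').not.imp (ih.comp DF.snd').not)))
  have hclo : ∀ n, ∀ t, 0 < t → (∃ᶠ s in 𝓝 t, Fit F n s) → Fit F n t := by
    intro n
    induction n with
    | zero => exact hcl
    | succ n ih =>
      intro t ht hf
      refine ⟨ih t ht (hf.mono fun s hs => hs.1), fun hev => ?_⟩
      apply hf
      have h1 := eventually_eventually_nhds.2 hev
      have hn : Fit F n t := ih t ht (hf.mono fun s hs => hs.1)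
      filter_upwards [h1, hev] with s hs hs2 hs3
      by_cases hst : s = t
      · subst hst
        exact hs3.2 hev
      · exact hs2 hst hs3.1
  have hempty : ∃ N, ∀ t, ¬ Fit F N t := by
    obtain ⟨N, hN⟩ := dmin_family (L := L) (X := ℝ) (P := fun _ t => F t) (hF.comp DF.snd')
    obtain ⟨U, D, hU, hD, he⟩ := hN 0
    have hU0 : U = ∅ := by
      rw [← subset_empty_iff, ← hi]
      apply interior_maximal _ hU
      rw [he]; exact subset_union_left
    rw [hU0, empty_union] at he
    refine ⟨N, fun t ht => ?_⟩
    have := CB D (by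
      intro i x hx
      obtain ⟨V, hV, hVD⟩ := hD i x hx
      refine ⟨V, hV, ?_, ?_⟩
      · have : x ∈ V ∩ D i := by rw [hVD]; rfl
        exact this.1
      · intro y hy
        rw [hVD] at hy; exact hy) N Finset.univ (by simp) (fun n => {t | Fit F n t}) (by
      intro x hx
      have : x ∈ {t | F t} := hx
      rw [he] at this
      obtain ⟨i, hi⟩ := mem_iUnion.1 this
      exact ⟨i, Finset.mem_univ _, hi⟩) (by
      intro j x hx
      refine ⟨hx.1, fun V hV hxV => ?_⟩
      by_contra hcon
      apply hx.2
      filter_upwards [hV.mem_nhds hxV] with s hs hne hFs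
      exact hcon ⟨s, ⟨hs, hFs⟩, hne⟩)
    have h2 : t ∈ {t | Fit F N t} := ht
    rw [this] at h2
    exact h2
  have hex : ∃ n, ¬ ∃ᶠ t in 𝓝[>] (0:ℝ), Fit F n t := by
    obtain ⟨N, hN⟩ := hempty
    refine ⟨N, fun h => ?_⟩
    obtain ⟨t, ht⟩ := h.exists
    exact hN t ht
  have hmin := Nat.find_spec hex
  have hpos : Nat.find hex ≠ 0 := by
    intro h0
    rw [h0] at hmin
    exact hmin hfr
  obtain ⟨n, hn⟩ := Nat.exists_eq_succ_of_ne_zero hpos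
  rw [hn] at hmin
  have hfn : ∃ᶠ t in 𝓝[>] (0:ℝ), Fit F n t := by
    by_contra hc
    exact Nat.find_min hex (m := n) (by omega) hc
  have hev : ∀ᶠ t in 𝓝[>] (0:ℝ), ¬ Fit F (n+1) t := not_frequently.1 hmin
  obtain ⟨δ, hδ, hδ2⟩ := (nhdsGT_basis (0:ℝ)).eventually_iff.1 hev
  have hacc : ∀ ε > 0, ∃ s, 0 < s ∧ s < ε ∧ Fit F n s := by
    intro ε hε
    have := hfn.and_eventually (Ioo_mem_nhdsGT hε)
    obtain ⟨s, h1, h2⟩ := this.exists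
    exact ⟨s, h2.1, h2.2, h1⟩
  obtain ⟨s0, hs0, hs1, hs2⟩ := hacc (min δ 1) (lt_min hδ one_pos)
  refine ⟨{t | Fit F n t ∧ 0 < t ∧ t ≤ s0}, s0, ⟨?_, ?_, ?_, ?_, ?_⟩, ?_⟩
  · intro t ht; exact ht.2
  · exact ⟨hs2, hs0, le_rfl⟩
  · exact (hs1.trans_le (min_le_right _ _)).le
  · intro ε hε
    by_contra hinf
    have hinf : ({t | Fit F n t ∧ 0 < t ∧ t ≤ s0} ∩ Ici ε).Infinite := hinf
    obtain ⟨x, hx, hacc⟩ := hinf.exists_accPt_of_subset_isCompact (isCompact_Icc (a := ε) (b := s0)) (by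
      intro t ht; exact ⟨ht.2, ht.1.2.2⟩)
    rw [accPt_iff_frequently] at hacc
    have hx0 : 0 < x := lt_of_lt_of_le hε hx.1
    refine hδ2 (x := x) ⟨hx0, lt_of_le_of_lt hx.2 (hs1.trans_le (min_le_left _ _))⟩ ⟨?_, ?_⟩
    · exact hclo n x hx0 (hacc.mono fun s hs => hs.2.1.1)
    · intro hev
      apply hacc
      filter_upwards [hev] with s hs hs'
      exact hs hs'.1 hs'.2.1.1
  · intro ε hε
    obtain ⟨s, h1, h2, h3⟩ := hacc (min ε s0) (lt_min hε hs0)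
    exact ⟨s, ⟨h3, h1, (h2.trans_le (min_le_right _ _)).le⟩, h2.trans_le (min_le_left _ _)⟩
  · exact (hd n).and ((DP.lt (DF.const 0) DF.id).and (DP.le DF.id (DF.const s0)))

lemma gt_dich [DM L] (hno : ¬ ∃ S s0, LF S s0 ∧ DP L (· ∈ S)) {P : ℝ → Prop} (hP : DP L P) :
    (∀ᶠ t in 𝓝[>] (0:ℝ), P t) ∨ (∀ᶠ t in 𝓝[>] (0:ℝ), ¬ P t) := by
  by_contra hcon
  push Not at hcon
  obtain ⟨h1, h2⟩ := hcon
  apply hno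
  have hint : DP L (fun t => ∀ᶠ s in 𝓝 t, P s) := DP.evR (P := fun t s => P s) DF.id (hP.comp DF.snd')
  have hint' : DP L (fun t => ∀ᶠ s in 𝓝 t, ¬ P s) := DP.evR (P := fun t s => ¬ P s) DF.id (hP.comp DF.snd').not
  apply lf_exists (F := fun t => ¬ (∀ᶠ s in 𝓝 t, P s) ∧ ¬ (∀ᶠ s in 𝓝 t, ¬ P s)) (hint.not.and hint'.not)
  · by_contra hne
    obtain ⟨x, hx⟩ := nonempty_iff_ne_empty.2 hne
    set O := interior {t | ¬ (∀ᶠ s in 𝓝 t, P s) ∧ ¬ (∀ᶠ s in 𝓝 t, ¬ P s)} with hO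
    have hsub : O ⊆ closure {t | P t} := by
      intro y hy
      have := (interior_subset hy).2
      exact mem_closure_iff_frequently.2 this
    obtain ⟨z, hz1, hz2⟩ := sdR (L := L) P hP O isOpen_interior ⟨x, hx⟩ hsub
    exact (interior_subset hz2).1 (mem_interior_iff_mem_nhds.1 hz1)
  · intro t ht hf
    constructor
    · intro h
      apply hf
      filter_upwards [eventually_eventually_nhds.2 h] with s hs hs'
      exact hs'.1 hs
    · intro h
      apply hf
      filter_upwards [eventually_eventually_nhds.2 h] with s hs hs'
      exact hs'.2 hs
  · intro hev
    obtain ⟨δ, hδ, hδ2⟩ := (nhdsGT_basis (0:ℝ)).eventually_iff.1 hev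
    have hpc : IsPreconnected (Ioo 0 δ) := isPreconnected_Ioo
    have a1 : ∃ t ∈ Ioo 0 δ, ¬ P t := by
      have := h1.and_eventually (Ioo_mem_nhdsGT hδ)
      obtain ⟨t, ha, hb⟩ := this.exists
      exact ⟨t, hb, ha⟩
    have a2 : ∃ t ∈ Ioo 0 δ, P t := by
      have := h2.and_eventually (Ioo_mem_nhdsGT hδ)
      obtain ⟨t, ha, hb⟩ := this.exists
      exact ⟨t, hb, ha⟩
    have hcov : ∀ t ∈ Ioo 0 δ, (∀ᶠ s in 𝓝 t, P s) ∨ (∀ᶠ s in 𝓝 t, ¬ P s) := by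
      intro t ht
      have := hδ2 ht
      tauto
    obtain ⟨t, ht, hb1, hb2⟩ := hpc (interior {t | P t}) (interior {t | ¬ P t}) isOpen_interior isOpen_interior (by
      intro t ht
      rcases hcov t ht with h | h
      · exact Or.inl (mem_interior_iff_mem_nhds.2 h)
      · exact Or.inr (mem_interior_iff_mem_nhds.2 h)) (by
      obtain ⟨t, ht, hPt⟩ := a2
      rcases hcov t ht with h | h
      · exact ⟨t, ht, mem_interior_iff_mem_nhds.2 h⟩
      · exact (h.self_of_nhds hPt).elim) (by
      obtain ⟨t, ht, hPt⟩ := a1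
      rcases hcov t ht with h | h
      · exact (hPt h.self_of_nhds).elim
      · exact ⟨t, ht, mem_interior_iff_mem_nhds.2 h⟩)
    exact interior_subset (s := {t | ¬ P t}) hb2 (interior_subset (s := {t | P t}) hb1)

end oned2

section oned3
variable {L}

lemma DF.iterD [OF L] {m : ℝ → ℝ} (hm : DF L m) (k : ℕ) : DF L (_root_.deriv^[k] m) := by
  induction k with
  | zero => exact hm
  | succ k ih =>
    rw [Function.iterate_succ_apply']
    exact DF.deriv (X := ℝ) (F := fun _ => _root_.deriv^[k] m) (a := fun x => x) (ih.comp DF.snd') DF.id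

lemma ev_diff [DM L] (hno : ¬ ∃ S s0, LF S s0 ∧ DP L (· ∈ S)) {f : ℝ → ℝ} (hf : DF L f) :
    ∀ᶠ t in 𝓝[>] (0:ℝ), DifferentiableAt ℝ f t := by
  have hd : DP L (fun t => DifferentiableAt ℝ f t) :=
    DP.diff (X := ℝ) (F := fun _ => f) (a := fun x => x) (hf.comp DF.snd') DF.id
  rcases gt_dich hno hd with h | h
  · exact h
  · obtain ⟨δ, hδ, h2⟩ := (nhdsGT_basis (0:ℝ)).eventually_iff.1 h
    obtain ⟨t, ht, h3⟩ := diff1 hf (show (0:ℝ) < δ from hδ)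
    exact (h2 ht h3).elim

lemma ev_sign [DM L] (hno : ¬ ∃ S s0, LF S s0 ∧ DP L (· ∈ S)) {f : ℝ → ℝ} (hf : DF L f) :
    (∀ᶠ t in 𝓝[>] (0:ℝ), 0 ≤ f t) ∨ (∀ᶠ t in 𝓝[>] (0:ℝ), f t ≤ 0) := by
  rcases gt_dich hno (DP.le (DF.const 0) hf) with h | h
  · exact Or.inl h
  · exact Or.inr (h.mono fun t ht => (not_le.1 ht).le)

lemma mvt_half {g : ℝ → ℝ} {a b : ℝ} (hab : a < b) (hg : ∀ t ∈ Icc a b, DifferentiableAt ℝ g t) :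
    ∃ ξ ∈ Ioo a b, deriv g ξ * (b - a) = g b - g a := by
  obtain ⟨ξ, hξ, h⟩ := exists_deriv_eq_slope g hab (fun t ht => (hg t ht).continuousAt.continuousWithinAt)
    (fun t ht => (hg t ⟨ht.1.le, ht.2.le⟩).differentiableWithinAt)
  refine ⟨ξ, hξ, ?_⟩
  rw [h]
  have : b - a ≠ 0 := by linarith [hab] |> fun (h : 0 < b - a) => h.ne'
  field_simp

lemma dbound_aux {g : ℝ → ℝ} {δ C : ℝ} {k : ℕ} (hg : ∀ t ∈ Ioo 0 δ, DifferentiableAt ℝ g t)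
    (hg' : ∀ t ∈ Ioo 0 δ, DifferentiableAt ℝ (deriv g) t)
    (hC : ∀ t ∈ Ioo 0 δ, t ^ k * |g t| ≤ C)
    (hs : (∀ t ∈ Ioo 0 δ, 0 ≤ deriv (deriv g) t) ∨ (∀ t ∈ Ioo 0 δ, deriv (deriv g) t ≤ 0)) :
    ∀ t ∈ Ioo 0 (δ/2), t ^ (k+1) * |deriv g t| ≤ 2 * (C + 2 ^ k * C) := by
  rintro t ⟨h0, h1⟩
  have hC0 : 0 ≤ C := le_trans (by positivity) (hC t ⟨h0, by linarith⟩)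
  obtain ⟨x, hx, ex⟩ := mvt_half (g := g) (a := t/2) (b := t) (by linarith) (fun u hu => hg u ⟨by linarith [hu.1], by linarith [hu.2]⟩)
  obtain ⟨y, hy, ey⟩ := mvt_half (g := g) (a := t) (b := 2*t) (by linarith) (fun u hu => hg u ⟨by linarith [hu.1], by linarith [hu.2]⟩)
  have c1 := hC t ⟨h0, by linarith⟩
  have c2 : t ^ k * |g (t/2)| ≤ 2 ^ k * C := by
    have := hC (t/2) ⟨by linarith, by linarith⟩
    rw [div_pow] at this
    have h2 : (0:ℝ) < 2 ^ k := by positivity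
    calc t ^ k * |g (t/2)| = 2 ^ k * (t ^ k / 2 ^ k * |g (t/2)|) := by field_simp
      _ ≤ _ := by gcongr
  have c3 : t ^ k * |g (2*t)| ≤ C := by
    refine le_trans ?_ (hC (2*t) ⟨by linarith, by linarith⟩)
    gcongr; linarith
  have tk : 0 < t ^ k := by positivity
  have two : (1:ℝ) ≤ 2 ^ k := one_le_pow₀ (by norm_num)
  have dx : t ^ (k+1) * |deriv g x| ≤ 2 * (C + 2 ^ k * C) := by
    have e1 : t * |deriv g x| = 2 * |g t - g (t/2)| := by
      rw [← ex, abs_mul, abs_of_pos (show 0 < t - t/2 by linarith)]; ring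
    calc t ^ (k+1) * |deriv g x| = t ^ k * (t * |deriv g x|) := by ring
      _ = 2 * (t ^ k * |g t - g (t/2)|) := by rw [e1]; ring
      _ ≤ 2 * (t ^ k * (|g t| + |g (t/2)|)) := by gcongr; exact abs_sub _ _
      _ ≤ _ := by nlinarith
  have dy : t ^ (k+1) * |deriv g y| ≤ 2 * (C + 2 ^ k * C) := by
    have e1 : t * |deriv g y| = |g (2*t) - g t| := by
      rw [← ey, abs_mul, abs_of_pos (show 0 < 2*t - t by linarith)]; ring
    calc t ^ (k+1) * |deriv g y| = t ^ k * (t * |deriv g y|) := by ring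
      _ = (t ^ k * |g (2*t) - g t|) := by rw [e1]
      _ ≤ (t ^ k * (|g (2*t)| + |g t|)) := by gcongr; exact abs_sub _ _
      _ ≤ _ := by nlinarith
  have hbet : |deriv g t| ≤ max |deriv g x| |deriv g y| := by
    have hint : interior (Ioo 0 δ) = Ioo 0 δ := isOpen_Ioo.interior_eq
    have mx : x ∈ Ioo 0 δ := ⟨by linarith [hx.1], by linarith [hx.2]⟩
    have mt : t ∈ Ioo 0 δ := ⟨by linarith, by linarith⟩
    have my : y ∈ Ioo 0 δ := ⟨by linarith [hy.1], by linarith [hy.2]⟩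
    rcases hs with hs | hs
    · have hmon : MonotoneOn (deriv g) (Ioo 0 δ) := by
        apply monotoneOn_of_deriv_nonneg (convex_Ioo 0 δ) (fun t ht => (hg' t ht).continuousAt.continuousWithinAt)
        · rw [hint]; exact fun t ht => (hg' t ht).differentiableWithinAt
        · rw [hint]; exact hs
      have a1 := hmon mx mt hx.2.le
      have a2 := hmon mt my hy.1.le
      exact abs_le_max_abs_abs a1 a2
    · have hmon : AntitoneOn (deriv g) (Ioo 0 δ) := by
        apply antitoneOn_of_deriv_nonpos (convex_Ioo 0 δ) (fun t ht => (hg' t ht).continuousAt.continuousWithinAt)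
        · rw [hint]; exact fun t ht => (hg' t ht).differentiableWithinAt
        · rw [hint]; exact hs
      have a1 := hmon mx mt hx.2.le
      have a2 := hmon mt my hy.1.le
      rw [max_comm]
      exact abs_le_max_abs_abs a2 a1
  rcases le_max_iff.1 hbet with h | h
  · exact le_trans (by gcongr) dx
  · exact le_trans (by gcongr) dy

lemma dbound [DM L] (hno : ¬ ∃ S s0, LF S s0 ∧ DP L (· ∈ S)) {m : ℝ → ℝ} (hmd : DF L m)
    (hm : ∀ t, 0 < t → 0 < m t ∧ m t ≤ 1) (k : ℕ) :
    ∃ C, ∀ᶠ t in 𝓝[>] (0:ℝ), t ^ k * |deriv^[k] m t| ≤ C := by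
  induction k with
  | zero =>
    refine ⟨1, ?_⟩
    filter_upwards [self_mem_nhdsWithin] with t ht
    have := hm t ht
    simp only [pow_zero, one_mul, Function.iterate_zero, id]
    rw [abs_of_pos this.1]; exact this.2
  | succ k ih =>
    obtain ⟨C, hC⟩ := ih
    refine ⟨2 * (C + 2 ^ k * C), ?_⟩
    have d0 := hmd.iterD k
    have d1 := hmd.iterD (k+1)
    have d2 := hmd.iterD (k+2)
    have hs := ev_sign hno d2
    have e0 := ev_diff hno d0
    have e1 := ev_diff hno d1
    rw [Function.iterate_succ_apply'] at e1 ⊢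
    rw [Function.iterate_succ_apply', Function.iterate_succ_apply'] at hs
    rcases hs with hs | hs
    · obtain ⟨δ, hδ, h2⟩ := (nhdsGT_basis (0:ℝ)).eventually_iff.1 (hC.and (e0.and (e1.and hs)))
      filter_upwards [Ioo_mem_nhdsGT (half_pos hδ)]
      exact dbound_aux (fun t ht => (h2 ht).2.1) (fun t ht => (h2 ht).2.2.1) (fun t ht => (h2 ht).1)
        (Or.inl fun t ht => (h2 ht).2.2.2)
    · obtain ⟨δ, hδ, h2⟩ := (nhdsGT_basis (0:ℝ)).eventually_iff.1 (hC.and (e0.and (e1.and hs)))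
      filter_upwards [Ioo_mem_nhdsGT (half_pos hδ)]
      exact dbound_aux (fun t ht => (h2 ht).2.1) (fun t ht => (h2 ht).2.2.1) (fun t ht => (h2 ht).1)
        (Or.inr fun t ht => (h2 ht).2.2.2)

def gG (m : ℝ → ℝ) (e j : ℕ) (t : ℝ) : ℝ := if 0 < t then t ^ e * deriv^[j] m t else 0

lemma gG_bound {m : ℝ → ℝ} {δ C : ℝ} (e j : ℕ) (hej : j ≤ e) (hC : ∀ t ∈ Ioo 0 δ, t ^ j * |deriv^[j] m t| ≤ C)
    (hδ : 0 < δ) {t : ℝ} (ht : t < δ) : |gG m e j t| ≤ C * |t| ^ (e - j) := by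
  have hC0 : 0 ≤ C := le_trans (by positivity) (hC (δ/2) ⟨by linarith, by linarith⟩)
  unfold gG
  split_ifs with h
  · rw [abs_mul, abs_pow, abs_of_pos h]
    calc t ^ e * |deriv^[j] m t| = t ^ j * |deriv^[j] m t| * t ^ (e - j) := by
          rw [← Nat.sub_add_cancel hej, pow_add]; simp; ring
      _ ≤ _ := by gcongr; exact hC t ⟨h, ht⟩
  · rw [abs_zero]; positivity

lemma gG_neg {m : ℝ → ℝ} (e j : ℕ) {t : ℝ} (ht : t ≤ 0) : gG m e j t = 0 := by
  unfold gG; rw [if_neg (by linarith)]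

lemma gG_deriv {m : ℝ → ℝ} {δ C : ℝ} (e j : ℕ) (hej : j + 2 ≤ e) (hC : ∀ t ∈ Ioo 0 δ, t ^ j * |deriv^[j] m t| ≤ C)
    (hd : ∀ t ∈ Ioo 0 δ, DifferentiableAt ℝ (deriv^[j] m) t)
    (hδ : 0 < δ) {t : ℝ} (ht : t < δ) : HasDerivAt (gG m e j) (e * gG m (e-1) j t + gG m e (j+1) t) t := by
  rcases lt_trichotomy t 0 with h | h | h
  · rw [gG_neg _ _ h.le, gG_neg _ _ h.le]
    simp only [mul_zero, add_zero]
    apply (hasDerivAt_const t (0 : ℝ)).congr_of_eventuallyEq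
    filter_upwards [eventually_lt_nhds h] with z hz using gG_neg _ _ hz.le
  · subst h
    rw [gG_neg _ _ le_rfl, gG_neg _ _ le_rfl]
    have : HasFDerivAt (gG m e j) (0 : ℝ →L[ℝ] ℝ) 0 := by
      apply Asymptotics.IsBigO.hasFDerivAt (n := e - j) _ (by omega)
      apply Asymptotics.IsBigO.of_bound C
      filter_upwards [eventually_lt_nhds ht] with z hz
      have := gG_bound e j (by omega) hC hδ hz
      simpa using this
    simpa using this.hasDerivAt
  · have h1 : HasDerivAt (fun z => z ^ e * deriv^[j] m z) (e * t ^ (e-1) * deriv^[j] m t + t ^ e * deriv^[j+1] m t) t := by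
      rw [Function.iterate_succ_apply']
      exact (hasDerivAt_pow e t).mul (hd t ⟨h, ht⟩).hasDerivAt
    refine (h1.congr_of_eventuallyEq ?_).congr_deriv ?_
    · filter_upwards [eventually_gt_nhds h] with z hz
      unfold gG; rw [if_pos hz]
    · unfold gG; rw [if_pos h, if_pos h]; ring

lemma gG_cd {m : ℝ → ℝ} {δ : ℝ} {C : ℕ → ℝ} (p : ℕ) (hC : ∀ j ≤ p, ∀ t ∈ Ioo 0 δ, t ^ j * |deriv^[j] m t| ≤ C j)
    (hd : ∀ j ≤ p, ∀ t ∈ Ioo 0 δ, DifferentiableAt ℝ (deriv^[j] m) t)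
    (hδ : 0 < δ) (k : ℕ) : ∀ e j, k + j + 1 ≤ e → k + j ≤ p → ContDiffOn ℝ k (gG m e j) (Iio δ) := by
  induction k with
  | zero =>
    intro e j he hj
    simp only [Nat.cast_zero]
    rw [contDiffOn_zero]
    intro t ht
    apply ContinuousAt.continuousWithinAt
    rcases lt_trichotomy t 0 with h | h | h
    · apply (continuousAt_const (y := (0:ℝ))).congr
      filter_upwards [eventually_lt_nhds h] with z hz using (gG_neg _ _ hz.le).symm
    · subst h
      rw [Metric.continuousAt_iff']
      intro ε hε
      have hc : ContinuousAt (fun z : ℝ => C j * |z| ^ (e - j)) 0 := by fun_prop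
      have := hc.eventually (eventually_lt_nhds (b := ε) (by
        simp only [abs_zero]; rw [zero_pow (by omega), mul_zero]; exact hε))
      filter_upwards [this, eventually_lt_nhds hδ] with z hz hz2
      rw [gG_neg _ _ le_rfl, Real.dist_eq, sub_zero]
      exact (gG_bound e j (by omega) (hC j (by omega)) hδ hz2).trans_lt hz
    · have h1 : ContinuousAt (fun z => z ^ e * deriv^[j] m z) t :=
        (continuousAt_id.pow e).mul (hd j (by omega) t ⟨h, ht⟩).continuousAt
      apply h1.congr
      filter_upwards [eventually_gt_nhds h] with z hz
      unfold gG; rw [if_pos hz]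
  | succ k ih =>
    intro e j he hj
    rw [show ((k + 1 : ℕ) : WithTop ℕ∞) = (k : WithTop ℕ∞) + 1 by push_cast; rfl]
    rw [contDiffOn_succ_iff_deriv_of_isOpen isOpen_Iio]
    have hD := fun t (ht : t < δ) => gG_deriv (m := m) e j (by omega) (hC j (by omega)) (hd j (by omega)) hδ ht
    refine ⟨fun t ht => (hD t ht).differentiableAt.differentiableWithinAt, by simp, ?_⟩
    have : ContDiffOn ℝ k (fun t => e * gG m (e-1) j t + gG m e (j+1) t) (Iio δ) :=
      ((contDiffOn_const).mul (ih _ _ (by omega) (by omega))).add (ih _ _ (by omega) (by omega))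
    refine this.congr fun t ht => (hD t ht).deriv

lemma theta [DM L] (p : ℕ) {m : ℝ → ℝ} (hmd : DF L m)
    (hm : ∀ t, 0 < t → 0 < m t ∧ m t ≤ 1)
    (hmono : ∀ s t, 0 < s → s ≤ t → m s ≤ m t) :
    ∃ t0 > 0, ∃ θ : ℝ → ℝ, DF L θ ∧ ContDiffOn ℝ p θ (Iio t0) ∧ (∀ t ≤ 0, θ t = 0) ∧
      ∀ t ∈ Ioo 0 t0, 0 < θ t ∧ θ t ≤ m t := by
  by_cases hno : ∃ S s0, LF S s0 ∧ DP L (· ∈ S)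
  · obtain ⟨S, s0, h, hS⟩ := hno
    exact theta1 p h hS hmd hm hmono
  · choose C hC using fun k => dbound hno hmd hm k
    have hev : ∀ᶠ t in 𝓝[>] (0:ℝ), ∀ j ∈ Finset.range (p+1), t ^ j * |deriv^[j] m t| ≤ C j ∧
        DifferentiableAt ℝ (deriv^[j] m) t := by
      rw [Finset.eventually_all]
      intro j _
      exact (hC j).and (ev_diff hno (hmd.iterD j))
    obtain ⟨δ, hδ, h2⟩ := (nhdsGT_basis (0:ℝ)).eventually_iff.1 (hev.and (Ioo_mem_nhdsGT (one_pos)))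
    refine ⟨δ, hδ, gG m (p+1) 0, ?_, ?_, fun t ht => gG_neg _ _ ht, ?_⟩
    · have := DF.ite (DP.lt (DF.const 0) DF.id) ((DF.id.pow (p+1)).mul hmd) (DF.const 0)
      convert this using 2 with x
      unfold gG
      congr
    · exact gG_cd p (fun j hj t ht => ((h2 ht).1 j (Finset.mem_range.2 (by omega))).1)
        (fun j hj t ht => ((h2 ht).1 j (Finset.mem_range.2 (by omega))).2) hδ p _ _ le_rfl le_rfl
    · intro t ht
      have h3 := hm t ht.1
      have h4 := (h2 ht).2
      unfold gG
      rw [if_pos ht.1]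
      simp only [Function.iterate_zero, id]
      have h5 : 0 < t ^ (p+1) := pow_pos ht.1 _
      have h6 : t ^ (p+1) ≤ 1 := pow_le_one₀ ht.1.le h4.2.le
      exact ⟨mul_pos h5 h3.1, by nlinarith⟩

end oned3

section dl
variable {L}
variable {κ : Type} [Fintype κ]

def gt2 (g : (κ → ℝ) → ℝ) (x : κ → ℝ) : ℝ := g x ^ 2 / ((1 + g x ^ 2) * (1 + ∑ i, x i ^ 2))

lemma gt2_den (g : (κ → ℝ) → ℝ) (x : κ → ℝ) : 0 < (1 + g x ^ 2) * (1 + ∑ i, x i ^ 2) := by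
  have : 0 ≤ ∑ i, x i ^ 2 := Finset.sum_nonneg fun i _ => sq_nonneg _
  positivity

lemma gt2_nonneg (g : (κ → ℝ) → ℝ) (x : κ → ℝ) : 0 ≤ gt2 g x :=
  div_nonneg (sq_nonneg _) (gt2_den g x).le

lemma gt2_pos {g : (κ → ℝ) → ℝ} {x : κ → ℝ} (h : g x ≠ 0) : 0 < gt2 g x :=
  div_pos (by positivity) (gt2_den g x)

lemma gt2_lt (g : (κ → ℝ) → ℝ) (x : κ → ℝ) : gt2 g x * (1 + ∑ i, x i ^ 2) < 1 := by
  have h : 0 ≤ ∑ i, x i ^ 2 := Finset.sum_nonneg fun i _ => sq_nonneg _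
  unfold gt2
  rw [div_mul_eq_mul_div, div_lt_one (gt2_den g x)]
  have : 0 < 1 + ∑ i, x i ^ 2 := by linarith
  nlinarith

lemma gt2_lt1 (g : (κ → ℝ) → ℝ) (x : κ → ℝ) : gt2 g x < 1 := by
  have h : 0 ≤ ∑ i, x i ^ 2 := Finset.sum_nonneg fun i _ => sq_nonneg _
  have := gt2_lt g x
  have := gt2_nonneg g x
  nlinarith

lemma gt2_cd {n : WithTop ℕ∞} {g : (κ → ℝ) → ℝ} (hg : ContDiff ℝ n g) : ContDiff ℝ n (gt2 g) := by
  unfold gt2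
  apply ContDiff.div (by fun_prop) (by fun_prop) (fun x => (gt2_den g x).ne')

lemma gt2_df [OF L] {g : (κ → ℝ) → ℝ} (hg : DF L g) : DF L (gt2 g) :=
  (hg.pow 2).div (((DF.const 1).add (hg.pow 2)).mul ((DF.const 1).add
    (DF.sum Finset.univ fun i => (DF.id.app i).pow 2)))

lemma gt2_cpt {g : (κ → ℝ) → ℝ} (hg : Continuous g) {t : ℝ} (ht : 0 < t) : IsCompact {x | t ≤ gt2 g x} := by
  have hc : Continuous (gt2 g) := by
    have := gt2_cd (n := 0) (contDiff_zero.2 hg)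
    exact contDiff_zero.1 this
  apply (isCompact_closedBall (0 : κ → ℝ) (1 + 1 / t)).of_isClosed_subset (isClosed_le continuous_const hc)
  intro x hx
  have hx : t ≤ gt2 g x := hx
  rw [mem_closedBall_zero_iff, pi_norm_le_iff_of_nonneg (by positivity)]
  intro i
  have h1 := gt2_lt g x
  have h2 : x i ^ 2 ≤ ∑ i, x i ^ 2 := Finset.single_le_sum (f := fun i => x i ^ 2) (fun i _ => sq_nonneg _) (Finset.mem_univ i)
  have h3 : x i ^ 2 ≤ 1 / t := by
    rw [le_div_iff₀ ht]
    nlinarith [sq_nonneg (x i)]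
  rw [Real.norm_eq_abs, abs_le]
  constructor <;> nlinarith [sq_nonneg (x i - 1), sq_nonneg (x i + 1)]

lemma delta [DM L] (p : ℕ) {g : (κ → ℝ) → ℝ} (hg : DF L g) (hgc : ContDiff ℝ p g)
    {Good : (κ → ℝ) → ℝ → Prop} (hGd : DP L (fun q : (κ → ℝ) × ℝ => Good q.1 q.2))
    (hdown : ∀ x a b, 0 < b → b ≤ a → Good x a → Good x b)
    (hloc : ∀ x, g x ≠ 0 → ∃ c > 0, ∀ᶠ x' in 𝓝 x, Good x' c) :
    ∃ δ : (κ → ℝ) → ℝ, DF L δ ∧ ContDiff ℝ p δ ∧ (∀ x, g x = 0 → δ x = 0) ∧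
      ∀ x, g x ≠ 0 → 0 < δ x ∧ Good x (δ x) := by
  set V : ℝ → ℝ → Prop := fun t u => (0 ≤ u ∧ u ≤ 1) ∧ (0 < u → ∀ x, t ≤ gt2 g x → Good x u) with hV
  have hVd : DP L (fun q : ℝ × ℝ => V q.1 q.2) := by
    apply DP.and ((DP.le (DF.const 0) DF.snd').and (DP.le DF.snd' (DF.const 1)))
    apply DP.imp (DP.lt (DF.const 0) DF.snd')
    apply DP.all
    exact DP.imp (DP.le DF.fst'.fst ((gt2_df hg).comp DF.snd')) (hGd.comp (DF.snd'.pair DF.fst'.snd))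
  have hbdd : ∀ t, BddAbove {u | V t u} := fun t => ⟨1, fun u hu => hu.1.2⟩
  have h0V : ∀ t, V t 0 := fun t => ⟨⟨le_rfl, zero_le_one⟩, fun h => (lt_irrefl _ h).elim⟩
  have hex : ∀ t, 0 < t → ∃ u > 0, V t u := by
    intro t ht
    have hK := gt2_cpt hgc.continuous ht
    have : ∃ c > 0, ∀ x ∈ {x | t ≤ gt2 g x}, Good x c := by
      apply hK.induction_on (p := fun s => ∃ c > 0, ∀ x ∈ s, Good x c)
      · exact ⟨1, one_pos, fun x hx => hx.elim⟩
      · rintro s s' hss ⟨c, hc, h⟩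
        exact ⟨c, hc, fun x hx => h x (hss hx)⟩
      · rintro s s' ⟨c, hc, h⟩ ⟨c', hc', h'⟩
        refine ⟨min c c', lt_min hc hc', ?_⟩
        rintro x (hx | hx)
        · exact hdown x _ _ (lt_min hc hc') (min_le_left _ _) (h x hx)
        · exact hdown x _ _ (lt_min hc hc') (min_le_right _ _) (h' x hx)
      · intro x hx
        have hgx : g x ≠ 0 := by
          intro h
          have hx : t ≤ gt2 g x := hx
          unfold gt2 at hx
          rw [h] at hx
          simp at hx
          linarith
        obtain ⟨c, hc, h⟩ := hloc x hgx
        exact ⟨_, mem_nhdsWithin_of_mem_nhds h, c, hc, fun y hy => hy⟩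
    obtain ⟨c, hc, h⟩ := this
    exact ⟨min c 1, lt_min hc one_pos, ⟨(lt_min hc one_pos).le, min_le_right _ _⟩,
      fun _ x hx => hdown x _ _ (lt_min hc one_pos) (min_le_left _ _) (h x hx)⟩
  set m : ℝ → ℝ := fun t => 1/2 * sSup {u | V t u} with hm
  have hmd : DF L m := (DF.const _).mul (DF.sup hVd)
  have hm1 : ∀ t, 0 < t → 0 < m t ∧ m t ≤ 1 := by
    intro t ht
    obtain ⟨u, hu, hVu⟩ := hex t ht
    have h1 : u ≤ sSup {u | V t u} := le_csSup (hbdd t) hVu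
    have h2 : sSup {u | V t u} ≤ 1 := csSup_le ⟨0, h0V t⟩ fun u hu => hu.1.2
    simp only [hm]
    constructor <;> linarith
  have hmono : ∀ s t, 0 < s → s ≤ t → m s ≤ m t := by
    intro s t hs hst
    simp only [hm]
    have : sSup {u | V s u} ≤ sSup {u | V t u} :=
      csSup_le_csSup (hbdd t) ⟨0, h0V s⟩ fun u hu => ⟨hu.1, fun h0 x hx => hu.2 h0 x (hst.trans hx)⟩
    linarith
  have hgood : ∀ t, 0 < t → ∀ x, t ≤ gt2 g x → Good x (m t) := by
    intro t ht x hx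
    have h1 := (hm1 t ht).1
    have : m t < sSup {u | V t u} := by
      simp only [hm] at h1 ⊢
      linarith
    obtain ⟨u, hu, hlt⟩ := exists_lt_of_lt_csSup ⟨0, h0V t⟩ this
    exact hdown x u _ h1 hlt.le (hu.2 (h1.trans hlt) x hx)
  obtain ⟨t0, ht0, θ, h1, h2, h3, h4⟩ := theta p hmd hm1 hmono
  have hc0 : 0 < min 1 t0 := lt_min one_pos ht0
  have hlt : ∀ x, min 1 t0 * gt2 g x < t0 := by
    intro x
    have := gt2_lt1 g x
    have := min_le_right 1 t0
    nlinarith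
  refine ⟨fun x => θ (min 1 t0 * gt2 g x), h1.comp ((DF.const _).mul (gt2_df hg)), ?_, ?_, ?_⟩
  · exact h2.comp_contDiff (contDiff_const.mul (gt2_cd hgc)) hlt
  · intro x hx
    apply h3
    unfold gt2
    rw [hx]; simp
  · intro x hx
    have hp := gt2_pos hx
    obtain ⟨a, b⟩ := h4 (min 1 t0 * gt2 g x) ⟨by positivity, hlt x⟩
    refine ⟨a, hdown x (m (gt2 g x)) _ a (b.trans (hmono _ _ (by positivity) ?_)) (hgood _ hp x le_rfl)⟩
    have := min_le_left 1 t0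
    nlinarith

end dl

section soft
variable {L}
variable {κ : Type} [Fintype κ]

def Gd (g : (κ → ℝ) → ℝ) : ℕ → ((κ → ℝ) → ℝ) → (κ → ℝ) → ℝ → Prop
  | 0, F, x, η => |η * F x| ≤ |g x|
  | k+1, F, x, η => |η * F x| ≤ |g x| ∧ ∀ i, Gd g k (pd i F) x η

lemma Gd_def [OF L] {g : (κ → ℝ) → ℝ} (hg : DF L g) (k : ℕ) : ∀ {F : (κ → ℝ) → ℝ}, DF L F →
    DP L (fun q : (κ → ℝ) × ℝ => Gd g k F q.1 q.2) := by
  have base : ∀ {F : (κ → ℝ) → ℝ}, DF L F → DP L (fun q : (κ → ℝ) × ℝ => |q.2 * F q.1| ≤ |g q.1|) := fun hF =>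
    DP.le (DF.snd'.mul (hF.comp DF.fst')).abs (hg.comp DF.fst').abs
  induction k with
  | zero => exact base
  | succ k ih =>
    intro F hF
    exact (base hF).and (DP.fall fun i => ih (hF.pd i))

lemma Gd_down {g : (κ → ℝ) → ℝ} (k : ℕ) : ∀ {F : (κ → ℝ) → ℝ} (x : κ → ℝ) (a b : ℝ), 0 < b → b ≤ a →
    Gd g k F x a → Gd g k F x b := by
  have base : ∀ {F : (κ → ℝ) → ℝ} (x : κ → ℝ) (a b : ℝ), 0 < b → b ≤ a → |a * F x| ≤ |g x| → |b * F x| ≤ |g x| := by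
    intro F x a b hb hab h
    refine le_trans ?_ h
    rw [abs_mul, abs_mul, abs_of_pos hb, abs_of_pos (hb.trans_le hab)]
    gcongr
  induction k with
  | zero => exact base
  | succ k ih =>
    intro F x a b hb hab h
    exact ⟨base x a b hb hab h.1, fun i => ih x a b hb hab (h.2 i)⟩

lemma Gd_le {g : (κ → ℝ) → ℝ} (k : ℕ) : ∀ {F : (κ → ℝ) → ℝ} {x : κ → ℝ} {a : ℝ}, 
    Gd g (k+1) F x a → Gd g k F x a := by
  induction k with
  | zero => intro F x a h; exact h.1
  | succ k ih => intro F x a h; exact ⟨h.1, fun i => ih (h.2 i)⟩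

lemma Gd_base {g : (κ → ℝ) → ℝ} (k : ℕ) {F : (κ → ℝ) → ℝ} {x : κ → ℝ} {a : ℝ} 
    (h : Gd g k F x a) : |a * F x| ≤ |g x| := by
  cases k with
  | zero => exact h
  | succ k => exact h.1

lemma Gd_loc {g : (κ → ℝ) → ℝ} (hg : Continuous g) (k : ℕ) : ∀ {F : (κ → ℝ) → ℝ} {x : κ → ℝ}, g x ≠ 0 →
    ContDiffAt ℝ k F x → ∀ᶠ c in 𝓝[>] (0:ℝ), ∀ᶠ x' in 𝓝 x, Gd g k F x' c := by
  have base : ∀ {F : (κ → ℝ) → ℝ} {x : κ → ℝ}, g x ≠ 0 →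
      ContinuousAt F x → ∀ᶠ c in 𝓝[>] (0:ℝ), ∀ᶠ x' in 𝓝 x, |c * F x'| ≤ |g x'| := by
    intro F x hgx hF
    have h0 : 0 < |g x| := abs_pos.2 hgx
    have h1 : ∀ᶠ c in 𝓝[>] (0:ℝ), |c * F x| < |g x| := by
      apply mem_nhdsWithin_of_mem_nhds
      have hc : Continuous (fun c : ℝ => |c * F x|) := by fun_prop
      exact hc.continuousAt.eventually (eventually_lt_nhds (by simpa using hgx))
    filter_upwards [h1] with c hc
    have hc1 : ContinuousAt (fun x' => |c * F x'|) x := (continuousAt_const.mul hF).abs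
    have hc2 : ContinuousAt (fun x' => |g x'|) x := hg.continuousAt.abs
    filter_upwards [hc1.eventually_lt hc2 hc] with z hz using hz.le
  induction k with
  | zero => intro F x hx hF; exact base hx hF.continuousAt
  | succ k ih =>
    intro F x hx hF
    have h1 := ((contDiffAt_succ_pd k F x).1 hF).2
    have h2 : ∀ᶠ c in 𝓝[>] (0:ℝ), ∀ i, ∀ᶠ x' in 𝓝 x, Gd g k (pd i F) x' c := by
      rw [eventually_all]
      exact fun i => ih hx (h1 i)
    filter_upwards [h2, base hx hF.continuousAt] with c hc hc'
    filter_upwards [hc', eventually_all.2 hc] with z hz1 hz2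
    exact ⟨hz1, hz2⟩

lemma soft {B : Set (κ → ℝ)} (hB : IsClosed B) {g d : (κ → ℝ) → ℝ} {p : ℕ} (hg : Continuous g)
    (hgB : ∀ x ∈ B, g x = 0) (hd : ContDiff ℝ p d) (hdB : ∀ x ∈ B, d x = 0) (k : ℕ) (hk : k ≤ p) :
    ∀ (F : (κ → ℝ) → ℝ) (e : ℕ), (∀ x ∉ B, ContDiffAt ℝ k F x) → (∀ x ∉ B, Gd g k F x (d x)) → k + 1 ≤ e →
      ContDiff ℝ k (fun x => d x ^ e * F x) := by
  induction k with
  | zero =>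
    intro F e hF hG he
    rw [show ((0 : ℕ) : WithTop ℕ∞) = 0 from rfl, contDiff_zero, continuous_iff_continuousAt]
    intro x
    by_cases hx : x ∈ B
    · obtain ⟨e, rfl⟩ : ∃ e', e = e' + 1 := ⟨e - 1, by omega⟩
      rw [ContinuousAt, hdB x hx, zero_pow (by omega), zero_mul]
      have hle : ∀ z, |d z ^ (e+1) * F z| ≤ |d z ^ e| * |g z| := by
        intro z
        by_cases hz : z ∈ B
        · rw [hdB z hz, hgB z hz]; simp
        · have h1 : |d z * F z| ≤ |g z| := hG z hz
          calc |d z ^ (e+1) * F z| = |d z ^ e| * |d z * F z| := by rw [← abs_mul]; ring_nf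
            _ ≤ _ := by gcongr
      have hc : Continuous (fun z => |d z ^ e| * |g z|) := by
        have := hd.continuous
        fun_prop
      have ht := hc.tendsto x
      simp only [hgB x hx, abs_zero, mul_zero] at ht
      exact squeeze_zero_norm hle ht
    · exact (hd.continuous.continuousAt.pow e).mul (hF x hx).continuousAt
  | succ k ih =>
    intro F e hF hG he
    obtain ⟨e, rfl⟩ : ∃ e', e = e' + 1 := ⟨e - 1, by omega⟩
    have hFk : ∀ x ∉ B, ContDiffAt ℝ k F x := fun x hx => (hF x hx).of_le (by norm_cast; omega)
    have c1 := ih (by omega) F e hFk (fun x hx => Gd_le k (hG x hx)) (by omega)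
    have c2 := fun i => ih (by omega) (pd i F) (e+1) (fun x hx => ((contDiffAt_succ_pd k F x).1 (hF x hx)).2 i)
      (fun x hx => (hG x hx).2 i) (by omega)
    have hdk : ContDiff ℝ (k+1 : ℕ) d := hd.of_le (by exact_mod_cast hk)
    have hdd : Differentiable ℝ d := hdk.differentiable (by simp)
    have c3 : ∀ i, ContDiff ℝ k (pd i d) := fun i => contDiff_iff_contDiffAt.2 fun x =>
      ((contDiffAt_succ_pd k d x).1 hdk.contDiffAt).2 i
    have dd : ∀ x i, HasDerivAt (fun t => d (Function.update x i t)) (pd i d x) (x i) := by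
      intro x i
      have := hasDerivAt_update_of_fderiv i (hdd x).hasFDerivAt
      exact this.differentiableAt.hasDerivAt
    have key : ∀ x i, HasDerivAt (fun t => d (Function.update x i t) ^ (e+1) * F (Function.update x i t))
        ((e+1) * pd i d x * (d x ^ e * F x) + d x ^ (e+1) * pd i F x) (x i) := by
      intro x i
      by_cases hx : x ∈ B
      · have h1 := (dd x i).isBigO_sub
        have h2 : Tendsto (fun t => d (Function.update x i t) ^ e * F (Function.update x i t)) (𝓝 (x i)) (𝓝 0) := by
          have hu : Continuous (fun t : ℝ => Function.update x i t) := by fun_prop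
          have := (c1.continuous.comp hu).tendsto (x i)
          simp only [Function.comp_def, Function.update_eq_self, hdB x hx] at this
          rwa [zero_pow (by omega), zero_mul] at this
        rw [hdB x hx, zero_pow (by omega), zero_pow (by omega)]
        simp only [zero_mul, mul_zero, add_zero]
        rw [hasDerivAt_iff_isLittleO]
        simp only [Function.update_eq_self, hdB x hx] at h1 ⊢
        rw [zero_pow (by omega)]
        simp only [sub_zero, zero_mul, smul_zero] at h1 ⊢
        have h3 := h1.mul_isLittleO ((Asymptotics.isLittleO_one_iff ℝ).2 h2)
        refine (h3.congr_left ?_).congr_right ?_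
        · intro t; ring
        · intro t; ring
      · have h1 := (((contDiffAt_succ_pd k F x).1 (hF x hx)).1.self_of_nhds i).hasDerivAt
        have h2 := ((dd x i).pow (e+1)).mul h1
        refine h2.congr_deriv ?_
        simp only [Function.update_eq_self, Pi.pow_apply, pd]
        push_cast
        ring
    rw [contDiff_iff_contDiffAt]
    intro x
    rw [contDiffAt_succ_pd]
    refine ⟨Eventually.of_forall fun z i => (key z i).differentiableAt, fun i => ?_⟩
    have : pd i (fun x => d x ^ (e+1) * F x) = fun x => (e+1) * pd i d x * (d x ^ e * F x) + d x ^ (e+1) * pd i F x := by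
      funext z
      exact (key z i).deriv
    rw [this]
    exact (((contDiff_const.mul (c3 i)).mul c1).add (c2 i)).contDiffAt

end soft

section stepsec
variable {L}
variable {κ : Type} [Fintype κ]

def pp (e : ℕ) (u : ℝ) : ℝ := max u 0 ^ e

lemma pp_deriv (e : ℕ) (u : ℝ) : HasDerivAt (pp (e+2)) ((e+2) * pp (e+1) u) u := by
  rcases lt_trichotomy u 0 with h | h | h
  · have : pp (e+1) u = 0 := by unfold pp; rw [max_eq_right h.le, zero_pow (by omega)]
    rw [this, mul_zero]
    apply (hasDerivAt_const u (0 : ℝ)).congr_of_eventuallyEq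
    filter_upwards [eventually_lt_nhds h] with z hz
    unfold pp; rw [max_eq_right hz.le, zero_pow (by omega)]
  · subst h
    have : pp (e+1) 0 = 0 := by unfold pp; simp
    rw [this, mul_zero]
    have : HasFDerivAt (pp (e+2)) (0 : ℝ →L[ℝ] ℝ) 0 := by
      apply Asymptotics.IsBigO.hasFDerivAt (n := e+2) _ (by omega)
      apply Asymptotics.IsBigO.of_bound 1
      filter_upwards with z
      unfold pp
      rw [norm_pow, one_mul, norm_pow, norm_norm, sub_zero]
      apply pow_le_pow_left₀ (norm_nonneg _)
      rw [Real.norm_eq_abs, Real.norm_eq_abs, abs_of_nonneg (le_max_right _ _)]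
      exact max_le (le_abs_self z) (abs_nonneg z)
    simpa using this.hasDerivAt
  · have h1 := hasDerivAt_pow (e+2) u
    refine (h1.congr_of_eventuallyEq ?_).congr_deriv ?_
    · filter_upwards [eventually_gt_nhds h] with z hz
      unfold pp; rw [max_eq_left hz.le]
    · unfold pp; rw [max_eq_left h.le]; push_cast; rfl

lemma pp_cd (k : ℕ) : ∀ e, k + 1 ≤ e → ContDiff ℝ k (pp e) := by
  induction k with
  | zero =>
    intro e he
    rw [show ((0 : ℕ) : WithTop ℕ∞) = 0 from rfl, contDiff_zero]
    unfold pp; fun_prop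
  | succ k ih =>
    intro e he
    obtain ⟨e, rfl⟩ : ∃ e', e = e' + 2 := ⟨e - 2, by omega⟩
    rw [show ((k + 1 : ℕ) : WithTop ℕ∞) = (k : WithTop ℕ∞) + 1 by push_cast; rfl, contDiff_succ_iff_deriv]
    refine ⟨fun u => (pp_deriv e u).differentiableAt, by simp, ?_⟩
    have : deriv (pp (e+2)) = fun u => (e+2) * pp (e+1) u := by
      funext u; exact (pp_deriv e u).deriv
    rw [this]
    exact contDiff_const.mul (ih _ (by omega))

def qq (s : Finset κ) (y : κ → ℝ) : ℝ := ∑ j ∈ Finset.univ.filter (· ∉ s), y j ^ 2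

lemma qq_nonneg (s : Finset κ) (y : κ → ℝ) : 0 ≤ qq s y := Finset.sum_nonneg fun _ _ => sq_nonneg _

lemma qq_coord {s : Finset κ} {y : κ → ℝ} {j : κ} (hj : j ∉ s) : y j ^ 2 ≤ qq s y :=
  Finset.single_le_sum (f := fun j => y j ^ 2) (fun _ _ => sq_nonneg _) (by simp [hj])

lemma qq_pos {s : Finset κ} {x y : κ → ℝ} (h : ag s y x) (hne : x ≠ y) : 0 < qq s (x - y) := by
  obtain ⟨j, hj⟩ := Function.ne_iff.1 hne
  have hjs : j ∉ s := fun hjs => hj (h j hjs).symm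
  have : 0 < (x - y) j ^ 2 := by
    have : (x - y) j ≠ 0 := sub_ne_zero.2 hj
    positivity
  exact this.trans_le (qq_coord hjs)

lemma qq_cd {n : WithTop ℕ∞} (s : Finset κ) : ContDiff ℝ n (qq s) := by
  unfold qq
  apply ContDiff.sum
  intro j _
  exact (contDiff_apply ℝ ℝ j).pow 2

lemma qq_df [OF L] (s : Finset κ) : DF L (qq s) := DF.sum _ fun j => (DF.id.app j).pow 2

lemma DF.vsub [OF L] {X : Type} [DSp X] {f g : X → κ → ℝ} (hf : DF L f) (hg : DF L g) :
    DF L (fun x => f x - g x) := DF.pi fun i => (hf.app i).sub (hg.app i)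

lemma qq_dist {s : Finset κ} {x y : κ → ℝ} (h : ag s y x) {r : ℝ} (hr : 0 ≤ r) (hq : qq s (x - y) ≤ r ^ 2) :
    dist x y ≤ r := by
  rw [dist_pi_le_iff hr]
  intro j
  by_cases hj : j ∈ s
  · rw [h j hj, dist_self]; exact hr
  · rw [Real.dist_eq]
    have := (qq_coord hj).trans hq
    exact abs_le_of_sq_le_sq this hr

def G1 (A B : Set (κ → ℝ)) (s : Finset κ) (x : κ → ℝ) (η : ℝ) : Prop :=
  (∀ y, (y ∈ B ∧ ag s y x) → 4 * η ^ 2 ≤ qq s (x - y)) ∧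
  ∀ y z, (y ∈ A ∧ ag s y x ∧ qq s (x - y) < 4 * η ^ 2) → (z ∈ A ∧ ag s z x ∧ qq s (x - z) < 4 * η ^ 2) → y = z

lemma G1_def [OF L] {A B : Set (κ → ℝ)} (hA : DP L (· ∈ A)) (hB : DP L (· ∈ B)) (s : Finset κ) :
    DP L (fun q : (κ → ℝ) × ℝ => G1 A B s q.1 q.2) := by
  apply DP.and
  · apply DP.all
    exact ((hB.comp DF.snd').and (DP.ag DF.snd' DF.fst'.fst)).imp
      (DP.le ((DF.const 4).mul (DF.fst'.snd.pow 2)) ((qq_df s).comp (DF.fst'.fst.vsub DF.snd')))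
  · apply DP.all
    apply DP.all
    apply DP.imp
    · exact (hA.comp DF.fst'.snd).and ((DP.ag DF.fst'.snd DF.fst'.fst.fst).and
        (DP.lt ((qq_df s).comp (DF.fst'.fst.fst.vsub DF.fst'.snd)) ((DF.const 4).mul (DF.fst'.fst.snd.pow 2))))
    · apply DP.imp
      · exact (hA.comp DF.snd').and ((DP.ag DF.snd' DF.fst'.fst.fst).and
          (DP.lt ((qq_df s).comp (DF.fst'.fst.fst.vsub DF.snd')) ((DF.const 4).mul (DF.fst'.fst.snd.pow 2))))
      · exact DP.eq DF.fst'.snd DF.snd'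

lemma G1_down {A B : Set (κ → ℝ)} {s : Finset κ} (x : κ → ℝ) (a b : ℝ) (hb : 0 < b) (hab : b ≤ a)
    (h : G1 A B s x a) : G1 A B s x b := by
  have : 4 * b ^ 2 ≤ 4 * a ^ 2 := by gcongr
  refine ⟨fun y hy => this.trans (h.1 y hy), fun y z hy hz => h.2 y z ⟨hy.1, hy.2.1, hy.2.2.trans_le this⟩
    ⟨hz.1, hz.2.1, hz.2.2.trans_le this⟩⟩

lemma G1_loc (p : ℕ) {A : Set (κ → ℝ)} (hAc : IsClosed A) {s : Finset κ} {x : κ → ℝ}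
    (hx : x ∉ {x | x ∈ A ∧ ¬ Reg p A s x}) :
    ∃ c > 0, ∀ᶠ x' in 𝓝 x, G1 A {x | x ∈ A ∧ ¬ Reg p A s x} s x' c := by
  have key : ∃ r > 0, (∀ y ∈ Metric.ball x r, y ∉ {x | x ∈ A ∧ ¬ Reg p A s x}) ∧
      ∀ x' ∈ Metric.ball x r, ∀ y ∈ Metric.ball x r, ∀ z ∈ Metric.ball x r, y ∈ A → z ∈ A → ag s y x' →
        ag s z x' → y = z := by
    by_cases hxA : x ∈ A
    · have hR : Reg p A s x := by
        by_contra h; exact hx ⟨hxA, h⟩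
      have ho := Reg_open p hR
      obtain ⟨-, c, ε, hε, h1, h2, h3⟩ := hR
      obtain ⟨r, hr, hb⟩ := Metric.eventually_nhds_iff_ball.1 (ho.and ((Inn_ev h1).and h2))
      refine ⟨r, hr, fun y hy hyB => hyB.2 ((hb y hy).1 hyB.1), ?_⟩
      intro x' hx' y hy z hz hyA hzA hyx hzx
      exact (hb x' hx').2.2.unique ⟨hyA, hyx, (hb y hy).2.1⟩ ⟨hzA, hzx, (hb z hz).2.1⟩
    · obtain ⟨r, hr, hb⟩ := Metric.eventually_nhds_iff_ball.1 (hAc.isOpen_compl.mem_nhds hxA)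
      refine ⟨r, hr, fun y hy hyB => hb y hy hyB.1, ?_⟩
      intro x' hx' y hy z hz hyA
      exact (hb y hy hyA).elim
  obtain ⟨r, hr, k1, k2⟩ := key
  refine ⟨r/8, by positivity, ?_⟩
  filter_upwards [Metric.ball_mem_nhds x (half_pos hr)] with x' hx'
  have hin : ∀ y, ag s y x' → qq s (x' - y) < 4 * (r/8) ^ 2 → y ∈ Metric.ball x r := by
    intro y hy hq
    have := qq_dist hy (show 0 ≤ r/4 by positivity) (by nlinarith)
    rw [Metric.mem_ball] at hx' ⊢
    have h2 := dist_triangle y x' x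
    rw [dist_comm y x'] at h2
    linarith
  have hx'r : x' ∈ Metric.ball x r := Metric.ball_subset_ball (by linarith) hx'
  constructor
  · rintro y ⟨hyB, hy⟩
    by_contra hcon
    exact k1 y (hin y hy (not_le.1 hcon)) hyB
  · rintro y z ⟨h1, h2, h3⟩ ⟨h4, h5, h6⟩
    exact k2 x' hx'r y (hin y h2 h3) z (hin z h5 h6) h1 h4 h2 h5

def WW (A : Set (κ → ℝ)) (s : Finset κ) (δ : (κ → ℝ) → ℝ) (x y : κ → ℝ) : Prop :=
  y ∈ A ∧ ag s y x ∧ qq s (x - y) < 4 * δ x ^ 2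

def TT (p : ℕ) (A : Set (κ → ℝ)) (s : Finset κ) (δ : (κ → ℝ) → ℝ) (x : κ → ℝ) : ℝ :=
  if h : ∃ y, WW A s δ x y then pp (p+1) (δ x ^ 2 - qq s (x - h.choose)) else 0

lemma TT_eq (p : ℕ) {A : Set (κ → ℝ)} {s : Finset κ} {δ : (κ → ℝ) → ℝ} {x y : κ → ℝ}
    (hu : ∀ y z, WW A s δ x y → WW A s δ x z → y = z) (h : WW A s δ x y) :
    TT p A s δ x = pp (p+1) (δ x ^ 2 - qq s (x - y)) := by
  have h' : ∃ y, WW A s δ x y := ⟨y, h⟩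
  unfold TT
  rw [dif_pos h', hu _ _ h'.choose_spec h]

lemma WW_def [OF L] {A : Set (κ → ℝ)} (hA : DP L (· ∈ A)) (s : Finset κ) {δ : (κ → ℝ) → ℝ} (hδ : DF L δ) :
    DP L (fun q : (κ → ℝ) × (κ → ℝ) => WW A s δ q.1 q.2) :=
  (hA.comp DF.snd').and ((DP.ag DF.snd' DF.fst').and
    (DP.lt ((qq_df s).comp (DF.fst'.vsub DF.snd')) ((DF.const 4).mul ((hδ.comp DF.fst').pow 2))))

lemma DF.pp [OF L] {X : Type} [DSp X] {f : X → ℝ} (hf : DF L f) (e : ℕ) : DF L (fun x => pp e (f x)) :=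
  (hf.max (DF.const 0)).pow e

lemma TT_def [OF L] (p : ℕ) {A : Set (κ → ℝ)} (hA : DP L (· ∈ A)) (s : Finset κ) {δ : (κ → ℝ) → ℝ} (hδ : DF L δ)
    (hu : ∀ x y z, WW A s δ x y → WW A s δ x z → y = z) : DF L (TT p A s δ) := by
  have hW := WW_def hA s hδ
  apply DF.of (P := fun x v => (∃ y, WW A s δ x y ∧ v = pp (p+1) (δ x ^ 2 - qq s (x - y))) ∨
    ((¬ ∃ y, WW A s δ x y) ∧ v = 0))
  · apply DP.or
    · apply DP.ex
      exact (hW.comp (DF.fst'.fst.pair DF.snd')).and (DP.eq DF.fst'.snd (DF.pp (((hδ.comp DF.fst'.fst).pow 2).sub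
        ((qq_df s).comp (DF.fst'.fst.vsub DF.snd'))) _))
    · exact ((DP.ex hW).comp DF.fst').not.and (DP.eq DF.snd' (DF.const 0))
  · intro x v
    by_cases h : ∃ y, WW A s δ x y
    · obtain ⟨y, hy⟩ := h
      rw [TT_eq p (hu x) hy]
      constructor
      · intro e; exact Or.inl ⟨y, hy, e⟩
      · rintro (⟨z, hz, e⟩ | ⟨h, -⟩)
        · rw [e, hu x z y hz hy]
        · exact (h ⟨y, hy⟩).elim
    · have : TT p A s δ x = 0 := by unfold TT; rw [dif_neg h]
      rw [this]
      constructor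
      · intro e; exact Or.inr ⟨h, e⟩
      · rintro (⟨z, hz, e⟩ | ⟨-, e⟩)
        · exact (h ⟨z, hz⟩).elim
        · exact e

lemma ag_closed (s : Finset κ) : IsClosed {q : (κ → ℝ) × (κ → ℝ) | ag s q.2 q.1} := by
  unfold ag
  simp only [setOf_forall]
  apply isClosed_iInter; intro i
  apply isClosed_iInter; intro _
  exact isClosed_eq (by fun_prop) (by fun_prop)

lemma TT_far (p : ℕ) {A : Set (κ → ℝ)} (hAc : IsClosed A) {s : Finset κ} {δ : (κ → ℝ) → ℝ} (hδ : Continuous δ) {x : κ → ℝ}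
    (hpos : 0 < δ x)
    (hx : ¬ ∃ y, WW A s δ x y) : ∀ᶠ x' in 𝓝 x, TT p A s δ x' = 0 := by
  have hev : ∀ᶠ x' in 𝓝 x, ∀ y, y ∈ A → ag s y x' → ¬ qq s (x' - y) ≤ δ x' ^ 2 := by
    have hK := isCompact_closedBall x (δ x + 2)
    have hcl : IsClosed {q : (κ → ℝ) × (κ → ℝ) | q.2 ∈ A ∧ ag s q.2 q.1 ∧ qq s (q.1 - q.2) ≤ δ q.1 ^ 2} := by
      have h3 : IsClosed {q : (κ → ℝ) × (κ → ℝ) | qq s (q.1 - q.2) ≤ δ q.1 ^ 2} := by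
        apply isClosed_le
        · exact (qq_cd (n := 0) s).continuous.comp (continuous_fst.sub continuous_snd)
        · exact (hδ.comp continuous_fst).pow 2
      exact (hAc.preimage continuous_snd).inter ((ag_closed s).inter h3)
    have h1 := hK.eventually_forall_of_forall_eventually (x₀ := x)
      (P := fun x' y => ¬ (y ∈ A ∧ ag s y x' ∧ qq s (x' - y) ≤ δ x' ^ 2)) (by
      intro y _
      apply hcl.isOpen_compl.mem_nhds
      rintro ⟨h1, h2, h3⟩
      have h3 : qq s (x - y) ≤ δ x ^ 2 := h3
      exact hx ⟨y, h1, h2, by nlinarith⟩)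
    have h2 : ∀ᶠ x' in 𝓝 x, δ x' < δ x + 1 := hδ.continuousAt.eventually (eventually_lt_nhds (by linarith))
    have h3 : ∀ᶠ x' in 𝓝 x, 0 < δ x' := hδ.continuousAt.eventually (eventually_gt_nhds hpos)
    filter_upwards [h1, h2, h3, Metric.ball_mem_nhds x one_pos] with x' a1 a2 a3 a4 y hyA hy hq
    refine a1 y ?_ ⟨hyA, hy, hq⟩
    have h5 := qq_dist hy a3.le hq
    rw [Metric.mem_ball] at a4
    rw [Metric.mem_closedBall]
    have h2 := dist_triangle y x' x
    rw [dist_comm y x'] at h2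
    linarith
  filter_upwards [hev] with x' hx'
  unfold TT
  split_ifs with h
  · have h1 := h.choose_spec
    have h2 := hx' _ h1.1 h1.2.1
    unfold pp
    rw [max_eq_right (by linarith), zero_pow (by omega)]
  · rfl

lemma TT_near (p : ℕ) {A : Set (κ → ℝ)} {s : Finset κ} {δ : (κ → ℝ) → ℝ} (hδ : ContDiff ℝ p δ) {x y0 : κ → ℝ}
    (hu : ∀ x y z, WW A s δ x y → WW A s δ x z → y = z)
    (hx : WW A s δ x y0) (hR : Reg p A s y0) : ContDiffAt ℝ p (TT p A s δ) x := by
  obtain ⟨hA, c, ε, hε, h1, h2, h3⟩ := hR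
  have hag : ag s y0 x := hx.2.1
  have h2' : ∀ᶠ x' in 𝓝 x, ∃! y, U1 A s c ε x' y :=
    cyl (P := fun x' => ∃! y, U1 A s c ε x' y) (fun a b hab h => by rwa [← U1_ag hab]) hag h2
  have h3' : ∀ j, ContDiffAt ℝ p (fun x' => sec A s c ε x' j) x := by
    intro j
    have e : (fun x' => sec A s c ε x' j) = (fun x' => sec A s c ε x' j) ∘ (Tm s y0) := by
      funext z
      simp only [Function.comp_def]
      rw [sec_ag (Tm_ag s y0 z)]
    rw [e]
    apply ContDiffAt.comp
    · rw [Tm_eq hag]; exact h3 j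
    · exact (Tm_cd s y0).contDiffAt
  have hsec : ContDiffAt ℝ p (sec A s c ε) x := contDiffAt_pi.2 h3'
  have hsx : sec A s c ε x = y0 := sec_eq h2'.self_of_nhds ⟨hA, hag, h1⟩
  have hdiff : ContDiffAt ℝ p (fun x' => qq s (x' - sec A s c ε x')) x :=
    (qq_cd s).contDiffAt.comp x (contDiffAt_id.sub hsec)
  have hlt : ∀ᶠ x' in 𝓝 x, qq s (x' - sec A s c ε x') < 4 * δ x' ^ 2 := by
    apply hdiff.continuousAt.eventually_lt (continuousAt_const.mul (hδ.continuous.continuousAt.pow 2))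
    rw [hsx]; exact hx.2.2
  have hcd : ContDiffAt ℝ p (fun x' => pp (p+1) (δ x' ^ 2 - qq s (x' - sec A s c ε x'))) x :=
    (pp_cd p (p+1) le_rfl).contDiffAt.comp x ((hδ.contDiffAt.pow 2).sub hdiff)
  apply hcd.congr_of_eventuallyEq
  filter_upwards [h2', hlt] with z hz1 hz2
  have hs := sec_spec hz1
  exact TT_eq p (hu z) ⟨hs.1, hs.2.1, hz2⟩

def HasF (L : FirstOrder.Language) [L.Structure ℝ] (p : ℕ) (A : Set (κ → ℝ)) : Prop :=
  ∃ f : (κ → ℝ) → ℝ, DF L f ∧ ContDiff ℝ p f ∧ ∀ x, f x = 0 ↔ x ∈ A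

lemma step [DM L] (p : ℕ) (A : Set (κ → ℝ)) (s : Finset κ) (hA : DP L (· ∈ A)) (hAc : IsClosed A)
    (hB : HasF L p {x | x ∈ A ∧ ¬ Reg p A s x}) : HasF L p A := by
  have hBd : DP L (· ∈ {x | x ∈ A ∧ ¬ Reg p A s x}) := hA.and (DP.Reg p hA s).not
  have hBc : IsClosed {x | x ∈ A ∧ ¬ Reg p A s x} := Reg_closed p hAc
  have hloc := fun x hx => G1_loc p hAc (s := s) (x := x) hx
  have hBA : ∀ x ∈ {x | x ∈ A ∧ ¬ Reg p A s x}, x ∈ A := fun x hx => hx.1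
  have hBR : ∀ x ∈ A, x ∉ {x | x ∈ A ∧ ¬ Reg p A s x} → Reg p A s x := by
    intro x hx h
    by_contra h'; exact h ⟨hx, h'⟩
  set B := {x | x ∈ A ∧ ¬ Reg p A s x} with hBdef
  clear_value B
  obtain ⟨g, hgd, hgc, hgz⟩ := hB
  obtain ⟨δ, hδd, hδc, hδ0, hδ1⟩ := delta p hgd hgc (G1_def hA hBd s) G1_down
    (fun x hx => hloc x (fun h => hx ((hgz x).2 h)))
  have hu : ∀ x y z, WW A s δ x y → WW A s δ x z → y = z := by
    intro x y z hy hz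
    by_cases hx : g x = 0
    · have := hy.2.2
      rw [hδ0 x hx] at this
      have := qq_nonneg s (x - y)
      linarith
    · exact (hδ1 x hx).2.2 y z hy hz
  set F : (κ → ℝ) → ℝ := fun x => pp (p+1) (δ x ^ 2) - TT p A s δ x with hF
  have hFd : DF L F := (DF.pp (hδd.pow 2) _).sub (TT_def p hA s hδd hu)
  have hFz : ∀ x ∉ B, (F x = 0 ↔ x ∈ A) := by
    intro x hx
    have hgx : g x ≠ 0 := fun h => hx ((hgz x).1 h)
    have hdx := (hδ1 x hgx).1
    constructor
    · intro h
      by_contra hxA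
      by_cases hW : ∃ y, WW A s δ x y
      · obtain ⟨y, hy⟩ := hW
        simp only [hF] at h
        rw [TT_eq p (hu x) hy] at h
        have hq : 0 < qq s (x - y) := qq_pos hy.2.1 (fun e => hxA (e ▸ hy.1))
        have : pp (p+1) (δ x ^ 2 - qq s (x - y)) < pp (p+1) (δ x ^ 2) := by
          unfold pp
          apply pow_lt_pow_left₀ _ (le_max_right _ _) (by omega)
          have : 0 < δ x ^ 2 := by positivity
          rw [max_eq_left this.le]
          exact max_lt (by linarith) this
        linarith
      · simp only [hF, TT] at h
        rw [dif_neg hW] at h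
        have : 0 < pp (p+1) (δ x ^ 2) := by
          unfold pp
          have : 0 < δ x ^ 2 := by positivity
          rw [max_eq_left this.le]
          positivity
        linarith
    · intro hxA
      have e : qq s (x - x) = 0 := by rw [sub_self]; simp [qq]
      have hW : WW A s δ x x := ⟨hxA, fun _ _ => rfl, by rw [e]; positivity⟩
      simp only [hF]
      rw [TT_eq p (hu x) hW, e, sub_zero, sub_self]
  have hFc : ∀ x ∉ B, ContDiffAt ℝ p F x := by
    intro x hx
    have hgx : g x ≠ 0 := fun h => hx ((hgz x).1 h)
    obtain ⟨hdx, hG⟩ := hδ1 x hgx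
    have h1 : ContDiffAt ℝ p (fun x => pp (p+1) (δ x ^ 2)) x :=
      (pp_cd p (p+1) le_rfl).contDiffAt.comp x (hδc.contDiffAt.pow 2)
    apply h1.sub
    by_cases hW : ∃ y, WW A s δ x y
    · obtain ⟨y, hy⟩ := hW
      refine TT_near p hδc hu hy (hBR y hy.1 fun hyB => ?_)
      have := hG.1 y ⟨hyB, hy.2.1⟩
      linarith [hy.2.2]
    · exact (contDiffAt_const (c := (0:ℝ))).congr_of_eventuallyEq (TT_far p hAc hδc.continuous hdx hW)
  obtain ⟨d, hdd, hdc, hd0, hd1⟩ := delta p hgd hgc (Gd_def hgd p hFd) (Gd_down p) (by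
    intro x hx
    have hxB : x ∉ B := fun h => hx ((hgz x).2 h)
    have := (Gd_loc hgc.continuous p hx (hFc x hxB)).and self_mem_nhdsWithin
    obtain ⟨c, hc, hc0⟩ := this.exists
    exact ⟨c, hc0, hc⟩)
  refine ⟨fun x => d x ^ (p+1) * F x, (hdd.pow _).mul hFd, ?_, ?_⟩
  · exact soft hBc hgc.continuous (fun x hx => (hgz x).2 hx) hdc (fun x hx => hd0 x ((hgz x).2 hx)) p le_rfl F (p+1)
      hFc (fun x hx => (hd1 x (fun h => hx ((hgz x).1 h))).2) le_rfl
  · intro x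
    by_cases hx : x ∈ B
    · have := hd0 x ((hgz x).2 hx)
      simp only [this, hBA x hx, iff_true]
      rw [zero_pow (by omega), zero_mul]
    · have h1 := (hd1 x (fun h => hx ((hgz x).1 h))).1
      rw [mul_eq_zero, or_iff_right (pow_pos h1 _).ne']
      exact hFz x hx

lemma hasF_all [DM L] (p : ℕ) (A : Set (κ → ℝ)) (hA : DP L (· ∈ A)) (hAc : IsClosed A) : HasF L p A :=
  main_ind p (HasF L p) ⟨fun _ => 1, DF.const 1, contDiff_const, fun x => by simp⟩ (step p) _ A hA hAc rfl

end stepsec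

/-- every definable closed set is the zero set of a definable `C^p`
function. -/
theorem stmt15 (L : FirstOrder.Language) [L.Structure ℝ] (hL : DMinimal L) (p n : ℕ)
    (hp : 1 ≤ p) (A : Set (Fin n → ℝ)) (hAdef : IsDef L A) (hAc : IsClosed A) :
    ∃ f : (Fin n → ℝ) → ℝ, IsDefFunOn L Set.univ f ∧ ContDiff ℝ p f ∧
      {x | f x = 0} = A := by
  haveI : DM L := ⟨hL⟩
  obtain ⟨f, h1, h2, h3⟩ := hasF_all (L := L) p A hAdef hAc
  refine ⟨f, ?_, h2, Set.ext h3⟩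
  have e : {z : (Fin n ⊕ Unit) → ℝ | (fun i => z (Sum.inl i)) ∈ (Set.univ : Set (Fin n → ℝ)) ∧
      z (Sum.inr ()) = f (fun i => z (Sum.inl i))} =
      {z : (Fin n ⊕ Unit) → ℝ | z (Sum.inr ()) = f (fun i => z (Sum.inl i))} := by
    ext z
    exact ⟨fun h => h.2, fun h => ⟨trivial, h⟩⟩
  unfold IsDefFunOn
  rw [e]
  exact h1

end DMinPaper
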